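/- For every permutation w ∈ S_n, the lattice PD(w) is semidistributive: it is both meet-semidistributive and join-semidistributive. -/

import Mathlib

open Classical

noncomputable section

/-- 1-based value of a permutation of `Fin n` at a 1-based position `j`. -/
def permVal {n : ℕ} (w : Equiv.Perm (Fin n)) (j : ℕ) : ℕ :=
  if h : 1 ≤ j ∧ j ≤ n then (w ⟨j - 1, by omega⟩ : ℕ) + 1 else 0

/-- `(i,j)` is an inversion of `w`: `1 ≤ i < j ≤ n` and the (1-based) position of the
value `j` in the one-line notation of `w` precedes that of `i`. -/
def IsInv {n : ℕ} (w : Equiv.Perm (Fin n)) (i j : ℕ) : Prop :=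
  1 ≤ i ∧ i < j ∧ j ≤ n ∧ permVal w.symm j < permVal w.symm i

/-- Lehmer form entry at box `(i,j)`: the number of `k ∈ [1, T(i,j)-1]` that do not
appear below box `(i,j)` in column `j`. -/
def lehmer (T : ℕ → ℕ → ℕ) (i j : ℕ) : ℕ :=
  ((Finset.Ico 1 (T i j)).filter fun k => ∀ i', 1 ≤ i' → i' < i → T i' j ≠ k).card

/-- Incrementing box `(i,j)` of `T` yields `T'`:  with `a = T(i,j)` and `b` the smallest
integer greater than `a` not appearing below `(i,j)` in column `j`, either a pure
increment (if `b` is absent from column `j`) or a trade increment (swap `a` and `b`). -/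
def IncrementAt (T T' : ℕ → ℕ → ℕ) (i j : ℕ) : Prop :=
  ∃ b, T i j < b ∧
    (∀ k, T i j < k → k < b → ∃ i', 1 ≤ i' ∧ i' < i ∧ T i' j = k) ∧
    (∀ i', 1 ≤ i' → i' < i → T i' j ≠ b) ∧
    (((∀ i', 1 ≤ i' → T i' j ≠ b) ∧
        T' = fun a c => if a = i ∧ c = j then b else T a c) ∨
      (∃ i'', i < i'' ∧ T i'' j = b ∧
        T' = fun a c =>
          if a = i ∧ c = j then b else if a = i'' ∧ c = j then T i j else T a c))

/-- `IncBy M T T'`: `T'` is obtained from `T` by incrementing each box of the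
multiset `M` (with multiplicity). -/
inductive IncBy : Multiset (ℕ × ℕ) → (ℕ → ℕ → ℕ) → (ℕ → ℕ → ℕ) → Prop
  | nil (T : ℕ → ℕ → ℕ) : IncBy 0 T T
  | cons {M : Multiset (ℕ × ℕ)} {T T' T'' : ℕ → ℕ → ℕ} {i j : ℕ} :
      IncrementAt T T' i j → IncBy M T' T'' → IncBy ((i, j) ::ₘ M) T T''

/-- Column-injective tableau for `w`: a box has a nonzero entry iff it is an inversion
of `w`, and the nonzero entries in each column are distinct. -/
def ColInj {n : ℕ} (w : Equiv.Perm (Fin n)) (T : ℕ → ℕ → ℕ) : Prop :=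
  (∀ i j, T i j ≠ 0 ↔ IsInv w i j) ∧
  ∀ i i' j, 1 ≤ i → i < i' → i' < j → T i j ≠ 0 → T i' j ≠ 0 → T i j ≠ T i' j

/-- The Λ-shape `Λ(i,j,k)` is balanced in `T`. -/
def LBal (T : ℕ → ℕ → ℕ) (i j k : ℕ) : Prop :=
  min (T i j) (T j k) ≤ T i k ∧ T i k ≤ max (T i j) (T j k)

/-- Every Λ-shape of `Δ_{n-1}` is balanced in `T`. -/
def BalancedTab (n : ℕ) (T : ℕ → ℕ → ℕ) : Prop :=
  ∀ i j k, 1 ≤ i → i < j → j < k → k ≤ n → LBal T i j k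

/-- Inversions tableau for `w`: balanced column-injective tableau whose entries in
row `i` are at most `i`. -/
def InvTab {n : ℕ} (w : Equiv.Perm (Fin n)) (T : ℕ → ℕ → ℕ) : Prop :=
  ColInj w T ∧ BalancedTab n T ∧ ∀ i j, T i j ≤ i

/-- The multiset of entries of `T` on `hook(i,k)`. -/
def hookEntries (T : ℕ → ℕ → ℕ) (i k : ℕ) : Multiset ℕ :=
  (T i k ::ₘ (Finset.Ioo i k).val.map fun r => T r k) +
    (Finset.Ioo i k).val.map fun c => T i c

/-- The median ((k-i)-th smallest of the `2(k-i)-1` entries) of the hook of `(i,k)`. -/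
def hookMedian (T : ℕ → ℕ → ℕ) (i k : ℕ) : ℕ :=
  ((hookEntries T i k).sort (· ≤ ·)).getD (k - i - 1) 0

/-! ## Pipe dreams

A pipe dream in the staircase `Δ_n` is encoded by `P : ℕ → ℕ → Bool`, where
`P i j = true` means box `(i,j)` (row `i` from the top, column `j` from the left,
with `1 ≤ i, j` and `i + j ≤ n`) is a cross tile, and `false` means a bump tile;
boxes on the southeast boundary (`i + j = n + 1`) are elbow tiles. -/

/-- `labels n P i j` is the pair (label of the north edge, label of the east edge) of
the pipes passing through box `(i,j)`:  pipes enter at row `k` on the west side with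
label `k` and propagate through cross, bump and elbow tiles. -/
def labels (n : ℕ) (P : ℕ → ℕ → Bool) (i j : ℕ) : ℕ × ℕ :=
  let west := if _h1 : j ≤ 1 then i else (labels n P i (j - 1)).2
  if _h : i + j ≤ n then
    if P i j then ((labels n P (i + 1) j).1, west)
    else (west, (labels n P (i + 1) j).1)
  else (west, west)
termination_by (n + 1 - i) + j
decreasing_by all_goals omega

def northLabel (n : ℕ) (P : ℕ → ℕ → Bool) (i j : ℕ) : ℕ := (labels n P i j).1

def westLabel (n : ℕ) (P : ℕ → ℕ → Bool) (i j : ℕ) : ℕ :=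
  if j ≤ 1 then i else (labels n P i (j - 1)).2

def southLabel (n : ℕ) (P : ℕ → ℕ → Bool) (i j : ℕ) : ℕ := (labels n P (i + 1) j).1

/-- Pipes `p` and `q` cross at box `(i,j)` of `P`. -/
def CrossAt (n : ℕ) (P : ℕ → ℕ → Bool) (i j p q : ℕ) : Prop :=
  1 ≤ i ∧ 1 ≤ j ∧ i + j ≤ n ∧ P i j = true ∧
    ((westLabel n P i j = p ∧ southLabel n P i j = q) ∨
      (westLabel n P i j = q ∧ southLabel n P i j = p))

/-- `P` is a pipe dream for `w`: crosses lie in the staircase, and reading the pipe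
labels along the north side gives the one-line notation of `w`. -/
def IsPD {n : ℕ} (w : Equiv.Perm (Fin n)) (P : ℕ → ℕ → Bool) : Prop :=
  (∀ i j, P i j = true → 1 ≤ i ∧ 1 ≤ j ∧ i + j ≤ n) ∧
    ∀ j, 1 ≤ j → j ≤ n → northLabel n P 1 j = permVal w j

/-- `P` is reduced: no two pipes cross more than once. -/
def Reduced (n : ℕ) (P : ℕ → ℕ → Bool) : Prop :=
  ∀ p q i j i' j', CrossAt n P i j p q → CrossAt n P i' j' p q → i = i' ∧ j = j'

/-- The set of reduced pipe dreams for `w`. -/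
def RPD {n : ℕ} (w : Equiv.Perm (Fin n)) :=
  { P : ℕ → ℕ → Bool // IsPD w P ∧ Reduced n P }

/-- `R` is a rectangle (rows `a < b`, columns `c < d`) in which a chute move of `P`
can take place: `NW(R)=(a,c)` and `SW(R)=(b,c)` are bumps, `SE(R)=(b,d)` is a bump or
elbow, and all other boxes of `R` are crosses. -/
def IsChuteRect (n : ℕ) (P : ℕ → ℕ → Bool) (a b c d : ℕ) : Prop :=
  1 ≤ a ∧ a < b ∧ 1 ≤ c ∧ c < d ∧ b + d ≤ n + 1 ∧
    P a c = false ∧ P b c = false ∧ P b d = false ∧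
    ∀ i j, a ≤ i → i ≤ b → c ≤ j → j ≤ d →
      ¬(i = a ∧ j = c) → ¬(i = b ∧ j = c) → ¬(i = b ∧ j = d) → P i j = true

/-- The result of the chute move in the rectangle with corners `(a,c)`, `(b,d)`:
the bump at `SW=(b,c)` becomes a cross and the cross at `NE=(a,d)` becomes a bump. -/
def chuteResult (P : ℕ → ℕ → Bool) (a b c d : ℕ) : ℕ → ℕ → Bool :=
  fun i j => if i = b ∧ j = c then true else if i = a ∧ j = d then false else P i j

/-- `P'` is obtained from `P` by a single chute move. -/
def ChuteStep (n : ℕ) (P P' : ℕ → ℕ → Bool) : Prop :=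
  ∃ a b c d, IsChuteRect n P a b c d ∧ P' = chuteResult P a b c d

/-- The chute move order on `RPD w`: `P ≤ Q` iff `Q` is obtained from `P`
by a sequence of chute moves. -/
def chuteLE {n : ℕ} (w : Equiv.Perm (Fin n)) (P Q : RPD w) : Prop :=
  Relation.ReflTransGen (fun X Y : RPD w => ChuteStep n X.1 Y.1) P Q

/-- `theta n P p q` is the index of the row in which pipes `p` and `q` cross in `P`
(`0` if they do not cross).  For `P ∈ PD(w)` reduced, `theta n P` is the inversions
tableau `Θ(P)`. -/
def theta (n : ℕ) (P : ℕ → ℕ → Bool) (p q : ℕ) : ℕ :=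
  if h : ∃ rc : ℕ × ℕ, CrossAt n P rc.1 rc.2 p q then (Classical.choose h).1 else 0

/-- The Lehmer tableau `Φ(P) = Λ(Θ(P))` of a pipe dream. -/
def phi (n : ℕ) (P : ℕ → ℕ → Bool) (i j : ℕ) : ℕ := lehmer (theta n P) i j

/-- Cover relation of the chute move order. -/
def chuteCovBy {n : ℕ} (w : Equiv.Perm (Fin n)) (P Q : RPD w) : Prop :=
  chuteLE w P Q ∧ P ≠ Q ∧ ∀ R, chuteLE w P R → chuteLE w R Q → R = P ∨ R = Q

/-- The interval `[P, Q]` in the chute move order. -/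
def chuteIcc {n : ℕ} (w : Equiv.Perm (Fin n)) (P Q : RPD w) : Set (RPD w) :=
  { R | chuteLE w P R ∧ chuteLE w R Q }

/-- A chain in the chute move order. -/
def chuteChain {n : ℕ} (w : Equiv.Perm (Fin n)) (C : Set (RPD w)) : Prop :=
  ∀ x ∈ C, ∀ y ∈ C, chuteLE w x y ∨ chuteLE w y x

/-- `[P,Q]` is a polygon: an interval of cardinality at least 4 that is the union of
two chains whose intersection is `{P, Q}`. -/
def IsPolygon {n : ℕ} (w : Equiv.Perm (Fin n)) (P Q : RPD w) : Prop :=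
  chuteLE w P Q ∧ 4 ≤ (chuteIcc w P Q).ncard ∧
    ∃ C₁ C₂ : Set (RPD w), chuteChain w C₁ ∧ chuteChain w C₂ ∧
      C₁ ∪ C₂ = chuteIcc w P Q ∧ C₁ ∩ C₂ = {P, Q}

/-- `m` is the meet (greatest lower bound) of `P` and `Q` in the chute move order. -/
def IsMeetOf {n : ℕ} (w : Equiv.Perm (Fin n)) (m P Q : RPD w) : Prop :=
  chuteLE w m P ∧ chuteLE w m Q ∧ ∀ r, chuteLE w r P → chuteLE w r Q → chuteLE w r m

/-- `s` is the join (least upper bound) of `P` and `Q` in the chute move order. -/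
def IsJoinOf {n : ℕ} (w : Equiv.Perm (Fin n)) (s P Q : RPD w) : Prop :=
  chuteLE w P s ∧ chuteLE w Q s ∧ ∀ r, chuteLE w P r → chuteLE w Q r → chuteLE w s r

/-- Number `r` shifted by how many of `f 0, …, f (j - 1)` are at least `r`. -/
def shift (f : ℕ → ℕ) (j r : ℕ) : ℕ := r + ((Finset.range j).filter fun x => r ≤ f x).card

lemma shift_succ_of_forall_ne {f : ℕ → ℕ} {j r : ℕ} (h : ∀ x < j, f x ≠ r) :
    shift f j (r + 1) = shift f j r + 1 := by
  have : ((Finset.range j).filter fun x => r + 1 ≤ f x)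
      = ((Finset.range j).filter fun x => r ≤ f x) := by
    ext x
    simp only [Finset.mem_filter, Finset.mem_range]
    constructor
    · rintro ⟨h1, h2⟩; exact ⟨h1, by omega⟩
    · rintro ⟨h1, h2⟩
      have := h x h1
      exact ⟨h1, by omega⟩
  simp only [shift, this]; omega

lemma shift_succ_of_eq {f : ℕ → ℕ} {j r x : ℕ} (hx : x < j) (hr : f x = r)
    (hf : ∀ y < j, f y = r → y = x) : shift f j (r + 1) = shift f j r := by
  have : ((Finset.range j).filter fun x => r ≤ f x)
      = insert x ((Finset.range j).filter fun x => r + 1 ≤ f x) := by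
    ext y
    simp only [Finset.mem_filter, Finset.mem_range, Finset.mem_insert]
    constructor
    · rintro ⟨h1, h2⟩
      rcases Nat.eq_or_lt_of_le h2 with h3 | h3
      · exact Or.inl (hf y h1 h3.symm)
      · exact Or.inr ⟨h1, h3⟩
    · rintro (rfl | ⟨h1, h2⟩)
      · exact ⟨hx, hr.ge⟩
      · exact ⟨h1, by omega⟩
  rw [shift, shift, this, Finset.card_insert_of_notMem (by simp [hr])]
  omega

/-- Injectivity of `f` on `{0, …, j - 1}` away from the value `0`. -/
def NzInj (f : ℕ → ℕ) (j : ℕ) : Prop := ∀ x < j, ∀ y < j, f x = f y → f x ≠ 0 → x = y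

lemma shift_le_succ {f : ℕ → ℕ} {j r : ℕ} (hf : NzInj f j) (hr : r ≠ 0) :
    shift f j r ≤ shift f j (r + 1) := by
  by_cases h : ∃ x < j, f x = r
  · obtain ⟨x, hx, hxr⟩ := h
    exact (shift_succ_of_eq hx hxr fun y hy hyr =>
      hf y hy x hx (hyr.trans hxr.symm) (hyr ▸ hr)).ge
  · push Not at h
    rw [shift_succ_of_forall_ne h]; omega

lemma shift_mono {f : ℕ → ℕ} {j r s : ℕ} (hf : NzInj f j) (hr : r ≠ 0) (hrs : r ≤ s) :
    shift f j r ≤ shift f j s := by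
  induction s, hrs using Nat.le_induction with
  | base => exact le_rfl
  | succ s hs ih => exact ih.trans (shift_le_succ hf (by omega))

lemma shift_lt {f : ℕ → ℕ} {j r s : ℕ} (hf : NzInj f j) (hr : r ≠ 0) (hrs : r < s)
    (h : ∀ x < j, f x ≠ r) : shift f j r < shift f j s := by
  have := shift_mono hf (Nat.succ_ne_zero r) hrs
  rw [Nat.succ_eq_add_one, shift_succ_of_forall_ne h] at this
  omega

lemma shift_eq_of_forall_exists {f : ℕ → ℕ} {j r s : ℕ} (hf : NzInj f j) (hr : r ≠ 0)
    (hrs : r ≤ s) (h : ∀ t, r ≤ t → t < s → ∃ x < j, f x = t) : shift f j r = shift f j s := by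
  induction s, hrs using Nat.le_induction with
  | base => rfl
  | succ s hs ih =>
    obtain ⟨x, hx, hxs⟩ := h s hs (Nat.lt_succ_self s)
    rw [ih fun t h1 h2 => h t h1 (by omega), shift_succ_of_eq hx hxs fun y hy hys =>
      hf y hy x hx (hys.trans hxs.symm) (by omega)]

lemma shift_congr {f g : ℕ → ℕ} {j r : ℕ} (h : ∀ x < j, (r ≤ f x ↔ r ≤ g x)) :
    shift f j r = shift g j r := by
  unfold shift
  congr 2
  exact Finset.filter_congr fun x hx => h x (Finset.mem_range.1 hx)

/-- Splitting off the indices above `i` in `shift`. -/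
lemma shift_split {f : ℕ → ℕ} {i j r : ℕ} (hij : i < j) :
    shift f j r = shift f i r + (if r ≤ f i then 1 else 0)
      + ((Finset.Ioo i j).filter fun l => r ≤ f l).card := by
  have h1 : ((Finset.range j).filter fun x => r ≤ f x)
      = ((Finset.range (i + 1)).filter fun x => r ≤ f x)
        ∪ ((Finset.Ioo i j).filter fun l => r ≤ f l) := by
    ext x
    simp only [Finset.mem_filter, Finset.mem_range, Finset.mem_union, Finset.mem_Ioo]
    constructor
    · rintro ⟨h1, h2⟩
      by_cases h : x < i + 1
      · exact Or.inl ⟨h, h2⟩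
      · exact Or.inr ⟨⟨by omega, h1⟩, h2⟩
    · rintro (⟨h1, h2⟩ | ⟨h1, h2⟩)
      · exact ⟨by omega, h2⟩
      · exact ⟨h1.2, h2⟩
  have h2 : Disjoint ((Finset.range (i + 1)).filter fun x => r ≤ f x)
      ((Finset.Ioo i j).filter fun l => r ≤ f l) := by
    rw [Finset.disjoint_left]
    intro x hx hx'
    simp only [Finset.mem_filter, Finset.mem_range, Finset.mem_Ioo] at hx hx'
    omega
  unfold shift
  rw [h1, Finset.card_union_of_disjoint h2, Finset.range_add_one, Finset.filter_insert]
  split_ifs with h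
  · rw [Finset.card_insert_of_notMem (by simp)]; omega
  · omega

/-- Balanced column-injective tableaux with support `I` in the columns up to `N` and with
entries of row `i` at most `i`. -/
structure Tab (I : ℕ → ℕ → Prop) (N : ℕ) (T : ℕ → ℕ → ℕ) : Prop where
  supp : ∀ i j, T i j ≠ 0 ↔ I i j ∧ j ≤ N
  lt : ∀ i j, T i j ≠ 0 → i < j
  le : ∀ i j, T i j ≤ i
  inj : ∀ i i' j, i < i' → T i j = T i' j → T i j = 0
  bal : ∀ i j k, i < j → j < k →
    (T i j ≤ T i k ∨ T j k ≤ T i k) ∧ (T i k ≤ T i j ∨ T i k ≤ T j k)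

/-- The rank of the box `(i, j)`: it decreases by one each time the crossing of the pipes `i`
and `j` moves one column to the right among the pipes smaller than `i`. -/
def rho (T : ℕ → ℕ → ℕ) (i j : ℕ) : ℕ := shift (fun x => T x i) i (T i j)

/-- The box `(i, j)` is nonzero and has rank at least `m`. -/
def High (T : ℕ → ℕ → ℕ) (m i j : ℕ) : Prop := T i j ≠ 0 ∧ m ≤ rho T i j

/-- Comparison of tableaux by ranks. -/
def RankLE (T T' : ℕ → ℕ → ℕ) : Prop := ∀ i j, rho T i j ≤ rho T' i j

lemma RankLE.refl (T : ℕ → ℕ → ℕ) : RankLE T T := fun _ _ => le_rfl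

lemma RankLE.trans {T T' T'' : ℕ → ℕ → ℕ} (h : RankLE T T') (h' : RankLE T' T'') :
    RankLE T T'' := fun i j => (h i j).trans (h' i j)

namespace Tab

variable {I : ℕ → ℕ → Prop} {N : ℕ} {T T' : ℕ → ℕ → ℕ}

lemma nzInj (h : Tab I N T) (i j : ℕ) : NzInj (fun x => T x i) j := by
  intro x _ y _ hxy hx
  rcases lt_trichotomy x y with h1 | h1 | h1
  · exact absurd (h.inj x y i h1 hxy) hx
  · exact h1
  · exact absurd (h.inj y x i h1 hxy.symm) (fun h0 => hx (hxy.trans h0))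

lemma zero_iff (h : Tab I N T) (h' : Tab I N T') (i j : ℕ) : T i j = 0 ↔ T' i j = 0 := by
  rw [← not_iff_not]; exact (h.supp i j).trans (h'.supp i j).symm

/-- A pipe that is crossed horizontally in row `T i j` is not crossed vertically there. -/
lemma ne_of_ne_zero (h : Tab I N T) {i j : ℕ} (hij : T i j ≠ 0) (x : ℕ) : T x i ≠ T i j := by
  intro hx
  have h1 := h.lt i j hij
  have h2 := h.lt x i (by omega)
  have h3 := h.bal x i j h2 h1
  have h4 := h.inj x i j h2
  omega

lemma rho_eq (h : Tab I N T) {i j : ℕ} (hij : T i j ≠ 0) :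
    rho T i j = shift (fun x => T x j) i (T i j) := by
  refine shift_congr fun x hx => ?_
  have h1 := h.lt i j hij
  have h3 := h.bal x i j hx h1
  have h4 := h.inj x i j hx
  have h5 := h.ne_of_ne_zero hij x
  omega

lemma rho_mono (h : Tab I N T) {i j k : ℕ} (hij : T i j ≠ 0) (hjk : T i j ≤ T i k) :
    rho T i j ≤ rho T i k :=
  shift_mono (h.nzInj i i) hij hjk

lemma rho_of_zero {i j : ℕ} (hij : T i j = 0) : rho T i j = i := by
  simp [rho, shift, hij]

lemma rho_congr {i j : ℕ} (h1 : ∀ x < i, T x i = T' x i) (h2 : T i j = T' i j) :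
    rho T i j = rho T' i j := by
  rw [rho, rho, h2]
  exact shift_congr fun x hx => by simp only [h1 x hx]

/-- If the pipes `i, j` and the pipes `j, k` cross early, so do `i, k`. -/
lemma high_of_high (h : Tab I N T) {m i j k : ℕ} (hij : High T m i j) (hjk : T j k ≠ 0)
    (hm : m + {l ∈ Finset.Ioo i j | ¬ High T m i l}.card ≤ rho T j k) : High T m i k := by
  have lij := h.lt i j hij.1
  have ljk := h.lt j k hjk
  have hb := h.bal i j k lij ljk
  have hik : T i k ≠ 0 := by have := hij.1; omega
  refine ⟨hik, ?_⟩
  by_contra hlt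
  push Not at hlt
  have h1 : T i k < T i j := by
    by_contra hh
    have := h.rho_mono hij.1 (not_lt.1 hh)
    have := hij.2
    omega
  have h2 : T j k < T i k := by
    have := h.inj i j k lij
    omega
  have h3 := shift_lt (f := fun x => T x k) (j := j) (h.nzInj k j) hjk h2 (by
    intro x hx hxe
    have := h.inj x j k hx hxe
    omega)
  rw [← h.rho_eq hjk, shift_split (f := fun x => T x k) lij, ← h.rho_eq hik, if_pos le_rfl] at h3
  have h4 : {l ∈ Finset.Ioo i j | T i k ≤ T l k}.card
      ≤ {l ∈ Finset.Ioo i j | ¬ High T m i l}.card := by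
    refine Finset.card_le_card fun l hl => ?_
    simp only [Finset.mem_filter, Finset.mem_Ioo] at hl ⊢
    refine ⟨hl.1, fun hh => ?_⟩
    have b := h.bal i l k hl.1.1 (by omega)
    have c := h.inj i l k hl.1.1
    have := h.rho_mono (k := k) hh.1 (by omega)
    have := hh.2
    omega
  omega

/-- If the pipes `i, j` and the pipes `j, k` cross late, so do `i, k`. -/
lemma not_high_of_not_high (h : Tab I N T) {m i j k : ℕ} (lij : i < j) (ljk : j < k)
    (hij : ¬ High T m i j)
    (hm : T j k ≠ 0 → rho T j k ≤ m + {l ∈ Finset.Ioo i j | ¬ High T m i l}.card) :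
    ¬ High T m i k := by
  rintro ⟨hik, hmik⟩
  have hb := h.bal i j k lij ljk
  have h1 : T i j < T i k := by
    by_contra hh
    have := h.rho_mono (k := j) hik (not_lt.1 hh)
    exact hij ⟨by omega, by omega⟩
  have hjk : T j k ≠ 0 := by omega
  have h2 : T i k ≤ T j k := by omega
  have h3 := shift_mono (f := fun x => T x k) (j := j) (h.nzInj k j) hik h2
  rw [← h.rho_eq hjk, shift_split (f := fun x => T x k) lij, ← h.rho_eq hik, if_pos le_rfl] at h3
  have h4 : {l ∈ Finset.Ioo i j | ¬ High T m i l}.card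
      ≤ {l ∈ Finset.Ioo i j | T i k ≤ T l k}.card := by
    refine Finset.card_le_card fun l hl => ?_
    simp only [Finset.mem_filter, Finset.mem_Ioo] at hl ⊢
    refine ⟨hl.1, ?_⟩
    by_contra hh
    have b := h.bal i l k hl.1.1 (by omega)
    have := h.rho_mono (k := l) hik (by omega)
    exact hl.2 ⟨by omega, by omega⟩
  have := hm hjk
  omega

end Tab

/-- Change the entry `a` of the box `(B, A)` to `b`, exchanging the entries `a` and `b` of the
rows `B` and `A` in the columns above `A` where both occur. -/
def move (T : ℕ → ℕ → ℕ) (B A a b : ℕ) : ℕ → ℕ → ℕ := fun i j =>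
  if j = A then (if i = B then b else T i j)
  else if A < j ∧ T A j = b ∧ T B j = a then (if i = B then b else if i = A then a else T i j)
  else T i j

/-- An elementary increase of a tableau, the counterpart of a chute move. -/
structure TabStep (I : ℕ → ℕ → Prop) (N : ℕ) (T T' : ℕ → ℕ → ℕ) (B A a b : ℕ) : Prop where
  tab : Tab I N T
  tab' : Tab I N T'
  lt : B < A
  val : T B A = a
  pos : 0 < a
  ab : a < b
  fill : ∀ r, a < r → r < b → ∃ h < B, T h A = r
  eq : T' = move T B A a b

namespace TabStep

variable {I : ℕ → ℕ → Prop} {N B A a b : ℕ} {T T' γ : ℕ → ℕ → ℕ}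

lemma val' (s : TabStep I N T T' B A a b) : T' B A = b := by simp [s.eq, move]

lemma of_lt (s : TabStep I N T T' B A a b) {i j : ℕ} (h : j < A) : T' i j = T i j := by
  simp [s.eq, move, h.ne, h.not_gt]

lemma of_ne (s : TabStep I N T T' B A a b) {i j : ℕ} (h : i ≠ B) (h' : i ≠ A) :
    T' i j = T i j := by
  simp [s.eq, move, h, h']

lemma col_ne (s : TabStep I N T T' B A a b) {i : ℕ} (h : i ≠ B) : T' i A = T i A := by
  simp [s.eq, move, h]

lemma le_N (s : TabStep I N T T' B A a b) : A ≤ N :=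
  ((s.tab.supp B A).1 (by rw [s.val]; exact s.pos.ne')).2

lemma eq_low (s : TabStep I N T T' B A a b) {v : ℕ} (hv : A < v) (h : T A v = b) :
    T B v = a := by
  by_contra hne
  have h1 : T' A v = b := by simp [s.eq, move, h, hne, hv.ne']
  have h2 : T' B v = T B v := by simp [s.eq, move, hne, hv.ne']
  have b1 := s.tab.bal B A v s.lt hv
  have b2 := s.tab'.bal B A v s.lt hv
  have b3 := s.tab.inj B A v s.lt
  rw [s.val'] at b2
  have := s.val
  have := s.pos
  have := s.ab
  omega

lemma ne_b (s : TabStep I N T T' B A a b) (i : ℕ) : T i A ≠ b := by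
  intro h
  have := s.ab
  by_cases hi : i = B
  · subst hi; have := s.val; omega
  · have h1 := s.col_ne hi
    have h2 := s.val'
    rcases lt_or_gt_of_ne hi with h3 | h3
    · have := s.tab'.inj i B A h3; omega
    · have := s.tab'.inj B i A h3; omega

lemma eq_of_val (s : TabStep I N T T' B A a b) {i : ℕ} (h : T i A = a) : i = B := by
  by_contra hi
  have := s.pos
  have := s.val
  rcases lt_or_gt_of_ne hi with h3 | h3
  · have := s.tab.inj i B A h3; omega
  · have := s.tab.inj B i A h3; omega

lemma lt_of_mem (s : TabStep I N T T' B A a b) {i : ℕ} (h : a < T i A) (h' : T i A < b) :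
    i < B := by
  obtain ⟨x, hx, e⟩ := s.fill _ h h'
  by_contra hi
  have := s.tab.inj x i A (by omega) e
  omega

lemma fill_col (s : TabStep I N T T' B A a b) {h : ℕ} (hB : h < B) (h1 : a < T h A)
    (h2 : T h A < b) : T h B = T h A := by
  have b1 := s.tab.bal h B A hB s.lt
  have b2 := s.tab'.bal h B A hB s.lt
  rw [s.val', s.col_ne hB.ne, s.of_lt s.lt] at b2
  have := s.val
  omega

/-- The rank attained by the increased box. -/
lemma rho_val (s : TabStep I N T T' B A a b) :
    shift (fun x => T x B) B b = rho T' B A := by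
  rw [rho, s.val']
  exact shift_congr fun x _ => by simp only [s.of_lt s.lt]

lemma rho_succ (s : TabStep I N T T' B A a b) : rho T B A + 1 = rho T' B A := by
  rw [← s.rho_val, rho, s.val]
  have hne : T B A ≠ 0 := by rw [s.val]; exact s.pos.ne'
  rw [← shift_succ_of_forall_ne (fun x _ => by
    have := s.tab.ne_of_ne_zero hne x; rwa [s.val] at this)]
  refine shift_eq_of_forall_exists (s.tab.nzInj B B) (by omega) s.ab fun t h1 h2 => ?_
  obtain ⟨h, hB, e⟩ := s.fill t h1 h2
  exact ⟨h, hB, by rw [s.fill_col hB (by omega) (by omega), e]⟩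

lemma shift_col (s : TabStep I N T T' B A a b) {k : ℕ} (hk : B < k) :
    shift (fun x => T x A) k b
      = rho T' B A + {l ∈ Finset.Ioo B k | b ≤ T l A}.card := by
  have := s.ab
  rw [shift_split hk, s.val, if_neg (by omega), s.tab'.rho_eq (by rw [s.val']; omega), s.val']
  have : shift (fun x => T x A) B b = shift (fun x => T' x A) B b :=
    shift_congr fun x hx => by rw [s.col_ne hx.ne]
  omega

lemma le_iff (s : TabStep I N T T' B A a b) {l : ℕ} (h1 : B < l) (h2 : l < A) :
    b ≤ T l A ↔ ¬ High T (rho T' B A) B l := by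
  have b1 := s.tab.bal B l A h1 h2
  have b2 := s.tab'.bal B l A h1 h2
  rw [s.val', s.col_ne h1.ne', s.of_lt h2] at b2
  have := s.val
  have := s.pos
  have := s.ab
  have n1 := s.ne_b l
  have n2 : T l A ≠ a := fun h => h1.ne' (s.eq_of_val h)
  have n3 := @lt_of_mem _ _ _ _ _ _ _ _ s l
  have e := s.rho_succ
  constructor
  · rintro h ⟨h3, h4⟩
    have := s.tab.rho_mono (k := A) h3 (by omega)
    omega
  · intro h
    by_contra h3
    refine h ⟨by omega, ?_⟩
    rw [← s.rho_val]
    exact shift_mono (s.tab.nzInj B B) (by omega) (by omega)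

lemma card_eq (s : TabStep I N T T' B A a b) {k : ℕ} (hk : k ≤ A) :
    {l ∈ Finset.Ioo B k | b ≤ T l A}.card
      = {l ∈ Finset.Ioo B k | ¬ High T (rho T' B A) B l}.card := by
  congr 1
  refine Finset.filter_congr fun l hl => ?_
  rw [Finset.mem_Ioo] at hl
  exact s.le_iff hl.1 (by omega)

lemma shift_row (s : TabStep I N T T' B A a b) (j : ℕ) :
    shift (fun x => T' x A) A (T' A j) = shift (fun x => T x A) A (T A j) := by
  have := s.ab
  have := s.pos
  have hval := s.val
  have hlt := s.lt
  by_cases hj : A < j ∧ T A j = b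
  · have hB := s.eq_low hj.1 hj.2
    have e1 : T' A j = a := by simp [s.eq, move, hj.1, hj.2, hB, hj.1.ne', hlt.ne']
    rw [e1, hj.2]
    have c1 : shift (fun x => T' x A) A (a + 1) = shift (fun x => T' x A) A (b + 1) := by
      refine shift_eq_of_forall_exists (s.tab'.nzInj A A) (by omega) (by omega)
        fun t h1 h2 => ?_
      by_cases ht : t = b
      · exact ⟨B, s.lt, by simp only [s.val', ht]⟩
      · obtain ⟨h, hB, e⟩ := s.fill t h1 (by omega)
        exact ⟨h, by omega, by simp only [s.col_ne hB.ne, e]⟩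
    have c2 : shift (fun x => T' x A) A (b + 1) = shift (fun x => T x A) A (b + 1) := by
      refine shift_congr fun x _ => ?_
      by_cases hx : x = B
      · subst hx; simp only [s.val', s.val]; omega
      · simp only [s.col_ne hx]
    have c3 := shift_succ_of_forall_ne (f := fun x => T' x A) (j := A) (r := a) fun x _ hx => by
      by_cases hxB : x = B
      · subst hxB; have := s.val'; omega
      · rw [s.col_ne hxB] at hx
        exact hxB (s.eq_of_val hx)
    have c4 := shift_succ_of_forall_ne (f := fun x => T x A) (j := A) (r := b)
      fun x _ => s.ne_b x
    omega
  · have e1 : T' A j = T A j := by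
      simp only [s.eq, move]
      have := hlt.ne'
      split_ifs <;> simp_all
    rw [e1]
    refine shift_congr fun x _ => ?_
    by_cases hx : x = B
    · subst hx
      simp only [s.val', s.val]
      have h1 : ¬ (a < T A j ∧ T A j < b) := by
        rintro ⟨h1, h2⟩
        obtain ⟨h, _, e⟩ := s.fill _ h1 h2
        exact s.tab.ne_of_ne_zero (by omega) h e
      have h2 : T A j ≠ b := fun h => hj ⟨s.tab.lt A j (by omega), h⟩
      omega
    · simp only [s.col_ne hx]

lemma rho_eq_or (s : TabStep I N T T' B A a b) (i j : ℕ) :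
    rho T' i j = rho T i j ∨ i = B ∧ (j = A ∨ A < j ∧ T A j = b) ∧
      rho T i j + 1 = rho T' B A ∧ rho T' i j = rho T' B A := by
  have hlt := s.lt
  rcases lt_trichotomy i A with hi | hi | hi
  · by_cases hij : T' i j = T i j
    · exact Or.inl (Tab.rho_congr (fun x _ => s.of_lt hi) hij)
    · have hB : i = B := by
        by_contra h; exact hij (s.of_ne h hi.ne)
      subst hB
      by_cases hj : j = A
      · subst hj; exact Or.inr ⟨rfl, Or.inl rfl, s.rho_succ, rfl⟩
      · by_cases hc : A < j ∧ T A j = b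
        · have hB := s.eq_low hc.1 hc.2
          have e1 : T' i j = b := by simp [s.eq, move, hj, hc.1, hc.2, hB]
          refine Or.inr ⟨rfl, Or.inr hc, ?_, ?_⟩
          · rw [← s.rho_succ, rho, rho, hB, s.val]
          · rw [rho, rho, s.val', e1]
        · refine absurd ?_ hij
          simp only [s.eq, move, if_neg hj]
          rw [if_neg]
          rintro ⟨h1, h2, -⟩
          exact hc ⟨h1, h2⟩
  · subst hi
    exact Or.inl (s.shift_row j)
  · left
    by_cases hc : T A i = b ∧ T B i = a
    · have e : ∀ x, T' x i = T (Equiv.swap B A x) i := by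
        intro x
        simp only [s.eq, move, hi.ne', hi, hc, if_false, and_self, if_true]
        by_cases h1 : x = B
        · subst h1; simp [hc.1]
        · by_cases h2 : x = A
          · subst h2; simp [hc.2, hlt.ne']
          · simp [h1, h2, Equiv.swap_apply_of_ne_of_ne]
      rw [rho, rho, s.of_ne (by omega) (by omega), shift, shift]
      congr 1
      refine Finset.card_bijective (Equiv.swap B A) (Equiv.bijective _) fun x => ?_
      simp only [Finset.mem_filter, Finset.mem_range, e]
      refine and_congr_left fun _ => ?_
      by_cases h1 : x = B
      · subst h1; simp only [Equiv.swap_apply_left]; omega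
      · by_cases h2 : x = A
        · subst h2; simp only [Equiv.swap_apply_right]; omega
        · rw [Equiv.swap_apply_of_ne_of_ne h1 h2]
    · refine Tab.rho_congr (fun x _ => ?_) (s.of_ne (by omega) (by omega))
      simp only [s.eq, move, hi.ne', if_false]
      rw [if_neg]
      rintro ⟨-, h⟩
      exact hc h

lemma rankLE (s : TabStep I N T T' B A a b) : RankLE T T' := by
  intro i j
  rcases s.rho_eq_or i j with h | h <;> omega

lemma high_iff (s : TabStep I N T T' B A a b) {m i j : ℕ} (h : i ≠ B ∨ m ≠ rho T' B A) :
    High T' m i j ↔ High T m i j := by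
  unfold High
  rw [ne_eq, ne_eq, s.tab'.zero_iff s.tab]
  rcases s.rho_eq_or i j with h1 | h1
  · rw [h1]
  · refine and_congr_right fun _ => ?_
    omega

lemma high' (s : TabStep I N T T' B A a b) : High T' (rho T' B A) B A :=
  ⟨by have := s.ab; rw [s.val']; omega, le_rfl⟩

lemma not_high (s : TabStep I N T T' B A a b) : ¬ High T (rho T' B A) B A := fun h => by
  have := s.rho_succ
  have := h.2
  omega

lemma high_iff_of_lt (s : TabStep I N T T' B A a b) {m i j : ℕ} (h : j < A) :
    High T' m i j ↔ High T m i j := by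
  unfold High
  rw [ne_eq, ne_eq, s.tab'.zero_iff s.tab]
  rcases s.rho_eq_or i j with h1 | h1
  · rw [h1]
  · omega

lemma rankLE_iff_of_le (s : TabStep I N T T' B A a b) (hγ : Tab I N γ) (h : RankLE T γ) :
    RankLE T' γ ↔ High γ (rho T' B A) B A := by
  refine ⟨fun h' => ⟨fun h0 => ?_, h' B A⟩, fun hh i j => ?_⟩
  · have := s.val
    have := s.pos
    rw [hγ.zero_iff s.tab] at h0
    omega
  rcases s.rho_eq_or i j with h1 | ⟨rfl, h1 | h1, h2, h3⟩
  · rw [h1]; exact h i j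
  · rw [h1]; exact hh.2
  · rw [h3]
    have := s.ab
    have hne : γ A j ≠ 0 := fun h0 => by
      rw [hγ.zero_iff s.tab] at h0
      omega
    refine (hγ.high_of_high hh hne ?_).2
    refine le_trans ?_ (h A j)
    rw [show rho T A j = _ by rw [rho, h1.2, s.shift_col s.lt, s.card_eq le_rfl]]
    refine Nat.add_le_add_left (Finset.card_le_card ?_) _
    refine Finset.monotone_filter_right _ fun l hl1 hl => ?_
    refine fun hl' => hl ⟨fun h0 => ?_, hl'.2.trans (h _ _)⟩
    rw [hγ.zero_iff s.tab] at h0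
    exact hl'.1 h0

lemma rankLE_iff_of_le' (s : TabStep I N T T' B A a b) (hγ : Tab I N γ) (h : RankLE γ T') :
    RankLE γ T ↔ ¬ High γ (rho T' B A) B A := by
  refine ⟨fun h' h0 => ?_, fun hh i j => ?_⟩
  · have := h' B A
    have := h0.2
    have := s.rho_succ
    omega
  rcases s.rho_eq_or i j with h1 | ⟨rfl, h1, h2, h3⟩
  · rw [← h1]; exact h i j
  have hγ0 : γ i j ≠ 0 := fun h0 => by
    have h4 := h0
    rw [hγ.zero_iff s.tab] at h4
    rcases h1 with rfl | h1
    · have := s.val; have := s.pos; omega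
    · have := s.eq_low h1.1 h1.2; have := s.pos; omega
  suffices ¬ High γ (rho T' i A) i j by
    by_contra h5
    exact this ⟨hγ0, by omega⟩
  rcases h1 with rfl | h1
  · exact hh
  refine hγ.not_high_of_not_high s.lt h1.1 hh fun _ => ?_
  refine (h A j).trans ?_
  have : rho T' A j = rho T A j := by
    rcases s.rho_eq_or A j with h | h
    · exact h
    · have := s.lt; omega
  rw [this, show rho T A j = _ by rw [rho, h1.2, s.shift_col s.lt, s.card_eq le_rfl]]
  refine Nat.add_le_add_left (Finset.card_le_card ?_) _
  refine Finset.monotone_filter_right _ fun l hl1 hl => ?_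
  simp only [Finset.mem_Ioo] at hl1
  rw [← s.high_iff_of_lt hl1.2] at hl
  refine fun hl' => hl ⟨fun h0 => ?_, hl'.2.trans (h _ _)⟩
  rw [s.tab'.zero_iff hγ] at h0
  exact hl'.1 h0

lemma high_of_high (s : TabStep I N T T' B A a b) (hγ : Tab I N γ) (h : RankLE T γ) {k : ℕ}
    (h1 : B < k) (h2 : k < A) (hk : ¬ High T (rho T' B A) B k)
    (hk' : High γ (rho T' B A) B k) : High γ (rho T' B A) B A := by
  have hb := (s.le_iff h1 h2).2 hk
  have := s.ab
  refine hγ.high_of_high hk' (fun h0 => ?_) (le_trans ?_ (h k A))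
  · rw [hγ.zero_iff s.tab] at h0
    omega
  rw [s.tab.rho_eq (by omega)]
  refine le_trans ?_ (shift_mono (s.tab.nzInj A k) (by omega) hb)
  rw [s.shift_col h1, s.card_eq h2.le]
  refine Nat.add_le_add_left (Finset.card_le_card ?_) _
  refine Finset.monotone_filter_right _ fun l hl1 hl => ?_
  refine fun hl' => hl ⟨fun h0 => ?_, hl'.2.trans (h _ _)⟩
  rw [hγ.zero_iff s.tab] at h0
  exact hl'.1 h0

lemma not_high_of_not_high (s : TabStep I N T T' B A a b) (hγ : Tab I N γ) (h : RankLE γ T')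
    {k : ℕ} (h1 : B < k) (h2 : k < A) (hk : High T (rho T' B A) B k)
    (hk' : ¬ High γ (rho T' B A) B k) : ¬ High γ (rho T' B A) B A := by
  have hb : ¬ b ≤ T k A := fun hb => (s.le_iff h1 h2).1 hb hk
  refine hγ.not_high_of_not_high h1 h2 hk' fun h0 => ?_
  rw [ne_eq, hγ.zero_iff s.tab] at h0
  refine (h k A).trans ?_
  have : rho T' k A = rho T k A := by
    rcases s.rho_eq_or k A with h | h
    · exact h
    · omega
  rw [this, s.tab.rho_eq h0]
  refine (shift_mono (s.tab.nzInj A k) h0 (not_le.1 hb).le).trans ?_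
  rw [s.shift_col h1, s.card_eq h2.le]
  refine Nat.add_le_add_left (Finset.card_le_card ?_) _
  refine Finset.monotone_filter_right _ fun l hl1 hl => ?_
  simp only [Finset.mem_Ioo] at hl1
  rw [← s.high_iff_of_lt (by omega)] at hl
  refine fun hl' => hl ⟨fun h0 => ?_, hl'.2.trans (h _ _)⟩
  rw [s.tab'.zero_iff hγ] at h0
  exact hl'.1 h0

end TabStep

/-- Restriction of a tableau to the columns up to `N`. -/
def resTab (N : ℕ) (T : ℕ → ℕ → ℕ) : ℕ → ℕ → ℕ := fun i j => if j ≤ N then T i j else 0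

/-- Extension of a tableau with columns up to `N` by the column `x`. -/
def glue (N : ℕ) (R : ℕ → ℕ → ℕ) (x : ℕ → ℕ) : ℕ → ℕ → ℕ := fun i j =>
  if j = N + 1 then x i else R i j

/-- The column `x` extends the tableau `R` with columns up to `N`. -/
structure IsCol (I : ℕ → ℕ → Prop) (N : ℕ) (R : ℕ → ℕ → ℕ) (x : ℕ → ℕ) : Prop where
  supp : ∀ i, x i ≠ 0 ↔ I i (N + 1)
  lt : ∀ i, x i ≠ 0 → i ≤ N
  le : ∀ i, x i ≤ i
  inj : ∀ i i', i < i' → x i = x i' → x i = 0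
  bal : ∀ i j, i < j → j ≤ N → (R i j ≤ x i ∨ x j ≤ x i) ∧ (x i ≤ R i j ∨ x i ≤ x j)

section

variable {I : ℕ → ℕ → Prop} {N B A a b : ℕ} {T T' R R' : ℕ → ℕ → ℕ} {x y : ℕ → ℕ}

lemma glue_last (i : ℕ) : glue N R x i (N + 1) = x i := by simp [glue]

lemma glue_of_le {i j : ℕ} (h : j ≤ N) : glue N R x i j = R i j := by
  simp [glue, show j ≠ N + 1 by omega]

lemma resTab_of_le {i j : ℕ} (h : j ≤ N) : resTab N T i j = T i j := by simp [resTab, h]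

namespace Tab

lemma eq_zero (h : Tab I N T) {i j : ℕ} (hj : N < j) : T i j = 0 := by
  by_contra h0
  have := ((h.supp i j).1 h0).2
  omega

lemma res (h : Tab I (N + 1) T) : Tab I N (resTab N T) where
  supp i j := by
    by_cases hj : j ≤ N
    · rw [resTab_of_le hj, h.supp]; simp [hj]; omega
    · simp [resTab, hj]
  lt i j := by
    by_cases hj : j ≤ N
    · rw [resTab_of_le hj]; exact h.lt i j
    · simp [resTab, hj]
  le i j := by
    by_cases hj : j ≤ N
    · rw [resTab_of_le hj]; exact h.le i j
    · simp [resTab, hj]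
  inj i i' j := by
    by_cases hj : j ≤ N
    · simp only [resTab_of_le hj]; exact h.inj i i' j
    · simp [resTab, hj]
  bal i j k hij hjk := by
    by_cases hk : k ≤ N
    · rw [resTab_of_le hk, resTab_of_le hk, resTab_of_le (hjk.le.trans hk)]
      exact h.bal i j k hij hjk
    · simp [resTab, hk]

lemma col (h : Tab I (N + 1) T) : IsCol I N (resTab N T) (fun i => T i (N + 1)) where
  supp i := by simpa using h.supp i (N + 1)
  lt i h0 := by have := h.lt i _ h0; omega
  le i := h.le i _
  inj i i' := h.inj i i' _
  bal i j hij hj := by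
    rw [resTab_of_le hj]
    exact h.bal i j (N + 1) hij (by omega)

lemma glue_res (h : Tab I (N + 1) T) : glue N (resTab N T) (fun i => T i (N + 1)) = T := by
  funext i j
  unfold glue resTab
  split_ifs with h1 h2
  · rw [h1]
  · rfl
  · rw [h.eq_zero (by omega)]

lemma res_glue (h : Tab I N R) : resTab N (glue N R x) = R := by
  funext i j
  by_cases hj : j ≤ N
  · rw [resTab_of_le hj, glue_of_le hj]
  · rw [h.eq_zero (by omega)]; simp [resTab, hj]

end Tab

lemma IsCol.tab (hR : Tab I N R) (h : IsCol I N R x) : Tab I (N + 1) (glue N R x) where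
  supp i j := by
    rcases lt_trichotomy j (N + 1) with hj | rfl | hj
    · rw [glue_of_le (by omega), hR.supp]; exact and_congr_right fun _ => by omega
    · rw [glue_last, h.supp]; simp
    · simp [glue, hj.ne', hR.eq_zero (show N < j by omega)]; omega
  lt i j := by
    rcases lt_trichotomy j (N + 1) with hj | rfl | hj
    · rw [glue_of_le (by omega)]; exact hR.lt i j
    · rw [glue_last]; intro h0; have := h.lt i h0; omega
    · simp [glue, hj.ne', hR.eq_zero (show N < j by omega)]
  le i j := by
    unfold glue
    split_ifs
    exacts [h.le i, hR.le i j]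
  inj i i' j := by
    unfold glue
    split_ifs
    exacts [h.inj i i', hR.inj i i' j]
  bal i j k hij hjk := by
    rcases lt_trichotomy k (N + 1) with hk | rfl | hk
    · rw [glue_of_le (by omega), glue_of_le (by omega), glue_of_le (by omega)]
      exact hR.bal i j k hij hjk
    · rw [glue_last, glue_last, glue_of_le (by omega)]
      exact h.bal i j hij (by omega)
    · simp [glue, hk.ne', hR.eq_zero (show N < k by omega)]

namespace TabStep

/-- The column over `R'` corresponding to the column `x` over `R`. -/
lemma glue_move (s : TabStep I N R R' B A a b) :
    move (glue N R x) B A a b = glue N R' (fun i =>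
      if x A = b ∧ x B = a then (if i = B then b else if i = A then a else x i) else x i) := by
  have hA := s.le_N
  have hB := s.lt
  funext i j
  by_cases hj : j = N + 1
  · subst hj
    rw [glue_last]
    simp only [move, glue_last, show N + 1 ≠ A by omega, show A < N + 1 by omega, if_false,
      true_and]
  · simp only [glue, hj, if_false, s.eq, move]

lemma glue_step (s : TabStep I N R R' B A a b) (hx : IsCol I N R x) (hy : IsCol I N R' y)
    (hxy : ∀ i, y i =
      if x A = b ∧ x B = a then (if i = B then b else if i = A then a else x i) else x i) :
    TabStep I (N + 1) (glue N R x) (glue N R' y) B A a b where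
  tab := hx.tab s.tab
  tab' := hy.tab s.tab'
  lt := s.lt
  val := by rw [glue_of_le s.le_N, s.val]
  pos := s.pos
  ab := s.ab
  fill r h1 h2 := by simpa only [glue_of_le s.le_N] using s.fill r h1 h2
  eq := by rw [s.glue_move, funext hxy]

end TabStep

/-- A step that increases an entry of the last column. -/
lemma IsCol.step (hR : Tab I N R) (hx : IsCol I N R x) (hB : x B = a) (ha : 0 < a) (hab : a < b)
    (fill : ∀ r, a < r → r < b → ∃ h < B, x h = r)
    (hy : IsCol I N R (fun i => if i = B then b else x i)) :
    TabStep I (N + 1) (glue N R x) (glue N R fun i => if i = B then b else x i) B (N + 1) a b where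
  tab := hx.tab hR
  tab' := hy.tab hR
  lt := by have := hx.lt B (by omega); omega
  val := by rw [glue_last, hB]
  pos := ha
  ab := hab
  fill r h1 h2 := by simpa only [glue_last] using fill r h1 h2
  eq := by
    funext i j
    by_cases hj : j = N + 1
    · subst hj; simp [glue, move]
    · simp only [glue, move, hj, if_false]
      rw [if_neg]
      rintro ⟨h1, h2, -⟩
      have := hR.eq_zero (i := N + 1) (show N < j by omega)
      omega
end

namespace TabStep
variable {I : ℕ → ℕ → Prop} {N B A a b : ℕ} {T T' R R' : ℕ → ℕ → ℕ} {x y : ℕ → ℕ}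

/-- The entries of a new column in the rows strictly between `a` and `b`, part one. -/
lemma col_fill (s : TabStep I N R R' B A a b) (hx : IsCol I N R x)
    (hxB : x B = a) (hxA : b < x A) {r : ℕ} (h1 : a < r) (h2 : r < b) : ∃ h < B, x h = r := by
  obtain ⟨h, hB, e⟩ := s.fill r h1 h2
  have e' := s.fill_col hB (by omega) (by omega)
  have hA := s.le_N
  have hBA := s.lt
  have b1 := hx.bal h B hB (by omega)
  have b2 := hx.bal h A (by omega) (by omega)
  have i1 := hx.inj h B hB
  have := s.pos
  exact ⟨h, hB, by omega⟩

lemma col_fill' (s : TabStep I N R R' B A a b) (hx : IsCol I N R' x)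
    (hxB : x B = b) (hxA : x A < a) {r : ℕ} (h1 : a < r) (h2 : r < b) : ∃ h < B, x h = r := by
  obtain ⟨h, hB, e⟩ := s.fill r h1 h2
  have e' := s.fill_col hB (by omega) (by omega)
  have hA := s.le_N
  have hBA := s.lt
  have b1 := hx.bal h B hB (by omega)
  have b2 := hx.bal h A (by omega) (by omega)
  rw [s.col_ne hB.ne] at b2
  rw [s.of_lt hBA] at b1
  have i1 := hx.inj h B hB
  have := s.pos
  exact ⟨h, hB, by omega⟩

lemma col_ne_b (s : TabStep I N R R' B A a b) (hx : IsCol I N R x)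
    (hxB : x B = a) (hxA : b < x A) (i : ℕ) : x i ≠ b := by
  intro hi
  have hA := s.le_N
  have hBA := s.lt
  have hpos := s.pos
  have hab := s.ab
  have hiN := hx.lt i (by omega)
  have v := s.val
  have v' := s.val'
  have n1 := s.ne_b i
  have hiB : i ≠ B := by rintro rfl; omega
  have hiA : i ≠ A := by rintro rfl; omega
  rcases lt_or_gt_of_ne hiB with h | h
  · have n2 := @fill_col _ _ _ _ _ _ _ _ s i h
    have n3 : R i A ≠ a := fun h => hiB (s.eq_of_val h)
    have b1 := hx.bal i B h (by omega)
    have b2 := hx.bal i A (by omega) (by omega)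
    have b3 := s.tab.bal i B A h hBA
    omega
  · have b1 := hx.bal B i h hiN
    rcases lt_or_gt_of_ne hiA with h' | h'
    · have b2 := hx.bal i A h' hA
      have b3 := s.tab'.bal B i A h h'
      rw [s.col_ne hiB, s.of_lt h'] at b3
      omega
    · have b2 := hx.bal A i h' hiN
      have b3 := s.tab'.bal B A i hBA h'
      have e1 : R' B i = R B i := by
        simp only [s.eq, move]; rw [if_neg (by omega), if_neg (by omega)]
      have e2 : R' A i = R A i := by
        simp only [s.eq, move]; rw [if_neg (by omega), if_neg (by omega)]
      omega

lemma col_ne_a (s : TabStep I N R R' B A a b) (hx : IsCol I N R' x)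
    (hxB : x B = b) (hxA : x A < a) (i : ℕ) : x i ≠ a := by
  intro hi
  have hA := s.le_N
  have hBA := s.lt
  have hpos := s.pos
  have hab := s.ab
  have hiN := hx.lt i (by omega)
  have v := s.val
  have v' := s.val'
  have n1 := s.ne_b i
  have hiB : i ≠ B := by rintro rfl; omega
  have hiA : i ≠ A := by rintro rfl; omega
  have n3 : R i A ≠ a := fun h => hiB (s.eq_of_val h)
  rcases lt_or_gt_of_ne hiB with h | h
  · have n2 := @fill_col _ _ _ _ _ _ _ _ s i h
    have b1 := hx.bal i B h (by omega)
    have b2 := hx.bal i A (by omega) (by omega)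
    have b3 := s.tab.bal i B A h hBA
    have b4 := s.tab'.bal i B A h hBA
    rw [s.col_ne hiB] at b2 b4
    rw [s.of_lt hBA] at b1 b4
    omega
  · have b1 := hx.bal B i h hiN
    rcases lt_or_gt_of_ne hiA with h' | h'
    · have b2 := hx.bal i A h' hA
      have b3 := s.tab'.bal B i A h h'
      have b4 := s.tab.bal B i A h h'
      rw [s.col_ne hiB] at b2 b3
      rw [s.of_lt h'] at b1 b3
      omega
    · have b2 := hx.bal A i h' hiN
      have b3 := s.tab.bal B A i hBA h'
      have b4 := s.tab'.bal B A i hBA h'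
      have i1 := s.tab'.inj B A i hBA
      by_cases hc : R A i = b
      · have hc' := s.eq_low h' hc
        have e1 : R' B i = b := by simp [s.eq, move, h'.ne', h', hc, hc']
        have e2 : R' A i = a := by simp [s.eq, move, h'.ne', h', hc, hc', hBA.ne']
        omega
      · have e1 : R' B i = R B i := by
          simp only [s.eq, move]; rw [if_neg (by omega), if_neg (by omega)]
        have e2 : R' A i = R A i := by
          simp only [s.eq, move]; rw [if_neg (by omega), if_neg (by omega)]
        omega

end TabStep

namespace TabStep
variable {I : ℕ → ℕ → Prop} {N B A a b : ℕ} {T T' R R' : ℕ → ℕ → ℕ} {x y : ℕ → ℕ}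

lemma col_not_mem (s : TabStep I N R R' B A a b) (hx : IsCol I N R x) {i : ℕ}
    (hi : i = B ∨ i = A) : x i ≤ a ∨ b ≤ x i := by
  by_contra hc
  push Not at hc
  obtain ⟨h, hB, e⟩ := s.fill _ hc.1 hc.2
  have e' := s.fill_col hB (by omega) (by omega)
  have hA := s.le_N
  have hBA := s.lt
  have b1 := hx.bal h B hB (by omega)
  have b2 := hx.bal h A (by omega) (by omega)
  have i1 := hx.inj h i (by omega)
  rcases hi with rfl | rfl <;> omega

lemma of_gt (s : TabStep I N R R' B A a b) {v : ℕ} (hv : A < v) :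
    R A v = b ∧ R B v = a ∧ R' A v = a ∧ R' B v = b ∨
      R A v ≠ b ∧ R' A v = R A v ∧ R' B v = R B v := by
  have hBA := s.lt
  by_cases hc : R A v = b
  · have hc' := s.eq_low hv hc
    left
    simp [s.eq, move, hv.ne', hv, hc, hc', hBA.ne']
  · right
    simp [s.eq, move, hv.ne', hc]

lemma col_up (s : TabStep I N R R' B A a b) (hx : IsCol I N R x) (hn : ¬ (x B = a ∧ b < x A))
    (hn' : ¬ (x A = b ∧ x B = a)) : IsCol I N R' x where
  supp := hx.supp
  lt := hx.lt
  le := hx.le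
  inj := hx.inj
  bal i j hij hj := by
    have hA := s.le_N
    have hBA := s.lt
    have hpos := s.pos
    have hab := s.ab
    have v := s.val
    have v' := s.val'
    have m1 := s.col_not_mem hx (Or.inl rfl)
    have m2 := s.col_not_mem hx (Or.inr rfl)
    have b0 := hx.bal i j hij hj
    have b1 := hx.bal B A hBA hA
    have i1 := hx.inj B A hBA
    rcases lt_trichotomy j A with h | rfl | h
    · rw [s.of_lt h]; exact b0
    · by_cases hi : i = B
      · subst hi; omega
      · rw [s.col_ne hi]; exact b0
    · have g := s.of_gt h
      have b2 := hx.bal B j (by omega) hj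
      have b3 := hx.bal A j h hj
      have i2 := hx.inj B j (by omega)
      have i3 := hx.inj A j (by omega)
      by_cases hi : i = B
      · subst hi; omega
      · by_cases hi' : i = A
        · subst hi'; omega
        · rw [s.of_ne hi hi']; exact b0

lemma col_down (s : TabStep I N R R' B A a b) (hx : IsCol I N R' x)
    (hn : ¬ (x B = b ∧ x A < a))
    (hn' : ¬ (x A = a ∧ x B = b)) : IsCol I N R x where
  supp := hx.supp
  lt := hx.lt
  le := hx.le
  inj := hx.inj
  bal i j hij hj := by
    have hA := s.le_N
    have hBA := s.lt
    have hpos := s.pos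
    have hab := s.ab
    have v := s.val
    have v' := s.val'
    have b0 := hx.bal i j hij hj
    have b1 := hx.bal B A hBA hA
    have i1 := hx.inj B A hBA
    have m : x B ≤ a ∨ b ≤ x B := by
      by_contra hc
      push Not at hc
      obtain ⟨h, hB, e⟩ := s.fill _ hc.1 hc.2
      have e' := s.fill_col hB (by omega) (by omega)
      have b1 := hx.bal h B hB (by omega)
      have b2 := hx.bal h A (by omega) (by omega)
      rw [s.of_lt hBA] at b1
      rw [s.col_ne (by omega)] at b2
      have i1 := hx.inj h B (by omega)
      omega
    have m' : x A ≤ a ∨ b ≤ x A := by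
      by_contra hc
      push Not at hc
      obtain ⟨h, hB, e⟩ := s.fill _ hc.1 hc.2
      have e' := s.fill_col hB (by omega) (by omega)
      have b1 := hx.bal h B hB (by omega)
      have b2 := hx.bal h A (by omega) (by omega)
      rw [s.of_lt hBA] at b1
      rw [s.col_ne (by omega)] at b2
      have i1 := hx.inj h A (by omega)
      omega
    rcases lt_trichotomy j A with h | rfl | h
    · rw [← s.of_lt h]; exact b0
    · by_cases hi : i = B
      · subst hi; omega
      · rw [← s.col_ne hi]; exact b0
    · have g := s.of_gt h
      have b2 := hx.bal B j (by omega) hj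
      have b3 := hx.bal A j h hj
      have i2 := hx.inj B j (by omega)
      have i3 := hx.inj A j (by omega)
      by_cases hi : i = B
      · subst hi; omega
      · by_cases hi' : i = A
        · subst hi'; omega
        · rw [← s.of_ne hi hi']; exact b0

/-- All balance conditions among the pipes `i, j, k` and the new column. -/
lemma col_swap_up (s : TabStep I N R R' B A a b) (hx : IsCol I N R x) (hB : x B = a)
    (hA : x A = b) :
    IsCol I N R' (fun i => if i = B then b else if i = A then a else x i) := by
  have hAN := s.le_N
  have hBA := s.lt
  have hpos := s.pos
  have hab := s.ab
  have v := s.val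
  have v' := s.val'
  constructor
  · intro i
    rw [← hx.supp i]
    split_ifs with h1 h2
    · subst h1; omega
    · subst h2; omega
    · rfl
  · intro i
    have h := hx.lt i
    split_ifs with h1 h2
    · subst h1; omega
    · subst h2; omega
    · exact h
  · intro i
    have h := hx.le i
    have := s.tab'.le B A
    split_ifs with h1 h2
    · subst h1; omega
    · subst h2; omega
    · exact h
  · intro i j hij
    have i0 := hx.inj i j hij
    have i1 := hx.inj i B
    have i2 := hx.inj i A
    have i3 := hx.inj A j
    have i4 := hx.inj B j
    have i5 := hx.inj B i
    have i6 := hx.inj j A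
    split_ifs <;> subst_vars <;> omega
  · intro i j hij hj
    have b0 := hx.bal i j hij hj
    by_cases hi : i = B
    · subst hi
      by_cases hj' : j = A
      · subst hj'; simp [hBA.ne']; omega
      · have i1 := hx.inj A j
        have i2 := hx.inj j A
        have i3 := hx.inj i j
        rcases lt_or_gt_of_ne hj' with h | h
        · have c1 := s.tab.bal i j A hij h
          have c2 := s.tab'.bal i j A hij h
          have b2 := hx.bal j A h (by omega)
          rw [s.col_ne hij.ne', s.of_lt h] at c2
          rw [s.of_lt h]
          simp only [hij.ne', hj', if_true, if_false]
          have c3 := s.ne_b j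
          have c4 := @lt_of_mem _ _ _ _ _ _ _ _ s j
          omega
        · have b2 := hx.bal A j h (by omega)
          have g := s.of_gt h
          simp only [hij.ne', hj', if_true, if_false]
          have c1 := s.tab.bal i A j hBA h
          have c2 := s.tab'.bal i A j hBA h
          omega
    · by_cases hi' : i = A
      · subst hi'
        have i1 := hx.inj B j (by omega)
        have i2 := hx.inj i j (by omega)
        have b1 := hx.bal B j (by omega) hj
        have g := s.of_gt hij
        have c1 := s.tab.bal B i j hBA hij
        have c2 := s.tab'.bal B i j hBA hij
        simp only [hij.ne', hi, show j ≠ B by omega, if_true, if_false]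
        omega
      · simp only [hi, hi', if_false]
        rw [s.of_ne hi hi']
        by_cases hjB : j = B
        · subst hjB
          have b1 := hx.bal i A (by omega) hAN
          have c1 := s.tab.bal i j A hij hBA
          have c2 := s.tab'.bal i j A hij hBA
          rw [s.of_lt hBA, s.col_ne hi] at c2
          have i1 := hx.inj i j (by omega)
          have i2 := hx.inj i A (by omega)
          have c3 := s.ne_b i
          have c4 := @fill_col _ _ _ _ _ _ _ _ s i hij
          simp only [if_true]
          omega
        · by_cases hjA : j = A
          · subst hjA
            simp only [hjB, if_true, if_false]
            rcases lt_or_gt_of_ne hi with h | h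
            · have b1 := hx.bal i B (by omega) (by omega)
              have c1 := s.tab.bal i B j h hBA
              have c2 := s.tab'.bal i B j h hBA
              rw [s.of_lt hBA, s.col_ne hi] at c2
              have i1 := hx.inj i j (by omega)
              have i2 := hx.inj i B (by omega)
              have c3 := s.ne_b i
              have c4 := @fill_col _ _ _ _ _ _ _ _ s i h
              have c5 : R i j ≠ a := fun h => hi (s.eq_of_val h)
              omega
            · have b1 := hx.bal B i (by omega) (by omega)
              have c1 := s.tab.bal B i j h hij
              have c2 := s.tab'.bal B i j h hij
              rw [s.of_lt hij, s.col_ne hi] at c2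
              have i1 := hx.inj i j (by omega)
              have i2 := hx.inj B i (by omega)
              have c3 := s.ne_b i
              have c4 := @lt_of_mem _ _ _ _ _ _ _ _ s i
              omega
          · simp only [hjB, hjA, if_false]; exact b0
end TabStep

namespace TabStep
variable {I : ℕ → ℕ → Prop} {N B A a b : ℕ} {T T' R R' : ℕ → ℕ → ℕ} {x y : ℕ → ℕ}

lemma col_swap_down (s : TabStep I N R R' B A a b) (hx : IsCol I N R' x) (hB : x B = b)
    (hA : x A = a) :
    IsCol I N R (fun i => if i = B then a else if i = A then b else x i) := by
  have hAN := s.le_N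
  have hBA := s.lt
  have hpos := s.pos
  have hab := s.ab
  have v := s.val
  have v' := s.val'
  constructor
  · intro i
    rw [← hx.supp i]
    split_ifs with h1 h2
    · subst h1; omega
    · subst h2; omega
    · rfl
  · intro i
    have h := hx.lt i
    split_ifs with h1 h2
    · subst h1; omega
    · subst h2; omega
    · exact h
  · intro i
    have h := hx.le i
    have := s.tab'.le B A
    split_ifs with h1 h2
    · subst h1; omega
    · subst h2; omega
    · exact h
  · intro i j hij
    have i0 := hx.inj i j hij
    have i1 := hx.inj i B
    have i2 := hx.inj i A
    have i3 := hx.inj A j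
    have i4 := hx.inj B j
    have i5 := hx.inj B i
    have i6 := hx.inj j A
    split_ifs <;> subst_vars <;> omega
  · intro i j hij hj
    have b0 := hx.bal i j hij hj
    by_cases hi : i = B
    · subst hi
      by_cases hj' : j = A
      · subst hj'; simp [hBA.ne']; omega
      · have i1 := hx.inj A j
        have i2 := hx.inj j A
        have i3 := hx.inj i j
        rcases lt_or_gt_of_ne hj' with h | h
        · have c1 := s.tab.bal i j A hij h
          have c2 := s.tab'.bal i j A hij h
          have b2 := hx.bal j A h (by omega)
          rw [s.col_ne hij.ne', s.of_lt h] at c2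
          rw [s.of_lt h] at b0
          rw [s.col_ne hij.ne'] at b2
          simp only [hij.ne', hj', if_true, if_false]
          have c3 := s.ne_b j
          have c4 := @lt_of_mem _ _ _ _ _ _ _ _ s j
          omega
        · have b2 := hx.bal A j h (by omega)
          have g := s.of_gt h
          simp only [hij.ne', hj', if_true, if_false]
          have c1 := s.tab.bal i A j hBA h
          have c2 := s.tab'.bal i A j hBA h
          omega
    · by_cases hi' : i = A
      · subst hi'
        have i1 := hx.inj B j (by omega)
        have i2 := hx.inj i j (by omega)
        have b1 := hx.bal B j (by omega) hj
        have g := s.of_gt hij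
        have c1 := s.tab.bal B i j hBA hij
        have c2 := s.tab'.bal B i j hBA hij
        simp only [hij.ne', hi, show j ≠ B by omega, if_true, if_false]
        omega
      · simp only [hi, hi', if_false]
        rw [s.of_ne hi hi'] at b0
        by_cases hjB : j = B
        · subst hjB
          have b1 := hx.bal i A (by omega) hAN
          have c1 := s.tab.bal i j A hij hBA
          have c2 := s.tab'.bal i j A hij hBA
          rw [s.of_lt hBA, s.col_ne hi] at c2
          rw [s.col_ne hi] at b1
          have i1 := hx.inj i j (by omega)
          have i2 := hx.inj i A (by omega)
          have c3 := s.ne_b i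
          have c4 := @fill_col _ _ _ _ _ _ _ _ s i hij
          simp only [if_true]
          omega
        · by_cases hjA : j = A
          · subst hjA
            simp only [hjB, if_true, if_false]
            rcases lt_or_gt_of_ne hi with h | h
            · have b1 := hx.bal i B (by omega) (by omega)
              have c1 := s.tab.bal i B j h hBA
              have c2 := s.tab'.bal i B j h hBA
              rw [s.of_lt hBA, s.col_ne hi] at c2
              rw [s.of_lt hBA] at b1
              have i1 := hx.inj i j (by omega)
              have i2 := hx.inj i B (by omega)
              have c3 := s.ne_b i
              have c4 := @fill_col _ _ _ _ _ _ _ _ s i h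
              have c5 : R i j ≠ a := fun h => hi (s.eq_of_val h)
              omega
            · have b1 := hx.bal B i (by omega) (by omega)
              have c1 := s.tab.bal B i j h hij
              have c2 := s.tab'.bal B i j h hij
              rw [s.of_lt hij, s.col_ne hi] at c2
              rw [s.of_lt hij] at b1
              have i1 := hx.inj i j (by omega)
              have i2 := hx.inj B i (by omega)
              have c3 := s.ne_b i
              have c4 := @lt_of_mem _ _ _ _ _ _ _ _ s i
              omega
          · simp only [hjB, hjA, if_false]; exact b0

lemma col_update_up (s : TabStep I N R R' B A a b) (hx : IsCol I N R x) (hB : x B = a)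
    (hA : b < x A) : IsCol I N R (fun i => if i = B then b else x i) := by
  have hAN := s.le_N
  have hBA := s.lt
  have hpos := s.pos
  have hab := s.ab
  have v := s.val
  have v' := s.val'
  have nb := s.col_ne_b hx hB hA
  constructor
  · intro i
    rw [← hx.supp i]
    split_ifs with h1
    · subst h1; omega
    · rfl
  · intro i
    have h := hx.lt i
    split_ifs with h1
    · subst h1; omega
    · exact h
  · intro i
    have h := hx.le i
    have := s.tab'.le B A
    split_ifs with h1
    · subst h1; omega
    · exact h
  · intro i j hij
    have i0 := hx.inj i j hij
    have i1 := nb i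
    have i2 := nb j
    split_ifs <;> subst_vars <;> omega
  · intro i j hij hj
    have b0 := hx.bal i j hij hj
    have b1 := hx.bal B A hBA hAN
    have nj := nb j
    by_cases hi : i = B
    · subst hi
      simp only [hij.ne', if_true, if_false]
      have hm : x j ≤ a ∨ b ≤ x j := by
        by_contra hc
        push Not at hc
        obtain ⟨h, hB, e⟩ := s.col_fill hx ‹_› hA hc.1 hc.2
        have := hx.inj h j (by omega)
        omega
      rcases lt_trichotomy j A with h | rfl | h
      · have c1 := s.tab.bal i j A hij h
        have c2 := s.tab'.bal i j A hij h
        have b2 := hx.bal j A h (by omega)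
        rw [s.col_ne hij.ne', s.of_lt h] at c2
        have c3 := s.ne_b j
        have i3 := hx.inj i j
        have c4 := @lt_of_mem _ _ _ _ _ _ _ _ s j
        omega
      · omega
      · have b2 := hx.bal A j h (by omega)
        have g := s.of_gt h
        have c1 := s.tab.bal i A j hBA h
        have c2 := s.tab'.bal i A j hBA h
        have i3 := hx.inj i j
        omega
    · simp only [hi, if_false]
      by_cases hjB : j = B
      · subst hjB
        simp only [if_true]
        have b1 := hx.bal i A (by omega) hAN
        have c1 := s.tab.bal i j A hij hBA
        have c2 := s.tab'.bal i j A hij hBA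
        rw [s.of_lt hBA, s.col_ne hi] at c2
        have i1 := hx.inj i j (by omega)
        have i2 := hx.inj i A (by omega)
        have c3 := s.ne_b i
        have ni := nb i
        have c4 := @fill_col _ _ _ _ _ _ _ _ s i hij
        omega
      · simp only [hjB, if_false]; exact b0

lemma col_update_down (s : TabStep I N R R' B A a b) (hx : IsCol I N R' x) (hB : x B = b)
    (hA : x A < a) : IsCol I N R' (fun i => if i = B then a else x i) := by
  have hAN := s.le_N
  have hBA := s.lt
  have hpos := s.pos
  have hab := s.ab
  have v := s.val
  have v' := s.val'
  have nb := s.col_ne_a hx hB hA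
  constructor
  · intro i
    rw [← hx.supp i]
    split_ifs with h1
    · subst h1; omega
    · rfl
  · intro i
    have h := hx.lt i
    split_ifs with h1
    · subst h1; omega
    · exact h
  · intro i
    have h := hx.le i
    have := s.tab.le B A
    split_ifs with h1
    · subst h1; omega
    · exact h
  · intro i j hij
    have i0 := hx.inj i j hij
    have i1 := nb i
    have i2 := nb j
    split_ifs <;> subst_vars <;> omega
  · intro i j hij hj
    have b0 := hx.bal i j hij hj
    have b1 := hx.bal B A hBA hAN
    have nj := nb j
    by_cases hi : i = B
    · subst hi
      simp only [hij.ne', if_true, if_false]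
      have hm : x j ≤ a ∨ b ≤ x j := by
        by_contra hc
        push Not at hc
        obtain ⟨h, hB, e⟩ := s.col_fill' hx ‹_› hA hc.1 hc.2
        have := hx.inj h j (by omega)
        omega
      rcases lt_trichotomy j A with h | rfl | h
      · have c1 := s.tab.bal i j A hij h
        have c2 := s.tab'.bal i j A hij h
        have b2 := hx.bal j A h (by omega)
        rw [s.col_ne hij.ne', s.of_lt h] at c2
        rw [s.col_ne hij.ne'] at b2
        rw [s.of_lt h] at b0 ⊢
        have c3 := s.ne_b j
        have i3 := hx.inj i j
        have c5 : R j A ≠ a := fun h => hij.ne' (s.eq_of_val h)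
        have c4 := @lt_of_mem _ _ _ _ _ _ _ _ s j
        omega
      · omega
      · have b2 := hx.bal A j h (by omega)
        have g := s.of_gt h
        have c1 := s.tab.bal i A j hBA h
        have c2 := s.tab'.bal i A j hBA h
        have i3 := hx.inj i j
        have i4 := s.tab'.inj i A j hBA
        omega
    · simp only [hi, if_false]
      by_cases hjB : j = B
      · subst hjB
        simp only [if_true]
        have b1 := hx.bal i A (by omega) hAN
        have c1 := s.tab.bal i j A hij hBA
        have c2 := s.tab'.bal i j A hij hBA
        rw [s.of_lt hBA, s.col_ne hi] at c2
        rw [s.col_ne hi] at b1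
        rw [s.of_lt hBA] at b0 ⊢
        have i1 := hx.inj i j (by omega)
        have i2 := hx.inj i A (by omega)
        have c3 := s.ne_b i
        have ni := nb i
        have c4 := @fill_col _ _ _ _ _ _ _ _ s i hij
        have c5 : R i A ≠ a := fun h => hi (s.eq_of_val h)
        omega
      · simp only [hjB, if_false]; exact b0

end TabStep

/-- Reachability by elementary increases. -/
def Reach (I : ℕ → ℕ → Prop) (N : ℕ) : (ℕ → ℕ → ℕ) → (ℕ → ℕ → ℕ) → Prop :=
  Relation.ReflTransGen fun T T' => ∃ B A a b, TabStep I N T T' B A a b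

section
variable {I : ℕ → ℕ → Prop} {N B A a b : ℕ} {T T' R R' : ℕ → ℕ → ℕ} {x y : ℕ → ℕ}

lemma TabStep.reach (s : TabStep I N R R' B A a b) : Reach I N R R' :=
  Relation.ReflTransGen.single ⟨B, A, a, b, s⟩

lemma Reach.rankLE (h : Reach I N T T') : RankLE T T' := by
  induction h with
  | refl => exact RankLE.refl T
  | tail _ h ih =>
    obtain ⟨B, A, a, b, s⟩ := h
    exact ih.trans s.rankLE

namespace Tab

lemma rho_res (h : Tab I (N + 1) T) {i j : ℕ} (hj : j ≤ N) : rho (resTab N T) i j = rho T i j := by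
  by_cases h0 : T i j = 0
  · rw [rho_of_zero h0, rho_of_zero (by rw [resTab_of_le hj, h0])]
  · have := h.lt i j h0
    exact rho_congr (fun x _ => resTab_of_le (by omega)) (resTab_of_le hj)

lemma high_res (h : Tab I (N + 1) T) {m i j : ℕ} (hj : j ≤ N) :
    High (resTab N T) m i j ↔ High T m i j := by
  rw [High, High, h.rho_res hj, resTab_of_le hj]

lemma rankLE_res (h : Tab I (N + 1) T) (h' : Tab I (N + 1) T') (hr : RankLE T T') :
    RankLE (resTab N T) (resTab N T') := by
  intro i j
  by_cases hj : j ≤ N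
  · rw [h.rho_res hj, h'.rho_res hj]; exact hr i j
  · rw [rho_of_zero, rho_of_zero] <;> simp [resTab, hj]

end Tab

namespace TabStep

lemma lift_rho (s : TabStep I N R R' B A a b) (hT : Tab I (N + 1) T) (e : resTab N T = R') :
    rho T B A = rho R' B A := by rw [← e, hT.rho_res s.le_N]

lemma lift_up_univ (s : TabStep I N R R' B A a b)
    (S : TabStep I (N + 1) T T' B A a b) (e : resTab N T = R) (e' : resTab N T' = R')
    {U : ℕ → ℕ → ℕ} (hU : Tab I (N + 1) U) (h : RankLE T U) (h' : RankLE R' (resTab N U)) :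
    RankLE T' U := by
  rw [S.rankLE_iff_of_le hU h, s.lift_rho S.tab' e', ← hU.high_res s.le_N]
  exact (s.rankLE_iff_of_le hU.res (e ▸ S.tab.rankLE_res hU h)).1 h'

lemma lift_down_univ (s : TabStep I N R R' B A a b)
    (S : TabStep I (N + 1) T T' B A a b) (e' : resTab N T' = R')
    {U : ℕ → ℕ → ℕ} (hU : Tab I (N + 1) U) (h : RankLE U T') (h' : RankLE (resTab N U) R) :
    RankLE U T := by
  rw [S.rankLE_iff_of_le' hU h, s.lift_rho S.tab' e', ← hU.high_res s.le_N]
  exact (s.rankLE_iff_of_le' hU.res (e' ▸ hU.rankLE_res S.tab' h)).1 h'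

lemma high_last (s : TabStep I N R R' B A a b) {A' a' b' m i j : ℕ}
    (S : TabStep I (N + 1) T T' B A' a' b') (e : rho T' B A' = rho R' B A)
    (h : ∀ k ≤ N, High R' m i k → High R m i k) : High T' m i j ↔ High T m i j := by
  refine S.high_iff ?_
  by_contra hc
  push Not at hc
  obtain ⟨rfl, rfl⟩ := hc
  rw [e] at h
  exact s.not_high (h A s.le_N s.high')

lemma exists_lift_up (s : TabStep I N R R' B A a b) (hT : Tab I (N + 1) T)
    (e : resTab N T = R) :
    ∃ T', Tab I (N + 1) T' ∧ resTab N T' = R' ∧ Reach I (N + 1) T T' ∧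
      (∀ U, Tab I (N + 1) U → RankLE T U → RankLE R' (resTab N U) → RankLE T' U) ∧
      ∀ m i, (∀ k ≤ N, High R' m i k → High R m i k) →
        High T' m i (N + 1) → High T m i (N + 1) := by
  have hx : IsCol I N R (fun i => T i (N + 1)) := e ▸ hT.col
  have eT : glue N R (fun i => T i (N + 1)) = T := e ▸ hT.glue_res
  generalize (fun i => T i (N + 1)) = x at hx eT
  by_cases hc : x B = a ∧ b < x A
  · have hx1 := s.col_update_up hx hc.1 hc.2
    have S1 : TabStep I (N + 1) _ _ B (N + 1) a b :=
      hx.step s.tab hc.1 s.pos s.ab (fun r h1 h2 => s.col_fill hx hc.1 hc.2 h1 h2) hx1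
    have hab := s.ab
    have hx2 := s.col_up hx1 (by simp; omega) (by simp; omega)
    have S2 := s.glue_step hx1 hx2 fun i => by simp; omega
    have hm : rho (glue N R fun i => if i = B then b else x i) B (N + 1) = rho R' B A := by
      rw [← S1.rho_val, ← s.rho_val]
      have := s.le_N
      have := s.lt
      exact shift_congr fun y _ => by rw [glue_of_le (by omega)]
    have e2 := s.tab.res_glue (x := fun i => if i = B then b else x i)
    have e3 := s.tab'.res_glue (x := fun i => if i = B then b else x i)
    rw [eT] at S1
    refine ⟨_, S2.tab', e3, S1.reach.trans S2.reach, fun U hU h1 h2 => ?_,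
      fun m i h => ?_⟩
    · refine s.lift_up_univ S2 e2 e3 hU ?_ h2
      rw [S1.rankLE_iff_of_le hU h1]
      have h3 := (s.rankLE_iff_of_le hU.res (e ▸ hT.rankLE_res hU h1)).1 h2
      rw [hU.high_res s.le_N] at h3
      refine S1.high_of_high hU h1 s.lt (Nat.lt_succ_of_le s.le_N) ?_ (hm ▸ h3)
      rw [hm, ← hT.high_res s.le_N, e]
      exact s.not_high
    · rw [s.high_last S2 (s.lift_rho S2.tab' e3) h, s.high_last S1 hm h]
      exact id
  · have key : ∃ y, IsCol I N R' y ∧ ∀ i, y i = if x A = b ∧ x B = a then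
        (if i = B then b else if i = A then a else x i) else x i := by
      by_cases hc' : x A = b ∧ x B = a
      · exact ⟨_, s.col_swap_up hx hc'.2 hc'.1, fun i => by rw [if_pos hc']⟩
      · exact ⟨x, s.col_up hx hc hc', fun i => by rw [if_neg hc']⟩
    obtain ⟨y, hy, hxy⟩ := key
    have S := s.glue_step hx hy hxy
    have e' := s.tab'.res_glue (x := y)
    rw [eT] at S
    refine ⟨_, S.tab', e', S.reach, fun U hU h1 h2 => s.lift_up_univ S e e' hU h1 h2,
      fun m i h => ?_⟩
    rw [s.high_last S (s.lift_rho S.tab' e') h]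
    exact id

lemma exists_lift_down (s : TabStep I N R R' B A a b) (hT : Tab I (N + 1) T')
    (e : resTab N T' = R') :
    ∃ T, Tab I (N + 1) T ∧ resTab N T = R ∧ Reach I (N + 1) T T' ∧
      (∀ U, Tab I (N + 1) U → RankLE U T' → RankLE (resTab N U) R → RankLE U T) ∧
      ∀ m i, (∀ k ≤ N, High R' m i k → High R m i k) →
        High T' m i (N + 1) → High T m i (N + 1) := by
  have hx : IsCol I N R' (fun i => T' i (N + 1)) := e ▸ hT.col
  have eT : glue N R' (fun i => T' i (N + 1)) = T' := e ▸ hT.glue_res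
  generalize (fun i => T' i (N + 1)) = x at hx eT
  have hBA := s.lt
  by_cases hc : x B = b ∧ x A < a
  · have hx1 := s.col_update_down hx hc.1 hc.2
    have hu : (fun i => if i = B then b else if i = B then a else x i) = x := by
      funext i
      split_ifs with h
      · rw [h, hc.1]
      · rfl
    have S2 : TabStep I (N + 1) _ _ B (N + 1) a b :=
      hx1.step s.tab' (by simp) s.pos s.ab (fun r h1 h2 => by
        obtain ⟨h, hB, e⟩ := s.col_fill' hx hc.1 hc.2 h1 h2
        exact ⟨h, hB, by rw [if_neg hB.ne, e]⟩) (by rw [hu]; exact hx)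
    have hab := s.ab
    have hx2 := s.col_down hx1 (by simp; omega) (by simp; omega)
    have S1 := s.glue_step hx2 hx1 fun i => by
      refine (if_neg ?_).symm
      simp only [hBA.ne', if_false]; omega
    have hm : rho T' B (N + 1) = rho R' B A := by
      rw [hu, eT] at S2
      rw [← S2.rho_val, ← s.rho_val]
      have := s.le_N
      refine shift_congr fun y _ => ?_
      rw [glue_of_le (by omega), s.of_lt s.lt]
    have e2 := s.tab.res_glue (x := fun i => if i = B then a else x i)
    have e3 := s.tab'.res_glue (x := fun i => if i = B then a else x i)
    rw [hu, eT] at S2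
    refine ⟨_, S1.tab, e2, S1.reach.trans S2.reach, fun U hU h1 h2 => ?_,
      fun m i h => ?_⟩
    · refine s.lift_down_univ S1 e3 hU ?_ h2
      rw [S2.rankLE_iff_of_le' hU h1]
      have h3 := (s.rankLE_iff_of_le' hU.res (e ▸ hU.rankLE_res hT h1)).1 h2
      rw [hU.high_res s.le_N] at h3
      refine S2.not_high_of_not_high hU h1 s.lt (Nat.lt_succ_of_le s.le_N) ?_ (hm ▸ h3)
      rw [hm, ← S2.tab.high_res s.le_N, e3]
      exact s.high'
    · rw [s.high_last S2 hm h, s.high_last S1 (s.lift_rho S1.tab' e3) h]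
      exact id
  · have key : ∃ y, IsCol I N R y ∧ ∀ i, x i = if y A = b ∧ y B = a then
        (if i = B then b else if i = A then a else y i) else y i := by
      by_cases hc' : x A = a ∧ x B = b
      · refine ⟨_, s.col_swap_down hx hc'.2 hc'.1, fun i => ?_⟩
        rw [if_pos (by simp [hBA.ne'])]
        split_ifs with h1 h2
        exacts [h1 ▸ hc'.2, h2 ▸ hc'.1, rfl]
      · refine ⟨x, s.col_down hx hc hc', fun i => ?_⟩
        rw [if_neg]
        rintro ⟨h1, h2⟩
        have b1 := hx.bal B A hBA s.le_N
        have := s.val'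
        have := s.ab
        omega
    obtain ⟨y, hy, hxy⟩ := key
    have S := s.glue_step hy hx hxy
    have e' := s.tab.res_glue (x := y)
    rw [eT] at S
    refine ⟨_, S.tab, e', S.reach, fun U hU h1 h2 => s.lift_down_univ S e hU h1 h2,
      fun m i h => ?_⟩
    rw [s.high_last S (s.lift_rho S.tab' e) h]
    exact id

end TabStep
end

/-- In every finite set of pipes there is a rightmost one at level `b`. -/
lemma Tab.exists_rightmost {I : ℕ → ℕ → Prop} {N : ℕ} {R : ℕ → ℕ → ℕ} (hR : Tab I N R) (b : ℕ)
    (S : Finset ℕ) (hS : S.Nonempty) :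
    ∃ B ∈ S, ∀ h ∈ S, h ≠ B → h < B ∧ R h B < b ∨ B < h ∧ b ≤ R B h := by
  induction hS using Finset.Nonempty.cons_induction with
  | singleton x => exact ⟨x, by simp, by simp⟩
  | cons x S hx hS ih =>
    obtain ⟨B, hB, h⟩ := ih
    have hne : x ≠ B := fun e => hx (e ▸ hB)
    by_cases hc : x < B ∧ R x B < b ∨ B < x ∧ b ≤ R B x
    · refine ⟨B, by simp [hB], fun k hk hkB => ?_⟩
      rcases Finset.mem_cons.1 hk with rfl | hk
      · exact hc
      · exact h k hk hkB
    · refine ⟨x, by simp, fun k hk hkx => ?_⟩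
      rcases Finset.mem_cons.1 hk with rfl | hk
      · exact absurd rfl hkx
      · by_cases hkB : k = B
        · subst hkB
          omega
        · have hk' := h k hk hkB
          rcases lt_trichotomy x B with h1 | h1 | h1
          · rcases lt_trichotomy k B with h2 | h2 | h2
            · rcases lt_or_gt_of_ne hkx with h3 | h3
              · have b1 := hR.bal k x B h3 h1
                omega
              · have b1 := hR.bal x k B h3 h2
                omega
            · exact absurd h2 hkB
            · have b1 := hR.bal x B k h1 h2
              omega
          · exact absurd h1 hne
          · rcases lt_trichotomy k B with h2 | h2 | h2
            · have b1 := hR.bal k B x h2 h1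
              omega
            · exact absurd h2 hkB
            · rcases lt_or_gt_of_ne hkx with h3 | h3
              · have b1 := hR.bal B k x h2 h3
                omega
              · have b1 := hR.bal B x k h1 h3
                omega

section
variable {I : ℕ → ℕ → Prop} {N B A a b : ℕ} {T T' R R' : ℕ → ℕ → ℕ} {x y : ℕ → ℕ}

lemma IsCol.exists_step (hR : Tab I N R) (hx : IsCol I N R x) (hy : IsCol I N R y)
    (hle : ∀ i, x i ≤ y i) (hne : x ≠ y) :
    ∃ B b, b ≤ y B ∧
      TabStep I (N + 1) (glue N R x) (glue N R fun i => if i = B then b else x i)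
        B (N + 1) (x B) b := by
  have hex : ∃ r, ∃ i, x i = r ∧ x i < y i := by
    by_contra hc
    push Not at hc
    exact hne (funext fun i => le_antisymm (hle i) (hc _ i rfl))
  obtain ⟨i0, hi0, hlt0⟩ := Nat.find_spec hex
  have hmin : ∀ i, x i < Nat.find hex → y i = x i := fun i hi => by
    by_contra hc
    exact Nat.find_min hex hi ⟨i, rfl, by have := hle i; omega⟩
  generalize Nat.find hex = a0 at hi0 hmin
  have z : ∀ i, x i = 0 ↔ y i = 0 := fun i => by
    rw [← not_iff_not]; exact (hx.supp i).trans (hy.supp i).symm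
  have ha0 : 0 < a0 := by have := z i0; omega
  have hexb : ∃ b, a0 < b ∧ ∀ i, x i ≠ b := by
    refine ⟨a0 + N + 1, by omega, fun i hi => ?_⟩
    have := hx.le i
    have := hx.lt i (by omega)
    omega
  obtain ⟨hab, hunused⟩ := Nat.find_spec hexb
  have hused : ∀ r, a0 ≤ r → r < Nat.find hexb → ∃ h, x h = r := fun r h1 h2 => by
    rcases h1.eq_or_lt with rfl | h1
    · exact ⟨i0, hi0⟩
    · have := Nat.find_min hexb h2
      push Not at this
      exact this h1
  generalize Nat.find hexb = b at hab hunused hused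
  obtain ⟨B, hBS, hB⟩ := hR.exists_rightmost b
    {i ∈ Finset.range (N + 1) | a0 ≤ x i ∧ x i < b}
    ⟨i0, by simp only [Finset.mem_filter, Finset.mem_range]; have := hx.lt i0; omega⟩
  simp only [Finset.mem_filter, Finset.mem_range] at hBS hB
  replace hB : ∀ h, a0 ≤ x h → x h < b → h ≠ B → h < B ∧ R h B < b ∨ B < h ∧ b ≤ R B h :=
    fun h h1 h2 => hB h ⟨by have := hx.lt h; omega, h1, h2⟩
  have inj : ∀ i j, x i = x j → x i ≠ 0 → i = j := fun i j h1 h2 => by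
    rcases lt_trichotomy i j with h | h | h
    · exact absurd (hx.inj i j h h1) h2
    · exact h
    · exact absurd (hx.inj j i h h1.symm) (h1 ▸ h2)
  have inj' : ∀ i j, y i = y j → y i ≠ 0 → i = j := fun i j h1 h2 => by
    rcases lt_trichotomy i j with h | h | h
    · exact absurd (hy.inj i j h h1) h2
    · exact h
    · exact absurd (hy.inj j i h h1.symm) (h1 ▸ h2)
  have f1 : ∀ h, x B < x h → x h < b → h < B ∧ x h ≤ R h B ∧ R h B < b := fun h h1 h2 => by
    have := hB h (by omega) h2 (by rintro rfl; omega)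
    have b1 := hx.bal B h
    have b2 := hx.bal h B
    have := hx.lt h
    omega
  have f2 : ∀ t h, x h + t = b → x B < x h → R h B = x h := by
    intro t
    induction t using Nat.strong_induction_on with
    | _ t ih =>
      intro h ht h1
      by_cases ht0 : t = 0
      · exact absurd (by omega) (hunused h)
      obtain ⟨g1, g2, g3⟩ := f1 h h1 (by omega)
      rcases g2.eq_or_lt with g2 | g2
      · exact g2.symm
      obtain ⟨h', e⟩ := hused (R h B) (by omega) g3
      have e2 := ih (b - x h') (by omega) h' (by omega) (by omega)
      have := f1 h' (by omega) (by omega)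
      have i1 := hR.inj h h' B
      have i2 := hR.inj h' h B
      have : h ≠ h' := by rintro rfl; omega
      omega
  have f3 : b ≤ y B := by
    by_contra hc
    push Not at hc
    have g1 := hle B
    have key : ∀ h, x B < x h → x h < b → y h = x h := fun h h1 h2 => by
      have e := f2 (b - x h) h (by omega) h1
      have := f1 h h1 h2
      have b1 := hy.bal h B
      have := hle h
      by_cases hyB : y B = x B
      · omega
      · obtain ⟨h', e'⟩ := hused (y B) (by omega) hc
        have e2 := f2 (b - x h') h' (by omega) (by omega)
        have := f1 h' (by omega) (by omega)
        have b1 := hy.bal h' B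
        have := hle h'
        have := hy.inj h' B
        omega
    rcases g1.eq_or_lt with g1 | g1
    · have hBi : B ≠ i0 := by rintro rfl; omega
      have hxB : x B ≠ a0 := fun h => hBi (inj B i0 (by omega) (by omega))
      obtain ⟨i, hi, hmax⟩ := Finset.exists_max_image
        {i ∈ Finset.range (N + 1) | a0 ≤ x i ∧ x i < x B ∧ x i < y i} x
        ⟨i0, by simp only [Finset.mem_filter, Finset.mem_range]; have := hx.lt i0; omega⟩
      simp only [Finset.mem_filter, Finset.mem_range] at hi hmax
      have n1 : y i ≠ x B := fun h => by
        have := inj' i B (by omega) (by omega)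
        subst this; omega
      have n2 : b ≤ y i := by
        by_contra hb
        obtain ⟨h, e⟩ := hused (y i) (by omega) (by omega)
        have hih : i ≠ h := by rintro rfl; omega
        have e2 : y h ≠ x h := fun h2 => hih (inj' i h (by omega) (by omega))
        by_cases hlt : y i < x B
        · have := hmax h ⟨by have := hx.lt h; omega, by omega, by omega, by
            have := hle h; omega⟩
          omega
        · exact e2 (key h (by omega) (by omega))
      have := hB i (by omega) (by omega) (by rintro rfl; omega)
      have b1 := hy.bal i B
      have b2 := hy.bal B i
      omega
    · obtain ⟨h, e⟩ := hused (y B) (by omega) hc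
      have := key h (by omega) (by omega)
      have := inj' h B (by omega) (by omega)
      subst this
      omega
  have hcol : IsCol I N R (fun i => if i = B then b else x i) := by
    constructor
    · intro i
      rw [← hx.supp i]
      split_ifs with h1
      · subst h1; omega
      · rfl
    · intro i
      have h := hx.lt i
      split_ifs with h1
      · omega
      · exact h
    · intro i
      have h := hx.le i
      have h' := hy.le i
      split_ifs with h1
      · subst h1; omega
      · exact h
    · intro i j hij
      have i0 := hx.inj i j hij
      have i1 := hunused i
      have i2 := hunused j
      split_ifs <;> subst_vars <;> omega
    · intro i j hij hj
      have b0 := hx.bal i j hij hj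
      have b1 := hy.bal i j hij hj
      by_cases hi : i = B
      · subst hi
        simp only [hij.ne', if_true, if_false]
        have := hB j
        have := hmin j
        omega
      · simp only [hi, if_false]
        by_cases hjB : j = B
        · subst hjB
          simp only [if_true]
          have := f2 (b - x i) i
          have := hx.inj i j hij
          omega
        · simp only [hjB, if_false]
          exact b0
  refine ⟨B, b, f3, hx.step hR rfl (by omega) (by omega) (fun r h1 h2 => ?_) hcol⟩
  obtain ⟨h, e⟩ := hused r (by omega) h2
  exact ⟨h, (f1 h (by omega) (by omega)).1, e⟩

lemma IsCol.reach (hR : Tab I N R) (hy : IsCol I N R y) (d : ℕ) :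
    ∀ x, IsCol I N R x → (∀ i, x i ≤ y i) → ∑ i ∈ Finset.range (N + 1), (y i - x i) = d →
      Reach I (N + 1) (glue N R x) (glue N R y) := by
  induction d using Nat.strong_induction_on with
  | _ d ih =>
    intro x hx hle hd
    by_cases hne : x = y
    · subst hne; exact Relation.ReflTransGen.refl
    obtain ⟨B, b, hb, s⟩ := hx.exists_step hR hy hle hne
    have hB : B ≤ N := by have := s.lt; omega
    have hcol := s.tab'.col
    rw [hR.res_glue, funext fun i => glue_last i] at hcol
    refine s.reach.trans (ih _ ?_ _ hcol (fun i => ?_) rfl)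
    · rw [← hd]
      refine Finset.sum_lt_sum (fun i _ => ?_) ⟨B, by simp; omega, ?_⟩
      · split_ifs with h
        · subst h; have := s.ab; omega
        · exact le_rfl
      · have := s.ab
        simp only [if_true]; omega
    · split_ifs with h
      · rw [h]; exact hb
      · exact hle i

end

section
variable {I : ℕ → ℕ → Prop} {N B A a b : ℕ} {T T' R R' : ℕ → ℕ → ℕ} {x y : ℕ → ℕ}

lemma IsCol.sup (hx : IsCol I N R x) (hy : IsCol I N R y) :
    IsCol I N R (fun i => max (x i) (y i)) where
  supp i := by have h1 := hx.supp i; have h2 := hy.supp i; rw [← h1] at h2 ⊢; omega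
  lt i := by have h1 := hx.lt i; have h2 := hy.lt i; omega
  le i := by have h1 := hx.le i; have h2 := hy.le i; omega
  inj i j hij h := by
    have h1 := hx.inj i j hij
    have h2 := hy.inj i j hij
    have h5 := hx.lt j
    have h6 := hy.lt j
    have h7 := (hx.supp i).trans (hy.supp i).symm
    have h8 := (hx.supp j).trans (hy.supp j).symm
    by_cases hj : j ≤ N
    · have h3 := hx.bal i j hij hj
      have h4 := hy.bal i j hij hj
      omega
    · omega
  bal i j hij hj := by
    have h3 := hx.bal i j hij hj
    have h4 := hy.bal i j hij hj
    omega

lemma IsCol.inf (hx : IsCol I N R x) (hy : IsCol I N R y) :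
    IsCol I N R (fun i => min (x i) (y i)) where
  supp i := by have h1 := hx.supp i; have h2 := hy.supp i; rw [← h1] at h2 ⊢; omega
  lt i := by have h1 := hx.lt i; have h2 := hy.lt i; omega
  le i := by have h1 := hx.le i; have h2 := hy.le i; omega
  inj i j hij h := by
    have h1 := hx.inj i j hij
    have h2 := hy.inj i j hij
    have h5 := hx.lt j
    have h6 := hy.lt j
    have h7 := (hx.supp i).trans (hy.supp i).symm
    have h8 := (hx.supp j).trans (hy.supp j).symm
    by_cases hj : j ≤ N
    · have h3 := hx.bal i j hij hj
      have h4 := hy.bal i j hij hj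
      omega
    · omega
  bal i j hij hj := by
    have h3 := hx.bal i j hij hj
    have h4 := hy.bal i j hij hj
    omega

namespace Tab

lemma high_mono (h : Tab I N T) (h' : Tab I N T') (hr : RankLE T T') {m i j : ℕ}
    (hh : High T m i j) : High T' m i j :=
  ⟨fun h0 => hh.1 ((h.zero_iff h' i j).2 h0), hh.2.trans (hr i j)⟩

lemma rho_of_res_eq (h : Tab I (N + 1) T) (e : resTab N T = resTab N T') {i j : ℕ}
    (hj : T i j = T' i j) : rho T i j = rho T' i j := by
  by_cases h0 : T i j = 0
  · rw [rho_of_zero h0, rho_of_zero (hj ▸ h0)]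
  · have h1 := h.lt i j h0
    have h2 := ((h.supp i j).1 h0).2
    refine rho_congr (fun x _ => ?_) hj
    have := congr_fun (congr_fun e x) i
    rwa [resTab_of_le (by omega), resTab_of_le (by omega)] at this

lemma rankLE_of_res_eq (h : Tab I (N + 1) T) (h' : Tab I (N + 1) T')
    (e : resTab N T = resTab N T') (hle : ∀ i, T i (N + 1) ≤ T' i (N + 1)) : RankLE T T' := by
  intro i j
  by_cases hj : j ≤ N
  · rw [← h.rho_res hj, e, h'.rho_res hj]
  by_cases h0 : T i j = 0
  · rw [rho_of_zero h0, rho_of_zero ((h.zero_iff h' i j).1 h0)]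
  have h1 := h.lt i j h0
  have h2 := ((h.supp i j).1 h0).2
  obtain rfl : j = N + 1 := by omega
  refine (shift_mono (h.nzInj i i) h0 (hle i)).trans (le_of_eq ?_)
  refine shift_congr fun x _ => ?_
  have := congr_fun (congr_fun e x) i
  rw [resTab_of_le (by omega), resTab_of_le (by omega)] at this
  rw [this]

lemma le_of_rankLE (h : Tab I (N + 1) T) (h' : Tab I (N + 1) T')
    (e : resTab N T = resTab N T') (hr : RankLE T T') (i : ℕ) :
    T i (N + 1) ≤ T' i (N + 1) := by
  by_contra hc
  push Not at hc
  have h1 := h.lt i (N + 1) (by omega)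
  have h0 : T' i (N + 1) ≠ 0 := fun h0 => by
    rw [h'.zero_iff h] at h0; omega
  have h2 := shift_lt (h.nzInj i i) h0 hc fun x _ => by
    have := congr_fun (congr_fun e x) i
    rw [resTab_of_le (by omega), resTab_of_le (by omega)] at this
    rw [this]
    exact h'.ne_of_ne_zero h0 x
  have h3 := hr i (N + 1)
  have h4 : shift (fun x => T x i) i (T' i (N + 1)) = rho T' i (N + 1) := by
    refine shift_congr fun x _ => ?_
    have := congr_fun (congr_fun e x) i
    rw [resTab_of_le (by omega), resTab_of_le (by omega)] at this
    rw [this]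
  rw [h4] at h2
  unfold rho at h2 h3
  omega

lemma exists_fiber_sup (h : Tab I (N + 1) T) (h' : Tab I (N + 1) T')
    (e : resTab N T = resTab N T') :
    ∃ J, Tab I (N + 1) J ∧ resTab N J = resTab N T ∧ RankLE T J ∧ RankLE T' J ∧
      ∀ i j, rho J i j = rho T i j ∨ rho J i j = rho T' i j := by
  have hc := h.col.sup (e ▸ h'.col)
  have hJ := hc.tab h.res
  have eJ := h.res.res_glue (x := fun i => max (T i (N + 1)) (T' i (N + 1)))
  refine ⟨_, hJ, eJ, ?_, ?_, fun i j => ?_⟩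
  · exact h.rankLE_of_res_eq hJ eJ.symm fun i => by rw [glue_last]; exact le_max_left _ _
  · exact h'.rankLE_of_res_eq hJ (e.symm.trans eJ.symm) fun i => by
      rw [glue_last]; exact le_max_right _ _
  · by_cases hj : j ≤ N
    · left; exact hJ.rho_of_res_eq eJ (by rw [glue_of_le hj, resTab_of_le hj])
    by_cases hj' : j = N + 1
    · subst hj'
      rcases le_total (T i (N + 1)) (T' i (N + 1)) with hm | hm
      · right; exact hJ.rho_of_res_eq (eJ.trans e) (by rw [glue_last, max_eq_right hm])
      · left; exact hJ.rho_of_res_eq eJ (by rw [glue_last, max_eq_left hm])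
    · left; exact hJ.rho_of_res_eq eJ (by rw [hJ.eq_zero (by omega), h.eq_zero (by omega)])

lemma exists_fiber_inf (h : Tab I (N + 1) T) (h' : Tab I (N + 1) T')
    (e : resTab N T = resTab N T') :
    ∃ J, Tab I (N + 1) J ∧ resTab N J = resTab N T ∧ RankLE J T ∧ RankLE J T' ∧
      ∀ i j, rho J i j = rho T i j ∨ rho J i j = rho T' i j := by
  have hc := h.col.inf (e ▸ h'.col)
  have hJ := hc.tab h.res
  have eJ := h.res.res_glue (x := fun i => min (T i (N + 1)) (T' i (N + 1)))
  refine ⟨_, hJ, eJ, ?_, ?_, fun i j => ?_⟩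
  · exact hJ.rankLE_of_res_eq h eJ fun i => by rw [glue_last]; exact min_le_left _ _
  · exact hJ.rankLE_of_res_eq h' (eJ.trans e) fun i => by
      rw [glue_last]; exact min_le_right _ _
  · by_cases hj : j ≤ N
    · left; exact hJ.rho_of_res_eq eJ (by rw [glue_of_le hj, resTab_of_le hj])
    by_cases hj' : j = N + 1
    · subst hj'
      rcases le_total (T i (N + 1)) (T' i (N + 1)) with hm | hm
      · left; exact hJ.rho_of_res_eq eJ (by rw [glue_last, min_eq_left hm])
      · right; exact hJ.rho_of_res_eq (eJ.trans e) (by rw [glue_last, min_eq_right hm])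
    · left; exact hJ.rho_of_res_eq eJ (by rw [hJ.eq_zero (by omega), h.eq_zero (by omega)])

end Tab

lemma Reach.exists_lift_up (h : Reach I N R R') (hT : Tab I (N + 1) T) (e : resTab N T = R) :
    ∃ T', Tab I (N + 1) T' ∧ resTab N T' = R' ∧ Reach I (N + 1) T T' ∧
      (∀ U, Tab I (N + 1) U → RankLE T U → RankLE R' (resTab N U) → RankLE T' U) ∧
      ∀ m i, (∀ k ≤ N, High R' m i k → High R m i k) →
        High T' m i (N + 1) → High T m i (N + 1) := by
  induction h with
  | refl =>
    exact ⟨T, hT, e, Relation.ReflTransGen.refl, fun U _ h _ => h, fun m i _ => id⟩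
  | tail h0 h ih =>
    obtain ⟨B, A, a, b, s⟩ := h
    obtain ⟨T1, h1, e1, r1, u1, z1⟩ := ih
    obtain ⟨T2, h2, e2, r2, u2, z2⟩ := s.exists_lift_up h1 e1
    refine ⟨T2, h2, e2, r1.trans r2, fun U hU hTU hRU => ?_, fun m i hk hh => ?_⟩
    · exact u2 U hU (u1 U hU hTU (s.rankLE.trans hRU)) hRU
    · have hR : Tab I N R := e ▸ hT.res
      refine z1 m i (fun k hkN hk1 => hk k hkN (s.tab.high_mono s.tab' s.rankLE hk1)) ?_
      exact z2 m i (fun k hkN hk1 => hR.high_mono s.tab (Reach.rankLE h0) (hk k hkN hk1)) hh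

lemma Reach.exists_lift_down (h : Reach I N R R') (hT : Tab I (N + 1) T')
    (e : resTab N T' = R') :
    ∃ T, Tab I (N + 1) T ∧ resTab N T = R ∧ Reach I (N + 1) T T' ∧
      (∀ U, Tab I (N + 1) U → RankLE U T' → RankLE (resTab N U) R → RankLE U T) ∧
      ∀ m i, (∀ k ≤ N, High R' m i k → High R m i k) →
        High T' m i (N + 1) → High T m i (N + 1) := by
  induction h using Relation.ReflTransGen.head_induction_on with
  | refl =>
    exact ⟨T', hT, e, Relation.ReflTransGen.refl, fun U _ h _ => h, fun m i _ => id⟩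
  | head h h0 ih =>
    obtain ⟨B, A, a, b, s⟩ := h
    obtain ⟨T1, h1, e1, r1, u1, z1⟩ := ih
    obtain ⟨T2, h2, e2, r2, u2, z2⟩ := s.exists_lift_down h1 e1
    refine ⟨T2, h2, e2, r2.trans r1, fun U hU hTU hRU => ?_, fun m i hk hh => ?_⟩
    · exact u2 U hU (u1 U hU hTU (hRU.trans s.rankLE)) hRU
    · have hR : Tab I N R' := e ▸ hT.res
      refine z2 m i (fun k hkN hk1 => hk k hkN (s.tab'.high_mono hR (Reach.rankLE h0) hk1)) ?_
      exact z1 m i (fun k hkN hk1 => s.tab.high_mono s.tab' s.rankLE (hk k hkN hk1)) hh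

/-- `J` is a join of `T` and `T'` compatible with the ranks on initial segments of rows. -/
structure IsTabJoin (I : ℕ → ℕ → Prop) (N : ℕ) (T T' J : ℕ → ℕ → ℕ) : Prop where
  tab : Tab I N J
  left : RankLE T J
  right : RankLE T' J
  univ : ∀ U, Tab I N U → RankLE T U → RankLE T' U → RankLE J U
  high : ∀ m i A, (∀ k ≤ A, High T m i k ↔ High T' m i k) →
    ∀ k ≤ A, High J m i k → High T m i k

/-- `M` is a meet of `T` and `T'` compatible with the ranks on initial segments of rows. -/
structure IsTabMeet (I : ℕ → ℕ → Prop) (N : ℕ) (T T' M : ℕ → ℕ → ℕ) : Prop where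
  tab : Tab I N M
  left : RankLE M T
  right : RankLE M T'
  univ : ∀ U, Tab I N U → RankLE U T → RankLE U T' → RankLE U M
  high : ∀ m i A, (∀ k ≤ A, High T m i k ↔ High T' m i k) →
    ∀ k ≤ A, High T m i k → High M m i k

lemma High.lt (h : Tab I N T) {m i j : ℕ} (hh : High T m i j) : i < j := h.lt i j hh.1

lemma High.le (h : Tab I N T) {m i j : ℕ} (hh : High T m i j) : j ≤ N := ((h.supp i j).1 hh.1).2

lemma Tab.reach_and_join_and_meet (N : ℕ) :
    (∀ T T', Tab I N T → Tab I N T' → RankLE T T' → Reach I N T T') ∧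
    (∀ T T', Tab I N T → Tab I N T' → ∃ J, IsTabJoin I N T T' J) ∧
    ∀ T T', Tab I N T → Tab I N T' → ∃ M, IsTabMeet I N T T' M := by
  induction N with
  | zero =>
    have key : ∀ T T', Tab I 0 T → Tab I 0 T' → T = T' := fun T T' h h' => by
      funext i j
      have h1 := h.lt i j
      have h2 := h'.lt i j
      have h3 := h.supp i j
      have h4 := h'.supp i j
      omega
    refine ⟨fun T T' h h' _ => key T T' h h' ▸ Relation.ReflTransGen.refl,
      fun T T' h h' => ?_, fun T T' h h' => ?_⟩
    · obtain rfl := key T T' h h'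
      exact ⟨T, h, .refl _, .refl _, fun _ _ h _ => h, fun _ _ _ _ _ _ h => h⟩
    · obtain rfl := key T T' h h'
      exact ⟨T, h, .refl _, .refl _, fun _ _ h _ => h, fun _ _ _ _ _ _ h => h⟩
  | succ N ih =>
    obtain ⟨reach, join, meet⟩ := ih
    refine ⟨fun T T' h h' hr => ?_, fun T T' h h' => ?_, fun T T' h h' => ?_⟩
    · obtain ⟨T1, h1, e1, r1, u1, -⟩ :=
        (reach _ _ h.res h'.res (h.rankLE_res h' hr)).exists_lift_up h rfl
      have hle := u1 T' h' hr (.refl _)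
      refine r1.trans ?_
      have := IsCol.reach h'.res h'.col _ _ (e1 ▸ h1.col) (h1.le_of_rankLE h' e1 hle) rfl
      rw [h'.glue_res] at this
      rwa [← e1, h1.glue_res] at this
    · obtain ⟨J0, hJ0, l0, r0, u0, z0⟩ := join _ _ h.res h'.res
      obtain ⟨T1, h1, e1, r1, u1, z1⟩ := (reach _ _ h.res hJ0 l0).exists_lift_up h rfl
      obtain ⟨T2, h2, e2, r2, u2, z2⟩ := (reach _ _ h'.res hJ0 r0).exists_lift_up h' rfl
      obtain ⟨J, hJ, eJ, lJ, rJ, eq⟩ := h1.exists_fiber_sup h2 (e1.trans e2.symm)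
      refine ⟨J, hJ, r1.rankLE.trans lJ, r2.rankLE.trans rJ, fun U hU hT hT' i j => ?_,
        fun m i A hA k hk hkJ => ?_⟩
      · have := u0 _ hU.res (h.rankLE_res hU hT) (h'.rankLE_res hU hT')
        have g1 := u1 U hU hT this i j
        have g2 := u2 U hU hT' this i j
        rcases eq i j with h | h <;> omega
      · have hkN := High.le hJ hkJ
        rcases hkN.eq_or_lt with rfl | hkN
        · have w0 := z0 m i N fun k hkN => by
            rw [h.high_res hkN, h'.high_res hkN]; exact hA k (by omega)
          have w1 := z1 m i w0
          have w2 := z2 m i fun k hkN hk1 => by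
            rw [h'.high_res hkN, ← hA k (by omega), ← h.high_res hkN]
            exact w0 k hkN hk1
          have hz := h1.zero_iff hJ i (N + 1)
          have hz' := h2.zero_iff hJ i (N + 1)
          rcases eq i (N + 1) with hh | hh
          · exact w1 ⟨fun h0 => hkJ.1 (hz.1 h0), hh ▸ hkJ.2⟩
          · exact (hA _ hk).2 (w2 ⟨fun h0 => hkJ.1 (hz'.1 h0), hh ▸ hkJ.2⟩)
        · have hkN : k ≤ N := by omega
          rw [← h.high_res hkN]
          refine z0 m i (min A N) (fun l hl => ?_) k (by omega) ?_
          · rw [h.high_res (by omega), h'.high_res (by omega)]; exact hA l (by omega)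
          · rw [← e1, ← eJ, hJ.high_res hkN]; exact hkJ
    · obtain ⟨J0, hJ0, l0, r0, u0, z0⟩ := meet _ _ h.res h'.res
      obtain ⟨T1, h1, e1, r1, u1, z1⟩ := (reach _ _ hJ0 h.res l0).exists_lift_down h rfl
      obtain ⟨T2, h2, e2, r2, u2, z2⟩ := (reach _ _ hJ0 h'.res r0).exists_lift_down h' rfl
      obtain ⟨J, hJ, eJ, lJ, rJ, eq⟩ := h1.exists_fiber_inf h2 (e1.trans e2.symm)
      refine ⟨J, hJ, lJ.trans r1.rankLE, rJ.trans r2.rankLE, fun U hU hT hT' i j => ?_,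
        fun m i A hA k hk hkT => ?_⟩
      · have := u0 _ hU.res (hU.rankLE_res h hT) (hU.rankLE_res h' hT')
        have g1 := u1 U hU hT this i j
        have g2 := u2 U hU hT' this i j
        rcases eq i j with h | h <;> omega
      · have hkN := High.le h hkT
        rcases hkN.eq_or_lt with rfl | hkN
        · have w0 := z0 m i N fun k hkN => by
            rw [h.high_res hkN, h'.high_res hkN]; exact hA k (by omega)
          have w1 := z1 m i w0
          have w2 := z2 m i fun k hkN hk1 => by
            rw [h'.high_res hkN, ← hA k (by omega), ← h.high_res hkN] at hk1
            exact w0 k hkN hk1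
          have hz := h1.zero_iff hJ i (N + 1)
          have g1 := w1 hkT
          have g2 := w2 ((hA _ hk).1 hkT)
          refine ⟨fun h0 => g1.1 (hz.2 h0), ?_⟩
          rcases eq i (N + 1) with hh | hh
          · rw [hh]; exact g1.2
          · rw [hh]; exact g2.2
        · have hkN : k ≤ N := by omega
          rw [← hJ.high_res hkN, eJ, e1]
          refine z0 m i (min A N) (fun l hl => ?_) k (by omega) ?_
          · rw [h.high_res (by omega), h'.high_res (by omega)]; exact hA l (by omega)
          · rw [h.high_res hkN]; exact hkT

end

section
variable {I : ℕ → ℕ → Prop} {N B A a b : ℕ} {T T' α β γ : ℕ → ℕ → ℕ}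

/-- Sum of the ranks of all boxes. -/
def rankSum (N : ℕ) (T : ℕ → ℕ → ℕ) : ℕ :=
  ∑ i ∈ Finset.range (N + 1), ∑ j ∈ Finset.range (N + 1), rho T i j

lemma Tab.rankLE_of_rankSum_le (h : Tab I N T) (h' : Tab I N T') (hr : RankLE T T')
    (hs : rankSum N T' ≤ rankSum N T) : RankLE T' T := by
  intro i j
  by_cases hz : T i j = 0
  · rw [Tab.rho_of_zero hz, Tab.rho_of_zero ((h.zero_iff h' i j).1 hz)]
  by_contra hlt
  have hN := ((h.supp i j).1 hz).2
  have := h.lt i j hz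
  refine absurd hs (not_le.2 (Finset.sum_lt_sum (fun i _ => Finset.sum_le_sum fun j _ => hr i j)
    ⟨i, by simp; omega, Finset.sum_lt_sum (fun j _ => hr i j) ⟨j, by simp; omega, ?_⟩⟩))
  omega

lemma Tab.rankSum_le (h : Tab I N T) :
    rankSum N T ≤ ∑ i ∈ Finset.range (N + 1), ∑ _j ∈ Finset.range (N + 1), 2 * i :=
  Finset.sum_le_sum fun i _ => Finset.sum_le_sum fun j _ => by
    have := h.le i j
    change T i j + (Finset.filter (fun x => T i j ≤ T x i) _).card ≤ _
    have := Finset.card_filter_le (Finset.range i) fun x => T i j ≤ T x i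
    rw [Finset.card_range] at this
    omega

/-- `α` is the meet of `γ` and `β`. -/
structure TabMeet (I : ℕ → ℕ → Prop) (N : ℕ) (α γ β : ℕ → ℕ → ℕ) : Prop where
  left : RankLE α γ
  right : RankLE α β
  univ : ∀ U, Tab I N U → RankLE U γ → RankLE U β → RankLE U α

/-- `β` is the join of `γ` and `α`. -/
structure TabJoin (I : ℕ → ℕ → Prop) (N : ℕ) (β γ α : ℕ → ℕ → ℕ) : Prop where
  left : RankLE γ β
  right : RankLE α β
  univ : ∀ U, Tab I N U → RankLE γ U → RankLE α U → RankLE β U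

lemma tabMeet_iff (hα : Tab I N α) (hβ : Tab I N β) (hγ : Tab I N γ) :
    TabMeet I N α γ β ↔ RankLE α γ ∧ RankLE α β ∧
      ∀ δ B A a b, TabStep I N α δ B A a b → RankLE δ β → ¬ RankLE δ γ := by
  constructor
  · rintro ⟨h1, h2, h3⟩
    refine ⟨h1, h2, fun δ B A a b s h4 h5 => ?_⟩
    have := h3 δ s.tab' h5 h4 B A
    have := s.rho_succ
    omega
  · rintro ⟨h1, h2, h3⟩
    obtain ⟨M, hM, l, r, u, -⟩ := (Tab.reach_and_join_and_meet N).2.2 γ β hγ hβ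
    have hr := (Tab.reach_and_join_and_meet N).1 α M hα hM (u α hα h1 h2)
    rcases hr.cases_head with rfl | ⟨δ, ⟨B, A, a, b, s⟩, hδ⟩
    · exact ⟨h1, h2, u⟩
    · have hδ : RankLE δ M := Reach.rankLE hδ
      exact absurd (hδ.trans l) (h3 δ B A a b s (hδ.trans r))

lemma tabJoin_iff (hα : Tab I N α) (hβ : Tab I N β) (hγ : Tab I N γ) :
    TabJoin I N β γ α ↔ RankLE γ β ∧ RankLE α β ∧
      ∀ δ B A a b, TabStep I N δ β B A a b → RankLE α δ → ¬ RankLE γ δ := by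
  constructor
  · rintro ⟨h1, h2, h3⟩
    refine ⟨h1, h2, fun δ B A a b s h4 h5 => ?_⟩
    have := h3 δ s.tab h5 h4 B A
    have := s.rho_succ
    omega
  · rintro ⟨h1, h2, h3⟩
    obtain ⟨M, hM, l, r, u, -⟩ := (Tab.reach_and_join_and_meet N).2.1 γ α hγ hα
    have hr := (Tab.reach_and_join_and_meet N).1 M β hM hβ (u β hβ h1 h2)
    rcases hr.cases_tail with rfl | ⟨δ, hδ, ⟨B, A, a, b, s⟩⟩
    · exact ⟨h1, h2, u⟩
    · have hδ : RankLE M δ := Reach.rankLE hδ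
      exact absurd (l.trans hδ) (h3 δ B A a b s (r.trans hδ))

lemma TabStep.high_iff_of_not_le (s : TabStep I N α T' B A a b) (hγ : Tab I N γ)
    (h : RankLE α γ) (h' : ¬ RankLE T' γ) {k : ℕ} (hk : k ≤ A) :
    High γ (rho T' B A) B k ↔ High α (rho T' B A) B k := by
  have h1 : ¬ High γ (rho T' B A) B A := fun hh => h' ((s.rankLE_iff_of_le hγ h).2 hh)
  rcases hk.eq_or_lt with rfl | hk
  · exact iff_of_false h1 s.not_high
  refine ⟨fun hh => ?_, s.tab.high_mono hγ h⟩
  by_contra h2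
  exact h1 (s.high_of_high hγ h (High.lt hγ hh) hk h2 hh)

lemma TabStep.high_iff_of_not_ge (s : TabStep I N T β B A a b) (hγ : Tab I N γ)
    (h : RankLE γ β) (h' : ¬ RankLE γ T) {k : ℕ} (hk : k ≤ A) :
    High γ (rho β B A) B k ↔ High β (rho β B A) B k := by
  have h1 : High γ (rho β B A) B A := by
    by_contra hh
    exact h' ((s.rankLE_iff_of_le' hγ h).2 hh)
  rcases hk.eq_or_lt with rfl | hk
  · exact iff_of_true h1 s.high'
  refine ⟨hγ.high_mono s.tab' h, fun h2 => ?_⟩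
  by_contra h3
  exact s.not_high_of_not_high hγ h (High.lt s.tab' h2) hk ((s.high_iff_of_lt hk).1 h2) h3 h1

lemma Tab.exists_max_tabMeet (hα : Tab I N α) (hβ : Tab I N β) (hαβ : RankLE α β) :
    ∃ μ, Tab I N μ ∧ TabMeet I N α μ β ∧
      ∀ γ, Tab I N γ → TabMeet I N α γ β → RankLE γ μ := by
  obtain ⟨μ, ⟨hμ, mμ⟩, hmin⟩ := (measure fun γ =>
    (∑ i ∈ Finset.range (N + 1), ∑ _j ∈ Finset.range (N + 1), 2 * i) - rankSum N γ).wf.has_min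
    {γ | Tab I N γ ∧ TabMeet I N α γ β} ⟨α, hα, RankLE.refl α, hαβ, fun U _ h _ => h⟩
  refine ⟨μ, hμ, mμ, fun γ hγ mγ => ?_⟩
  obtain ⟨J, hJ, l, r, u, z⟩ := (Tab.reach_and_join_and_meet N).2.1 γ μ hγ hμ
  have hJS : TabMeet I N α J β := by
    refine (tabMeet_iff hα hβ hJ).2 ⟨mγ.left.trans l, hαβ, fun δ B A a b s h1 h2 => ?_⟩
    have g1 := ((tabMeet_iff hα hβ hγ).1 mγ).2.2 δ B A a b s h1
    have g2 := ((tabMeet_iff hα hβ hμ).1 mμ).2.2 δ B A a b s h1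
    have := (s.rankLE_iff_of_le hJ (mγ.left.trans l)).1 h2
    refine g1 ((s.rankLE_iff_of_le hγ mγ.left).2 (z _ _ A (fun k hk => ?_) A le_rfl this))
    rw [s.high_iff_of_not_le hγ mγ.left g1 hk, s.high_iff_of_not_le hμ mμ.left g2 hk]
  have h1 := hmin J ⟨hJ, hJS⟩
  refine l.trans (hμ.rankLE_of_rankSum_le hJ r ?_)
  have h2 := hJ.rankSum_le
  have h3 := hμ.rankSum_le
  change ¬ ((_ : ℕ) < _) at h1
  beta_reduce at h1
  omega

lemma Tab.exists_min_tabJoin (hα : Tab I N α) (hβ : Tab I N β) (hαβ : RankLE α β) :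
    ∃ ν, Tab I N ν ∧ TabJoin I N β ν α ∧
      ∀ γ, Tab I N γ → TabJoin I N β γ α → RankLE ν γ := by
  obtain ⟨ν, ⟨hν, jν⟩, hmin⟩ := (measure (rankSum N)).wf.has_min
    {γ | Tab I N γ ∧ TabJoin I N β γ α} ⟨β, hβ, RankLE.refl β, hαβ, fun U _ h _ => h⟩
  refine ⟨ν, hν, jν, fun γ hγ jγ => ?_⟩
  obtain ⟨M, hM, l, r, u, z⟩ := (Tab.reach_and_join_and_meet N).2.2 γ ν hγ hν
  have hMS : TabJoin I N β M α := by
    refine (tabJoin_iff hα hβ hM).2 ⟨l.trans jγ.left, hαβ, fun δ B A a b s h1 h2 => ?_⟩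
    have g1 := ((tabJoin_iff hα hβ hγ).1 jγ).2.2 δ B A a b s h1
    have g2 := ((tabJoin_iff hα hβ hν).1 jν).2.2 δ B A a b s h1
    have := (s.rankLE_iff_of_le' hM (l.trans jγ.left)).1 h2
    refine this (z _ _ A (fun k hk => ?_) A le_rfl ?_)
    · rw [s.high_iff_of_not_ge hγ jγ.left g1 hk, s.high_iff_of_not_ge hν jν.left g2 hk]
    · exact (s.high_iff_of_not_ge hγ jγ.left g1 le_rfl).2 s.high'
  have h1 := hmin M ⟨hM, hMS⟩
  refine (hM.rankLE_of_rankSum_le hν r ?_).trans l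
  change ¬ ((_ : ℕ) < _) at h1
  omega

end

/-- Column in which the pipe leaving column `k` of a row to the east entered the row from the
south (`0` if it entered from the west), where `X` marks the crosses of the row. -/
def carry (X : ℕ → Bool) : ℕ → ℕ
  | 0 => 0
  | k + 1 => if X (k + 1) then carry X k else k + 1

/-- Column in which the pipe leaving column `k` of a row to the north entered the row. -/
def src (X : ℕ → Bool) (k : ℕ) : ℕ := if X k then k else carry X (k - 1)

section
variable {X : ℕ → Bool} {k l m a b : ℕ}

lemma carry_le : carry X k ≤ k := by
  induction k with
  | zero => simp [carry]
  | succ k ih => rw [carry]; split_ifs <;> omega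

lemma carry_of_true (hk : 1 ≤ k) (h : X k = true) : carry X k = carry X (k - 1) := by
  obtain ⟨k, rfl⟩ := Nat.exists_eq_add_of_le' hk
  simp [carry, h]

lemma carry_of_false (h : X k = false) : carry X k = k := by
  cases k <;> simp [carry, h]

lemma not_cross_carry (h : carry X k ≠ 0) : X (carry X k) = false := by
  induction k with
  | zero => simp [carry] at h
  | succ k ih =>
    rw [carry] at h ⊢
    split_ifs at h ⊢ with h1
    · exact ih h
    · simpa using h1

lemma cross_of_carry_lt (h : carry X k < l) (hl : l ≤ k) :
    X l = true ∧ carry X l = carry X k := by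
  induction k with
  | zero => omega
  | succ k ih =>
    by_cases h1 : X (k + 1)
    · have h2 : carry X (k + 1) = carry X k := carry_of_true (by omega) h1
      rw [h2] at h ⊢
      rcases hl.eq_or_lt with rfl | hl
      · exact ⟨h1, h2⟩
      · exact ih h (by omega)
    · rw [carry_of_false (by simpa using h1)] at h
      omega

lemma le_carry (h : X l = false) (hl : l ≤ k) : l ≤ carry X k := by
  by_contra h1
  have := (cross_of_carry_lt (not_le.1 h1) hl).1
  simp [h] at this

lemma carry_eq (hl : l ≤ k) (h : l = 0 ∨ X l = false) (h' : ∀ m, l < m → m ≤ k → X m = true) :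
    carry X k = l := by
  have h1 : l ≤ carry X k := by
    rcases h with rfl | h
    · omega
    · exact le_carry h hl
  rcases h1.eq_or_lt with h2 | h2
  · exact h2.symm
  · have h3 := h' _ h2 carry_le
    have h4 := @not_cross_carry X k (by omega)
    simp [h4] at h3

lemma src_le (hb : X (m + 1) = false) (hk : k ≤ m + 1) : src X k ≤ m := by
  unfold src
  have := @carry_le X (k - 1)
  split_ifs with h
  · rcases hk.eq_or_lt with rfl | h1
    · simp [hb] at h
    · omega
  · omega

lemma exists_src (hb : X (m + 1) = false) (hk : k ≤ m) (hm : k = 0 → X 0 = false) :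
    ∃ b, 1 ≤ b ∧ b ≤ m + 1 ∧ src X b = k := by
  by_cases h : X k = true
  · refine ⟨k, ?_, by omega, by simp [src, h]⟩
    rcases Nat.eq_zero_or_pos k with h0 | h0
    · simp [hm h0, h0] at h
    · exact h0
  have hex : ∃ b, k < b ∧ X b = false := ⟨m + 1, by omega, hb⟩
  obtain ⟨h1, h2⟩ := Nat.find_spec hex
  refine ⟨Nat.find hex, by omega, Nat.find_min' hex ⟨by omega, hb⟩, ?_⟩
  rw [src, h2]
  simp only [Bool.false_eq_true, if_false]
  refine carry_eq (by omega) (Or.inr (by simpa using h)) fun t h3 h4 => ?_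
  have := Nat.find_min hex (show t < _ by omega)
  simpa [h3] using this

/-- The order in which pipes leave a row is the order in which they enter it, except that the
pipe of a cross is overtaken. -/
lemma src_order (ha : 1 ≤ a) (hab : a < b) :
    (src X a < src X b ∧ ¬ (X (src X b) = true ∧ carry X (src X b - 1) = src X a)) ∨
      (X (src X a) = true ∧ carry X (src X a - 1) = src X b ∧ src X b < src X a) := by
  have ca := @carry_le X (a - 1)
  have cb := @carry_le X (b - 1)
  unfold src
  by_cases h1 : X a = true <;> by_cases h2 : X b = true
  · simp only [h1, h2, if_true, true_and]
    refine Or.inl ⟨hab, fun h => ?_⟩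
    have h3 := @not_cross_carry X (b - 1) (by omega)
    rw [h, h1] at h3
    simp at h3
  · simp only [h1, h2, if_true, true_and]
    rcases lt_trichotomy a (carry X (b - 1)) with h3 | h3 | h3
    · refine Or.inl ⟨by simpa using h3, fun h => ?_⟩
      have h4 := @not_cross_carry X (b - 1) (by omega)
      simp [h4] at h
    · have h4 := @not_cross_carry X (b - 1) (by omega)
      simp [← h3, h1] at h4
    · refine Or.inr ⟨?_, by simpa using h3⟩
      rw [← carry_of_true ha h1, (cross_of_carry_lt h3 (by omega)).2]
      simp
  · simp only [h1, h2, if_true, true_and]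
    have h3 := @le_carry X (b - 1) a (by simpa using h1) (by omega)
    refine Or.inl ⟨?_, ?_⟩
    · simp only [Bool.false_eq_true, if_false]; omega
    · simp only [Bool.false_eq_true, if_false]; omega
  · have h3 := @le_carry X (b - 1) a (by simpa using h1) (by omega)
    simp only [h1, h2, if_false, Bool.false_eq_true]
    refine Or.inl ⟨by omega, fun h => ?_⟩
    have h4 := @not_cross_carry X (b - 1) (by omega)
    simp [h4] at h

lemma src_inj (ha : 1 ≤ a) (hab : a < b) : src X a ≠ src X b := by
  rcases @src_order X a b ha hab with h | h <;> omega

end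

/-- The crosses of `P` lie in the staircase. -/
def Stair (n : ℕ) (P : ℕ → ℕ → Bool) : Prop :=
  ∀ i j, P i j = true → 1 ≤ i ∧ 1 ≤ j ∧ i + j ≤ n

/-- Labels of the pipes entering row `r`: from the west (index `0`) and from the south. -/
def base (n : ℕ) (P : ℕ → ℕ → Bool) (r k : ℕ) : ℕ :=
  if k = 0 then r else northLabel n P (r + 1) k

section
variable {n r k l : ℕ} {P : ℕ → ℕ → Bool}

lemma labels_cross (h : P r k = true) (hk : r + k ≤ n) :
    labels n P r k = (southLabel n P r k, westLabel n P r k) := by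
  rw [labels]; simp [hk, h, southLabel, westLabel]

lemma labels_bump (h : P r k = false) (hk : r + k ≤ n) :
    labels n P r k = (westLabel n P r k, southLabel n P r k) := by
  rw [labels]; simp [hk, h, southLabel, westLabel]

lemma labels_elbow (hk : n < r + k) :
    labels n P r k = (westLabel n P r k, westLabel n P r k) := by
  rw [labels]; simp [hk, westLabel]

lemma southLabel_eq (hk : 1 ≤ k) : southLabel n P r k = base n P r k := by
  simp [base, southLabel, northLabel, show k ≠ 0 by omega]

lemma westLabel_eq (hk : 1 ≤ k) (hn : r + k ≤ n + 1) :
    westLabel n P r k = base n P r (carry (P r) (k - 1)) := by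
  induction k, hk using Nat.le_induction with
  | base => simp [westLabel, carry, base]
  | succ k hk ih =>
    rw [westLabel, if_neg (by omega), Nat.add_sub_cancel]
    cases h : P r k with
    | false => rw [labels_bump h (by omega), carry_of_false h, southLabel_eq hk]
    | true => rw [labels_cross h (by omega), carry_of_true hk h, ih (by omega)]

lemma northLabel_of_cross (h : P r k = true) (hn : r + k ≤ n) :
    northLabel n P r k = northLabel n P (r + 1) k := by
  rw [northLabel, labels_cross h hn]; rfl

lemma northLabel_of_bump (h : P r k = false) : northLabel n P r k = westLabel n P r k := by
  rw [northLabel]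
  rcases le_or_gt (r + k) n with hn | hn
  · rw [labels_bump h hn]
  · rw [labels_elbow hn]

lemma northLabel_eq (hP : Stair n P) (hk : 1 ≤ k) (hn : r + k ≤ n + 1) :
    northLabel n P r k = base n P r (src (P r) k) := by
  unfold src
  cases h : P r k with
  | true =>
    rw [northLabel_of_cross h (hP r k h).2.2, base, if_pos rfl, if_neg (by omega)]
  | false => rw [northLabel_of_bump h, westLabel_eq hk hn]; simp

lemma Stair.last (hP : Stair n P) (hr : r ≤ n) : P r (n - r + 1) = false := by
  by_contra h
  have := hP r (n - r + 1) (by simpa using h)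
  omega

lemma Stair.zero (hP : Stair n P) : P r 0 = false := by
  by_contra h
  have := hP r 0 (by simpa using h)
  omega

/-- The labels on the north side of row `r` enumerate the numbers from `r` to `n`. -/
structure IsEnum (n r : ℕ) (f : ℕ → ℕ) : Prop where
  mem : ∀ k, 1 ≤ k → r + k ≤ n + 1 → r ≤ f k ∧ f k ≤ n
  inj : ∀ k l, 1 ≤ k → k < l → r + l ≤ n + 1 → f k ≠ f l
  surj : ∀ p, r ≤ p → p ≤ n → ∃ k, 1 ≤ k ∧ r + k ≤ n + 1 ∧ f k = p

lemma IsEnum.base_mem {f : ℕ → ℕ} (h : IsEnum n (r + 1) f) (hr : r ≤ n) (hk : r + k ≤ n) :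
    r ≤ (if k = 0 then r else f k) ∧ (if k = 0 then r else f k) ≤ n := by
  split_ifs with h0
  · omega
  · have := h.mem k (by omega) (by omega); omega

lemma IsEnum.base_inj {f : ℕ → ℕ} (h : IsEnum n (r + 1) f) (hk : k < l) (hl : r + l ≤ n) :
    (if k = 0 then r else f k) ≠ (if l = 0 then r else f l) := by
  rw [if_neg (show l ≠ 0 by omega)]
  split_ifs with h0
  · have := h.mem l (by omega) (by omega); omega
  · exact h.inj k l (by omega) hk (by omega)

lemma IsEnum.base_surj {f : ℕ → ℕ} (h : IsEnum n (r + 1) f) {p : ℕ} (hp : r ≤ p) (hn : p ≤ n) :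
    ∃ k, r + k ≤ n ∧ (if k = 0 then r else f k) = p := by
  rcases hp.eq_or_lt with rfl | hp
  · exact ⟨0, by omega, by simp⟩
  · obtain ⟨k, h1, h2, h3⟩ := h.surj p hp hn
    exact ⟨k, by omega, by rw [if_neg (by omega), h3]⟩

lemma IsEnum.out {f : ℕ → ℕ} {X : ℕ → Bool} (h : IsEnum n (r + 1) f) (hr : r ≤ n)
    (hX : X (n - r + 1) = false) (h0 : X 0 = false) :
    IsEnum n r fun k => if src X k = 0 then r else f (src X k) where
  mem k hk hn := by
    have := src_le hX (show k ≤ n - r + 1 by omega)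
    exact h.base_mem hr (by omega)
  inj k l hk hkl hl := by
    have h1 := src_le hX (show k ≤ n - r + 1 by omega)
    have h2 := src_le hX (show l ≤ n - r + 1 by omega)
    rcases lt_or_gt_of_ne (src_inj (X := X) hk hkl) with h3 | h3
    · exact h.base_inj h3 (by omega)
    · exact (h.base_inj h3 (by omega)).symm
  surj p hp hn := by
    obtain ⟨k, h1, h2⟩ := h.base_surj hp hn
    obtain ⟨b, h3, h4, h5⟩ := exists_src hX (show k ≤ n - r by omega) fun _ => h0
    exact ⟨b, h3, by omega, by simp only [h5, h2]⟩

lemma IsEnum.congr {f g : ℕ → ℕ} (h : IsEnum n r f)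
    (e : ∀ k, 1 ≤ k → r + k ≤ n + 1 → g k = f k) : IsEnum n r g where
  mem k hk hn := by rw [e k hk hn]; exact h.mem k hk hn
  inj k l hk hkl hl := by
    rw [e k hk (by omega), e l (by omega) hl]; exact h.inj k l hk hkl hl
  surj p hp hn := by
    obtain ⟨k, h1, h2, h3⟩ := h.surj p hp hn
    exact ⟨k, h1, h2, by rw [e k h1 h2, h3]⟩

lemma isEnum_of_lt {f : ℕ → ℕ} (hr : n < r) : IsEnum n r f :=
  ⟨fun _ _ _ => by omega, fun _ _ _ _ _ => by omega, fun _ _ _ => by omega⟩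

lemma Stair.isEnum (hP : Stair n P) (r : ℕ) : IsEnum n r (northLabel n P r) := by
  rcases lt_or_ge n r with hr | hr
  · exact isEnum_of_lt hr
  induction hr using Nat.decreasingInduction with
  | of_succ r hr ih =>
    exact (IsEnum.out ih hr.le (hP.last hr.le) hP.zero).congr fun k h1 h2 => northLabel_eq hP h1 h2
  | self =>
    exact (IsEnum.out (isEnum_of_lt (f := northLabel n P (n + 1)) (by omega)) le_rfl
      (hP.last le_rfl) hP.zero).congr fun k h1 h2 => northLabel_eq hP h1 h2

lemma Stair.base_mem (hP : Stair n P) (hk : r + k ≤ n) :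
    r ≤ base n P r k ∧ base n P r k ≤ n := (hP.isEnum (r + 1)).base_mem (by omega) hk

lemma Stair.base_inj (hP : Stair n P) (hk : r + k ≤ n) (hl : r + l ≤ n)
    (h : base n P r k = base n P r l) : k = l := by
  by_contra hne
  rcases lt_or_gt_of_ne hne with h1 | h1
  · exact (hP.isEnum (r + 1)).base_inj h1 hl h
  · exact (hP.isEnum (r + 1)).base_inj h1 hk h.symm

lemma Stair.src_le (hP : Stair n P) (hr : 1 ≤ k) (hk : r + k ≤ n + 1) : r + src (P r) k ≤ n := by
  have := _root_.src_le (hP.last (r := r) (by omega)) (show k ≤ n - r + 1 by omega)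
  omega

end

/-- The pipe `p` precedes the pipe `q` at level `r`, according to the tableau `T` of rows of
crossings. -/
def Bef (T : ℕ → ℕ → ℕ) (r p q : ℕ) : Prop := (p < q ∧ T p q < r) ∨ (q < p ∧ r ≤ T q p)

/-- The pipes of `P` cross in the rows prescribed by `T`. -/
structure Fits (n : ℕ) (P : ℕ → ℕ → Bool) (T : ℕ → ℕ → ℕ) : Prop where
  stair : Stair n P
  sorted : ∀ r k l, 1 ≤ r → 1 ≤ k → k < l → r + l ≤ n + 1 →
    Bef T r (northLabel n P r k) (northLabel n P r l)

section
variable {I : ℕ → ℕ → Prop} {n r k l p q i j x : ℕ} {P Q : ℕ → ℕ → Bool} {T T' : ℕ → ℕ → ℕ}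

lemma Bef.asymm (h : Bef T r p q) (h' : Bef T r q p) : False := by
  unfold Bef at *; omega

lemma Bef.irrefl (h : Bef T r p p) : False := h.asymm h

lemma bef_or (T : ℕ → ℕ → ℕ) (r : ℕ) (h : p ≠ q) : Bef T r p q ∨ Bef T r q p := by
  unfold Bef; omega

lemma bef_iff (h : i < j) : Bef T r i j ↔ T i j < r := by unfold Bef; omega

lemma bef_iff' (h : i < j) : Bef T r j i ↔ r ≤ T i j := by unfold Bef; omega

/-- Pipes between two pipes that cross in row `r` are crossed by the same pipe in row `r`. -/
lemma Tab.eq_of_between (h : Tab I n T) (hr : 1 ≤ r) (hij : T i j = r) (hx : x ≠ i)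
    (h1 : Bef T (r + 1) i x) (h2 : Bef T (r + 1) x j) : T i x = r := by
  have hlt := h.lt i j (by omega)
  unfold Bef at h1 h2
  rcases lt_or_gt_of_ne hx with h3 | h3
  · have := h.bal x i j h3 hlt
    have := h.inj x i j h3
    omega
  · rcases lt_trichotomy x j with h4 | rfl | h4
    · have := h.bal i x j h3 h4
      have := h.inj i x j h3
      omega
    · exact hij
    · have := h.bal i j x hlt h4
      omega

/-- A pipe crossed from the left in row `r` crosses no pipe to its right in row `r`. -/
lemma Tab.vert_not_hor (h : Tab I n T) (hr : 1 ≤ r) (hij : T i j = r) : T j x ≠ r := by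
  intro hjx
  have := h.lt i j (by omega)
  have := h.lt j x (by omega)
  have := h.bal i j x (by omega) (by omega)
  have := h.inj i j x (by omega)
  omega

lemma Tab.bef_self (h : Tab I n T) (hx : r < x) : Bef T (r + 1) r x := by
  have := h.le r x
  exact Or.inl ⟨hx, by omega⟩

/-- The sequence `u` lists the pipes that enter row `r` in their order. -/
structure RowSorted (n r : ℕ) (T : ℕ → ℕ → ℕ) (u : ℕ → ℕ) : Prop where
  sorted : ∀ k l, k < l → r + l ≤ n → Bef T (r + 1) (u k) (u l)
  surj : ∀ p, r ≤ p → p ≤ n → ∃ k, r + k ≤ n ∧ u k = p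

lemma RowSorted.of_level (h : Tab I n T) {f : ℕ → ℕ} (hf : IsEnum n (r + 1) f)
    (hs : ∀ k l, 1 ≤ k → k < l → r + 1 + l ≤ n + 1 → Bef T (r + 1) (f k) (f l)) :
    RowSorted n r T fun k => if k = 0 then r else f k where
  sorted k l hkl hl := by
    simp only [show l ≠ 0 by omega, if_false]
    split_ifs with h0
    · exact h.bef_self (by have := hf.mem l (by omega) (by omega); omega)
    · exact hs k l (by omega) hkl (by omega)
  surj p hp hn := hf.base_surj hp hn

lemma RowSorted.lt_of_bef {u : ℕ → ℕ} (hu : RowSorted n r T u) (hk : r + k ≤ n) (hl : r + l ≤ n)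
    (h : Bef T (r + 1) (u k) (u l)) : k < l := by
  rcases lt_trichotomy k l with h1 | rfl | h1
  · exact h1
  · exact h.irrefl.elim
  · exact (h.asymm (hu.sorted l k h1 hk)).elim

/-- If the crosses of the row are the vertical pipes, then vertical pipes are crossed by the
carried pipe. -/
lemma RowSorted.eq_carry (h : Tab I n T) {u : ℕ → ℕ} {X : ℕ → Bool} (hu : RowSorted n r T u)
    (hr : 1 ≤ r) (hX : ∀ k, 1 ≤ k → r + k ≤ n → (X k = true ↔ ∃ i, T i (u k) = r))
    (hk : 1 ≤ k) (hkn : r + k ≤ n) (hi : T i (u k) = r) : i = u (carry X (k - 1)) := by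
  have hlt := h.lt i (u k) (by omega)
  have hle := h.le i (u k)
  have hN := ((h.supp i (u k)).1 (by omega)).2
  obtain ⟨l, hl, rfl⟩ := hu.surj i (by omega) (by omega)
  have hlk : l < k := hu.lt_of_bef hl hkn (Or.inl ⟨hlt, by omega⟩)
  congr 1
  refine (carry_eq (by omega) ?_ fun m h1 h2 => ?_).symm
  · by_contra hcon
    push Not at hcon
    obtain ⟨x, hx⟩ := (hX l (by omega) hl).1 (by simpa using hcon.2)
    exact h.vert_not_hor hr hx hi
  · refine (hX m (by omega) (by omega)).2 ⟨u l, ?_⟩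
    have h3 := hu.sorted l m h1 (by omega)
    exact h.eq_of_between hr hi (fun e => (e ▸ h3).irrefl) h3 (hu.sorted m k (by omega) hkn)

lemma bef_of_bef_succ (h : Bef T (r + 1) p q) (hne : T p q ≠ r) : Bef T r p q := by
  unfold Bef at *; omega

/-- If the crosses of the row are the vertical pipes, then the pipes leave the row in order. -/
lemma RowSorted.out (h : Tab I n T) {u : ℕ → ℕ} {X : ℕ → Bool} (hu : RowSorted n r T u)
    (hr : 1 ≤ r) (hb : X (n - r + 1) = false)
    (hX : ∀ k, 1 ≤ k → r + k ≤ n → (X k = true ↔ ∃ i, T i (u k) = r))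
    (hk : 1 ≤ k) (hkl : k < l) (hl : r + l ≤ n + 1) :
    Bef T r (u (src X k)) (u (src X l)) := by
  have b1 := src_le hb (show k ≤ n - r + 1 by omega)
  have b2 := src_le hb (show l ≤ n - r + 1 by omega)
  rcases @src_order X k l hk hkl with ⟨h1, h2⟩ | ⟨h1, h2, h3⟩
  · refine bef_of_bef_succ (hu.sorted _ _ h1 (by omega)) fun e => h2 ⟨?_, ?_⟩
    · exact (hX _ (by omega) (by omega)).2 ⟨_, e⟩
    · have e1 := hu.eq_carry h hr hX (by omega) (by omega) e
      by_contra hne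
      have := @carry_le X (src X l - 1)
      rcases lt_or_gt_of_ne hne with h3 | h3
      · have := hu.sorted _ _ h3 (by omega)
        rw [← e1] at this
        exact this.irrefl
      · have := hu.sorted _ _ h3 (by omega)
        rw [← e1] at this
        exact this.irrefl
  · obtain ⟨i, hi⟩ := (hX _ (by omega) (by omega)).1 h1
    have := hu.eq_carry h hr hX (by omega) (by omega) hi
    rw [h2] at this
    rw [← this]
    exact Or.inr ⟨h.lt _ _ (by omega), hi.ge⟩

lemma Fits.rowSorted (hR : Fits n P T) (h : Tab I n T) (r : ℕ) :
    RowSorted n r T (base n P r) :=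
  RowSorted.of_level h (hR.stair.isEnum (r + 1)) fun k l hk hkl hl =>
    hR.sorted (r + 1) k l (by omega) hk hkl hl

/-- The crosses of row `r` are the boxes of vertical pipes. -/
lemma Fits.cross_iff (hR : Fits n P T) (h : Tab I n T) (hr : 1 ≤ r) (hk : 1 ≤ k)
    (hn : r + k ≤ n) : P r k = true ↔ T (westLabel n P r k) (southLabel n P r k) = r := by
  have hu := hR.rowSorted h r
  rw [westLabel_eq hk (by omega), southLabel_eq hk]
  have hc := @carry_le (P r) (k - 1)
  have h1 := hu.sorted (carry (P r) (k - 1)) k (by omega) hn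
  cases hX : P r k with
  | true =>
    refine iff_of_true rfl ?_
    obtain ⟨b, b1, b2, b3⟩ := exists_src (X := P r) (k := carry (P r) (k - 1))
      (hR.stair.last (by omega)) (by omega) fun _ => hR.stair.zero
    have hkb : k < b := by
      by_contra hkb
      rcases (not_lt.1 hkb).eq_or_lt with rfl | hkb
      · simp only [src, hX, if_true] at b3
        omega
      · have h4 := @src_order (P r) b k b1 hkb
        rw [b3, show src (P r) k = k by simp [src, hX]] at h4
        rcases h4 with h4 | h4
        · exact h4.2 ⟨hX, rfl⟩
        · omega
    have h2 := hR.sorted r k b hr hk hkb (by omega)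
    rw [northLabel_eq hR.stair hk (by omega), northLabel_eq hR.stair b1 (by omega), b3,
      show src (P r) k = k by simp [src, hX]] at h2
    unfold Bef at h1 h2
    omega
  | false =>
    refine iff_of_false (by simp) fun e => ?_
    obtain ⟨b, b1, b2, b3⟩ := exists_src (X := P r) (k := k)
      (hR.stair.last (by omega)) (show k ≤ n - r by omega) fun _ => hR.stair.zero
    have hkb : k < b := by
      by_contra hkb
      rcases (not_lt.1 hkb).eq_or_lt with rfl | hkb
      · simp only [src, hX] at b3
        simp at b3
        omega
      · have := @carry_le (P r) (b - 1)
        unfold src at b3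
        split_ifs at b3 <;> omega
    have h2 := hR.sorted r k b hr hk hkb (by omega)
    rw [northLabel_eq hR.stair hk (by omega), northLabel_eq hR.stair b1 (by omega), b3,
      show src (P r) k = carry (P r) (k - 1) by simp [src, hX]] at h2
    have := h.lt _ _ (show T (base n P r (carry (P r) (k - 1))) (base n P r k) ≠ 0 by omega)
    unfold Bef at h1 h2
    omega

/-- A pipe is vertical in row `r` if and only if its box is a cross. -/
lemma Fits.vert (hR : Fits n P T) (h : Tab I n T) (hr : 1 ≤ r) (hk : 1 ≤ k)
    (hn : r + k ≤ n) (hi : T i (southLabel n P r k) = r) :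
    P r k = true ∧ i = westLabel n P r k := by
  have hu := hR.rowSorted h r
  have key : ∀ k, 1 ≤ k → r + k ≤ n → (P r k = true ↔ ∃ i, T i (base n P r k) = r) := by
    intro k hk hn
    refine ⟨fun h1 => ⟨_, southLabel_eq (n := n) (P := P) (r := r) hk ▸
      (hR.cross_iff h hr hk hn).1 h1⟩, ?_⟩
    rintro ⟨i, hi⟩
    have hlt := h.lt _ _ (show T i (base n P r k) ≠ 0 by omega)
    have hle := h.le i (base n P r k)
    have hN := ((h.supp i (base n P r k)).1 (by omega)).2
    obtain ⟨l, hl, rfl⟩ := hu.surj i (by omega) (by omega)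
    have hlk : l < k := hu.lt_of_bef hl hn (Or.inl ⟨hlt, by omega⟩)
    by_contra hX
    have hX : P r k = false := by simpa using hX
    obtain ⟨b, b1, b2, b3⟩ := exists_src (X := P r) (k := k)
      (hR.stair.last (by omega)) (show k ≤ n - r by omega) fun _ => hR.stair.zero
    obtain ⟨a, a1, a2, a3⟩ := exists_src (X := P r) (k := l)
      (hR.stair.last (by omega)) (show l ≤ n - r by omega) fun _ => hR.stair.zero
    have hab : a < b := by
      by_contra hab
      rcases (not_lt.1 hab).eq_or_lt with rfl | hab
      · omega
      · have := @src_order (P r) b a b1 hab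
        rw [a3, b3, hX] at this
        simp at this
        omega
    have h2 := hR.sorted r a b hr a1 hab (by omega)
    rw [northLabel_eq hR.stair a1 (by omega), northLabel_eq hR.stair b1 (by omega), a3, b3] at h2
    unfold Bef at h2
    omega
  rw [southLabel_eq hk] at hi
  refine ⟨(key k hk hn).2 ⟨i, hi⟩, ?_⟩
  rw [westLabel_eq hk (by omega)]
  exact hu.eq_carry h hr key hk hn hi

lemma pd_eq_of_cross_iff
    (hT : ∀ r k, 1 ≤ r → 1 ≤ k → r + k ≤ n → westLabel n P r k = westLabel n Q r k →
      southLabel n P r k = southLabel n Q r k → P r k = Q r k) (hr : 1 ≤ r) (k : ℕ) (hk : 1 ≤ k) :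
    r + k ≤ n → P r k = Q r k := by
  suffices H : ∀ N r k, n + 1 - r + k ≤ N → 1 ≤ r → 1 ≤ k → r + k ≤ n + 1 →
      labels n P r k = labels n Q r k from by
    intro hn
    refine hT r k hr hk hn ?_ ?_
    · unfold westLabel
      split_ifs with h
      · rfl
      · rw [H _ r (k - 1) le_rfl hr (by omega) (by omega)]
    · rw [southLabel, southLabel, H _ (r + 1) k le_rfl (by omega) hk (by omega)]
  intro N
  induction N with
  | zero => intro r k h1 h2 h3 h4; omega
  | succ N ih =>
    intro r k h1 h2 h3 h4
    have hw : westLabel n P r k = westLabel n Q r k := by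
      unfold westLabel
      split_ifs with h
      · rfl
      · rw [ih r (k - 1) (by omega) h2 (by omega) (by omega)]
    rcases h4.eq_or_lt with h4 | h4
    · rw [labels_elbow (by omega), labels_elbow (by omega), hw]
    have hs : southLabel n P r k = southLabel n Q r k := by
      rw [southLabel, southLabel, ih (r + 1) k (by omega) (by omega) h3 (by omega)]
    have := hT r k h2 h3 (by omega) hw hs
    cases hX : Q r k with
    | true =>
      rw [hX] at this
      rw [labels_cross hX (by omega), labels_cross this (by omega), hw, hs]
    | false =>
      rw [hX] at this
      rw [labels_bump hX (by omega), labels_bump this (by omega), hw, hs]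

/-- A pipe dream is determined by its tableau. -/
lemma Fits.pd_unique (hP : Fits n P T) (hQ : Fits n Q T) (h : Tab I n T) : P = Q := by
  funext r k
  by_cases hin : 1 ≤ r ∧ 1 ≤ k ∧ r + k ≤ n
  · refine pd_eq_of_cross_iff (fun r k h1 h2 h3 e1 e2 => ?_) hin.1 k hin.2.1
      hin.2.2
    have p1 := hP.cross_iff h h1 h2 h3
    have q1 := hQ.cross_iff h h1 h2 h3
    rw [e1, e2, ← q1] at p1
    exact Bool.eq_iff_iff.2 p1
  · have p1 : P r k = false := by
      by_contra hc; exact hin (hP.stair r k (by simpa using hc))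
    have q1 : Q r k = false := by
      by_contra hc; exact hin (hQ.stair r k (by simpa using hc))
    rw [p1, q1]

/-- Comparing orders at all levels determines a tableau. -/
lemma Tab.eq_of_bef (h : Tab I n T) (h' : Tab I n T')
    (hb : ∀ r i j, 1 ≤ r → r ≤ i → i < j → j ≤ n → (Bef T r j i ↔ Bef T' r j i)) : T = T' := by
  funext i j
  by_cases h0 : T i j = 0
  · rw [h0, (h.zero_iff h' i j).1 h0]
  have h0' := mt (h.zero_iff h' i j).2 h0
  have hlt := h.lt i j h0
  have hN := ((h.supp i j).1 h0).2
  have l1 := h.le i j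
  have l2 := h'.le i j
  have b1 := hb (T i j) i j (by omega) l1 hlt hN
  have b2 := hb (T' i j) i j (by omega) l2 hlt hN
  rw [bef_iff' hlt, bef_iff' hlt] at b1 b2
  omega

lemma Fits.bef_iff (hP : Fits n P T) (hr : 1 ≤ r) (hk : 1 ≤ k) (hk' : r + k ≤ n + 1)
    (hl : 1 ≤ l) (hl' : r + l ≤ n + 1) :
    Bef T r (northLabel n P r k) (northLabel n P r l) ↔ k < l := by
  refine ⟨fun h => ?_, fun h => hP.sorted r k l hr hk h hl'⟩
  rcases lt_trichotomy k l with h1 | rfl | h1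
  · exact h1
  · exact h.irrefl.elim
  · exact (h.asymm (hP.sorted r l k hr hl h1 hk')).elim

/-- A tableau is determined by its pipe dream. -/
lemma Fits.tab_unique (hP : Fits n P T) (hP' : Fits n P T') (h : Tab I n T) (h' : Tab I n T') :
    T = T' := by
  refine h.eq_of_bef h' fun r i j h1 h2 h3 h4 => ?_
  obtain ⟨k, k1, k2, rfl⟩ := (hP.stair.isEnum r).surj i h2 (by omega)
  obtain ⟨l, l1, l2, rfl⟩ := (hP.stair.isEnum r).surj j (by omega) h4
  rw [hP.bef_iff h1 l1 l2 k1 k2, hP'.bef_iff h1 l1 l2 k1 k2]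

end

/-- The boxes of the row `r`, entered by the pipes `u 0, …, u (n - r)`, in which a pipe is
crossed from the left according to `T`. -/
def rowCross (n : ℕ) (T : ℕ → ℕ → ℕ) (r : ℕ) (u : ℕ → ℕ) (k : ℕ) : Bool :=
  decide (1 ≤ k ∧ r + k ≤ n ∧ ∃ i, T i (u k) = r)

/-- Labels on the north side of row `n + 1 - t` of the pipe dream of `T`. -/
def levelOf (n : ℕ) (T : ℕ → ℕ → ℕ) : ℕ → ℕ → ℕ
  | 0 => id
  | t + 1 => fun k =>
    let u := fun k => if k = 0 then n - t else levelOf n T t k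
    u (src (rowCross n T (n - t) u) k)

/-- The pipe dream of the tableau `T`. -/
def pdOf (n : ℕ) (T : ℕ → ℕ → ℕ) (r k : ℕ) : Bool :=
  decide (1 ≤ r) && rowCross n T r (fun k => if k = 0 then r else levelOf n T (n - r) k) k

section
variable {I : ℕ → ℕ → Prop} {n r k l p q i j x : ℕ} {P Q : ℕ → ℕ → Bool} {T T' : ℕ → ℕ → ℕ}

lemma stair_pdOf : Stair n (pdOf n T) := fun i j h => by
  simp only [pdOf, rowCross, Bool.and_eq_true, decide_eq_true_eq] at h
  exact ⟨h.1, h.2.1, h.2.2.1⟩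

lemma northLabel_pdOf (hr : 1 ≤ r) (hk : 1 ≤ k) (hn : r + k ≤ n + 1) :
    northLabel n (pdOf n T) r k = levelOf n T (n + 1 - r) k := by
  obtain ⟨t, ht⟩ : ∃ t, r + t = n := ⟨n - r, by omega⟩
  induction t generalizing r k with
  | zero =>
    have hX : rowCross n T r (fun k => if k = 0 then r else levelOf n T (n - r) k) k = false := by
      simp [rowCross]; omega
    have hX' : pdOf n T r k = false := by simp [pdOf, hX]
    rw [northLabel_eq stair_pdOf hk hn, show n + 1 - r = 0 + 1 by omega, levelOf]
    simp only [src, hX', show n - 0 = r by omega]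
    simp only [show n - r = 0 by omega] at hX
    have hc : ∀ X, carry X (k - 1) = 0 := fun X => by
      have := @carry_le X (k - 1); omega
    simp [hX, hc, base]
  | succ t ih =>
    rw [northLabel_eq stair_pdOf hk hn, show n + 1 - r = (n - r) + 1 by omega, levelOf]
    have e : n - (n - r) = r := by omega
    simp only [e]
    have e2 : pdOf n T r
        = rowCross n T r (fun k => if k = 0 then r else levelOf n T (n - r) k) := by
      funext k; simp [pdOf, hr]
    rw [← e2, base]
    have := stair_pdOf.src_le (P := pdOf n T) hk hn
    split_ifs with h0
    · rfl
    · rw [ih (by omega) (by omega) (by omega) (by omega)]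
      congr 1; omega

lemma Tab.fits_pdOf (h : Tab I n T) : Fits n (pdOf n T) T where
  stair := stair_pdOf
  sorted r := by
    rcases lt_or_ge n r with hr | hr
    · intro k l; omega
    have step : ∀ r ≤ n, (∀ k l, 1 ≤ r + 1 → 1 ≤ k → k < l → r + 1 + l ≤ n + 1 →
        Bef T (r + 1) (northLabel n (pdOf n T) (r + 1) k) (northLabel n (pdOf n T) (r + 1) l)) →
        ∀ k l, 1 ≤ r → 1 ≤ k → k < l → r + l ≤ n + 1 →
        Bef T r (northLabel n (pdOf n T) r k) (northLabel n (pdOf n T) r l) := by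
      intro r hrn ih k l hr hk hkl hl
      have hs : Stair n (pdOf n T) := stair_pdOf
      have hu := RowSorted.of_level h (hs.isEnum (r + 1)) fun k l => ih k l (by omega)
      rw [northLabel_eq hs hk (by omega), northLabel_eq hs (by omega) hl]
      refine hu.out h hr (hs.last hrn) (fun k hk hn => ?_) hk hkl hl
      have e : ∀ j, levelOf n T (n - r) k = j ↔ northLabel n (pdOf n T) (r + 1) k = j := by
        intro j
        rw [northLabel_pdOf (by omega) hk (by omega)]
        rw [show n + 1 - (r + 1) = n - r by omega]
      simp [pdOf, rowCross, hr, hk, hn, show k ≠ 0 by omega, (e _).1 rfl]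
    induction hr using Nat.decreasingInduction with
    | of_succ r hr ih => exact step r hr.le ih
    | self => exact step n le_rfl fun k l => by omega

variable {w : Equiv.Perm (Fin n)}

lemma permVal_pos (hj : 1 ≤ j) (hn : j ≤ n) : 1 ≤ permVal w j ∧ permVal w j ≤ n := by
  rw [permVal, dif_pos ⟨hj, hn⟩]
  have := (w ⟨j - 1, by omega⟩).2
  omega

lemma permVal_symm_permVal (hj : 1 ≤ j) (hn : j ≤ n) : permVal w (permVal w.symm j) = j := by
  have h := permVal_pos (w := w.symm) hj hn
  rw [permVal, dif_pos h]
  have : (⟨permVal w.symm j - 1, by omega⟩ : Fin n) = w.symm ⟨j - 1, by omega⟩ := by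
    ext
    simp [permVal, hj, hn]
  rw [this, Equiv.apply_symm_apply]
  simp only
  omega

lemma permVal_symm_ne (hij : i ≠ j) (hi : 1 ≤ i) (hi' : i ≤ n) (hj : 1 ≤ j) (hj' : j ≤ n) :
    permVal w.symm i ≠ permVal w.symm j := fun h => by
  have := congrArg (permVal w) h
  rw [permVal_symm_permVal hi hi', permVal_symm_permVal hj hj'] at this
  exact hij this

lemma eq_of_strictMono_on {f : ℕ → ℕ} (hf : ∀ k, 1 ≤ k → k ≤ n → 1 ≤ f k ∧ f k ≤ n)
    (hm : ∀ k l, 1 ≤ k → k < l → l ≤ n → f k < f l) (hk : 1 ≤ k) (hn : k ≤ n) : f k = k := by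
  have h1 : k ≤ f k := by
    induction k, hk using Nat.le_induction with
    | base => exact (hf 1 le_rfl hn).1
    | succ k hk ih =>
      have := ih (by omega)
      have := hm k (k + 1) hk (by omega) hn
      omega
  have h2 : f k ≤ k := by
    induction hn using Nat.decreasingInduction with
    | of_succ k hn ih =>
      by_cases hkn : k = 0
      · omega
      have h3 := hm k (k + 1) hk (by omega) hn
      have h4 : k + 1 ≤ f (k + 1) := by omega
      have := ih (by omega) h4
      omega
    | self => exact (hf n hk le_rfl).2
  omega

lemma Fits.rpd (hP : Fits n P T) (h : Tab (IsInv w) n T) : IsPD w P ∧ Reduced n P := by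
  refine ⟨⟨hP.stair, fun j h1 h2 => ?_⟩, ?_⟩
  · have hE := hP.stair.isEnum 1
    have hm := hE.mem j h1 (by omega)
    have key : permVal w.symm (northLabel n P 1 j) = j := by
      refine eq_of_strictMono_on (f := fun j => permVal w.symm (northLabel n P 1 j))
        (fun k hk hn => ?_) (fun k l hk hkl hl => ?_) h1 h2
      · have := hE.mem k hk (by omega)
        exact permVal_pos this.1 this.2
      · have m1 := hE.mem k hk (by omega)
        have m2 := hE.mem l (by omega) (by omega)
        have hs := hP.sorted 1 k l le_rfl hk hkl (by omega)
        have hne := permVal_symm_ne (w := w) (hE.inj k l hk hkl (by omega)) m1.1 m1.2 m2.1 m2.2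
        rcases hs with hs | hs
        · have := h.supp (northLabel n P 1 k) (northLabel n P 1 l)
          unfold IsInv at this
          by_contra hcon
          have := this.2 ⟨⟨m1.1, hs.1, m2.2, by omega⟩, m2.2⟩
          omega
        · have := (h.supp (northLabel n P 1 l) (northLabel n P 1 k)).1 (by omega)
          exact this.1.2.2.2
    rw [← permVal_symm_permVal (w := w) hm.1 hm.2, key]
  · intro p q i j i' j' h1 h2
    obtain ⟨a1, a2, a3, a4, a5⟩ := h1
    obtain ⟨b1, b2, b3, b4, b5⟩ := h2
    have e1 := (hP.cross_iff h a1 a2 a3).1 a4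
    have e2 := (hP.cross_iff h b1 b2 b3).1 b4
    have l1 := h.lt _ _ (show T (westLabel n P i j) (southLabel n P i j) ≠ 0 by omega)
    have l2 := h.lt _ _ (show T (westLabel n P i' j') (southLabel n P i' j') ≠ 0 by omega)
    have hs : southLabel n P i j = southLabel n P i' j' ∧
        westLabel n P i j = westLabel n P i' j' := by
      rcases a5 with ⟨a5, a6⟩ | ⟨a5, a6⟩ <;> rcases b5 with ⟨b5, b6⟩ | ⟨b5, b6⟩ <;>
        constructor <;> omega
    rw [hs.1, hs.2, e2] at e1
    subst e1
    refine ⟨rfl, ?_⟩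
    rw [southLabel_eq a2, southLabel_eq b2] at hs
    exact hP.stair.base_inj a3 b3 hs.1

/-- The row in which the pipes `i < j` cross. -/
def crossRow (n : ℕ) (P : ℕ → ℕ → Bool) (i j : ℕ) : ℕ :=
  if h : ∃ r, i < j ∧ ∃ k, CrossAt n P r k i j then h.choose else 0

lemma crossRow_eq (hR : Reduced n P) (hij : i < j) (h : CrossAt n P r k i j) :
    crossRow n P i j = r := by
  have hex : ∃ r, i < j ∧ ∃ k, CrossAt n P r k i j := ⟨r, hij, k, h⟩
  rw [crossRow, dif_pos hex]
  obtain ⟨-, k', h'⟩ := hex.choose_spec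
  exact (hR _ _ _ _ _ _ h' h).1

lemma crossAt_of_crossRow (h : crossRow n P i j = r) (hr : 1 ≤ r) :
    i < j ∧ ∃ k, CrossAt n P r k i j := by
  unfold crossRow at h
  split_ifs at h with hex
  · rw [← h]; exact hex.choose_spec
  · omega

lemma CrossAt.symm (h : CrossAt n P r k p q) : CrossAt n P r k q p := by
  unfold CrossAt at *; tauto

lemma CrossAt.mem (hP : Stair n P) (h : CrossAt n P r k p q) :
    (r ≤ p ∧ p ≤ n) ∧ r ≤ q ∧ q ≤ n := by
  obtain ⟨a1, a2, a3, a4, a5⟩ := h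
  rw [southLabel_eq a2, westLabel_eq a2 (by omega)] at a5
  have h1 := hP.base_mem (r := r) (k := k) a3
  have := @carry_le (P r) (k - 1)
  have h2 := hP.base_mem (r := r) (k := carry (P r) (k - 1)) (by omega)
  rcases a5 with ⟨rfl, rfl⟩ | ⟨rfl, rfl⟩
  · exact ⟨h2, h1⟩
  · exact ⟨h1, h2⟩

lemma fits_crossRow (hP : Stair n P) (hR : Reduced n P) : Fits n P (crossRow n P) where
  stair := hP
  sorted r := by
    rcases lt_or_ge n r with hr | hr
    · intro k l; omega
    have step : ∀ r ≤ n, (∀ k l, 1 ≤ r + 1 → 1 ≤ k → k < l → r + 1 + l ≤ n + 1 →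
        Bef (crossRow n P) (r + 1) (northLabel n P (r + 1) k) (northLabel n P (r + 1) l)) →
        ∀ k l, 1 ≤ r → 1 ≤ k → k < l → r + l ≤ n + 1 →
        Bef (crossRow n P) r (northLabel n P r k) (northLabel n P r l) := by
      intro r hrn ih a b hr ha hab hb
      have hu : ∀ k l, k < l → r + l ≤ n →
          Bef (crossRow n P) (r + 1) (base n P r k) (base n P r l) := by
        intro k l hkl hl
        unfold base
        rw [if_neg (show l ≠ 0 by omega)]
        split_ifs with h0
        · have hm := (hP.isEnum (r + 1)).mem l (by omega) (by omega)
          refine Or.inl ⟨by omega, ?_⟩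
          by_contra hc
          obtain ⟨-, k, hk⟩ := crossAt_of_crossRow (n := n) (P := P) (i := r)
            (j := northLabel n P (r + 1) l) rfl (by omega)
          have := (hk.mem hP).1.1
          omega
        · exact ih k l (by omega) (by omega) hkl (by omega)
      rw [northLabel_eq hP ha (by omega), northLabel_eq hP (by omega) hb]
      have s1 := hP.src_le ha (show r + a ≤ n + 1 by omega)
      have s2 := hP.src_le (show 1 ≤ b by omega) hb
      rcases @src_order (P r) a b ha hab with ⟨h1, h2⟩ | ⟨h1, h2, h3⟩
      · refine bef_of_bef_succ (hu _ _ h1 s2) fun e => ?_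
        obtain ⟨-, k, c1, c2, c3, c4, c5⟩ := crossAt_of_crossRow e hr
        have := @carry_le (P r) (k - 1)
        rw [southLabel_eq c2, westLabel_eq c2 (by omega)] at c5
        rcases c5 with ⟨c5, c6⟩ | ⟨c5, c6⟩
        · have c6 := hP.base_inj c3 s2 c6
          have c5 := hP.base_inj (by omega) s1 c5
          subst c6
          exact h2 ⟨c4, c5⟩
        · have c6 := hP.base_inj c3 s1 c6
          have c5 := hP.base_inj (by omega) s2 c5
          omega
      · have hc : CrossAt n P r (src (P r) a) (base n P r (src (P r) b))
            (base n P r (src (P r) a)) :=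
          ⟨hr, by omega, s1, h1, Or.inl
            ⟨by rw [westLabel_eq (by omega) (by omega), h2], southLabel_eq (by omega)⟩⟩
        have hb := hu _ _ h3 s1
        rcases hb with hb | hb
        · exact Or.inr ⟨hb.1, (crossRow_eq hR hb.1 hc).ge⟩
        · have := crossRow_eq hR hb.1 hc.symm
          omega
    induction hr using Nat.decreasingInduction with
    | of_succ r hr ih => exact step r hr.le ih
    | self => exact step n le_rfl fun k l => by omega

lemma Bef.trans_crossRow (hF : Fits n P T) {r i j k : ℕ} (hr : 1 ≤ r) (hi : r ≤ i) (hi' : i ≤ n)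
    (hj : r ≤ j) (hj' : j ≤ n) (hk : r ≤ k) (hk' : k ≤ n)
    (h1 : Bef T r i j) (h2 : Bef T r j k) : Bef T r i k := by
  obtain ⟨a, a1, a2, rfl⟩ := (hF.stair.isEnum r).surj i hi hi'
  obtain ⟨b, b1, b2, rfl⟩ := (hF.stair.isEnum r).surj j hj hj'
  obtain ⟨c, c1, c2, rfl⟩ := (hF.stair.isEnum r).surj k hk hk'
  rw [hF.bef_iff hr a1 a2 b1 b2] at h1
  rw [hF.bef_iff hr b1 b2 c1 c2] at h2
  rw [hF.bef_iff hr a1 a2 c1 c2]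
  omega

lemma CrossAt.west_south (h : CrossAt n P r k i j) (hP : Stair n P) (hR : Reduced n P)
    (hij : i < j) : westLabel n P r k = i ∧ southLabel n P r k = j := by
  have hc := crossRow_eq hR hij h
  obtain ⟨a1, a2, a3, a4, ⟨a5, a6⟩ | ⟨a5, a6⟩⟩ := h
  · exact ⟨a5, a6⟩
  exfalso
  rw [southLabel_eq a2] at a6
  rw [westLabel_eq a2 (by omega)] at a5
  have hle := @carry_le (P r) (k - 1)
  by_cases h0 : carry (P r) (k - 1) = 0
  · have := (hP.base_mem (r := r) a3).1
    simp only [h0, base, if_true] at a5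
    omega
  · rw [base, if_neg h0] at a5
    rw [base, if_neg (by omega)] at a6
    have := (fits_crossRow hP hR).sorted (r + 1) (carry (P r) (k - 1)) k (by omega) (by omega)
      (by omega) (by omega)
    rw [a5, a6, bef_iff' hij] at this
    omega

lemma tab_crossRow (hPD : IsPD w P) (hR : Reduced n P) : Tab (IsInv w) n (crossRow n P) := by
  have hP : Stair n P := hPD.1
  have hF := fits_crossRow hP hR
  have hlt : ∀ i j, crossRow n P i j ≠ 0 → i < j := fun i j h =>
    (crossAt_of_crossRow rfl (Nat.one_le_iff_ne_zero.2 h)).1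
  have hmem : ∀ i j, crossRow n P i j ≠ 0 → crossRow n P i j ≤ i ∧ j ≤ n := fun i j h => by
    obtain ⟨-, k, hk⟩ := crossAt_of_crossRow (i := i) (j := j) rfl (Nat.one_le_iff_ne_zero.2 h)
    have := hk.mem hP
    omega
  refine ⟨fun i j => ?_, hlt, fun i j => ?_, fun i i' j hii e => ?_, fun i j k hij hjk => ?_⟩
  · have key : ∀ i j, 1 ≤ i → i < j → j ≤ n →
        (crossRow n P i j ≠ 0 ↔ permVal w.symm j < permVal w.symm i) := by
      intro i j h1 h2 h3
      have p1 := permVal_pos (w := w.symm) h1 (show i ≤ n by omega)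
      have p2 := permVal_pos (w := w.symm) (show 1 ≤ j by omega) h3
      have := hF.bef_iff le_rfl p2.1 (by omega) p1.1 (by omega)
      rw [hPD.2 _ p1.1 p1.2, hPD.2 _ p2.1 p2.2, permVal_symm_permVal h1 (by omega),
        permVal_symm_permVal (by omega) h3, bef_iff' h2] at this
      omega
    constructor
    · intro h
      have h1 := hlt i j h
      have h2 := hmem i j h
      exact ⟨⟨by omega, h1, h2.2, (key i j (by omega) h1 h2.2).1 h⟩, h2.2⟩
    · rintro ⟨⟨h1, h2, h3, h4⟩, -⟩
      exact (key i j h1 h2 h3).2 h4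
  · by_cases h : crossRow n P i j = 0
    · omega
    · exact (hmem i j h).1
  · by_contra h
    obtain ⟨l1, k, hk⟩ := crossAt_of_crossRow (n := n) (P := P) (i := i) (j := j) rfl (by omega)
    obtain ⟨l2, k', hk'⟩ := crossAt_of_crossRow (n := n) (P := P) (i := i') (j := j) rfl
      (by omega)
    rw [← e] at hk'
    have e1 := hk.west_south hP hR l1
    have e2 := hk'.west_south hP hR l2
    have hs : southLabel n P (crossRow n P i j) k = southLabel n P (crossRow n P i j) k' := by
      rw [e1.2, e2.2]
    rw [southLabel_eq hk.2.1, southLabel_eq hk'.2.1] at hs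
    have := hP.base_inj hk.2.2.1 hk'.2.2.1 hs
    subst this
    omega
  · have m1 := hmem i j
    have m2 := hmem j k
    have m3 := hmem i k
    constructor
    · by_contra hc
      push Not at hc
      have h1 := m1 (by omega)
      have h2 := m2 (by omega)
      have := Bef.trans_crossRow hF (r := min (crossRow n P i j) (crossRow n P j k)) (by omega)
        (show _ ≤ k by omega) h2.2 (show _ ≤ j by omega) h1.2 (show _ ≤ i by omega) (by omega)
        ((bef_iff' hjk).2 (by omega)) ((bef_iff' hij).2 (by omega))
      rw [bef_iff' (by omega)] at this
      omega
    · by_contra hc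
      push Not at hc
      have h3 := m3 (by omega)
      have := Bef.trans_crossRow hF (r := crossRow n P i k) (by omega)
        h3.1 (by omega) (show _ ≤ j by omega) (by omega) (show _ ≤ k by omega) h3.2
        ((bef_iff hij).2 (by omega)) ((bef_iff hjk).2 (by omega))
      rw [bef_iff (by omega)] at this
      omega

end

section
variable {X X' : ℕ → Bool} {c d k l m : ℕ}

lemma carry_congr (h : ∀ l, carry X m ≤ l → l ≤ m → X' l = X l) : carry X' m = carry X m := by
  refine carry_eq carry_le ?_ fun l h1 h2 => ?_
  · by_cases h0 : carry X m = 0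
    · exact Or.inl h0
    · exact Or.inr ((h _ le_rfl carry_le).trans (not_cross_carry h0))
  · rw [h l h1.le h2]
    exact (cross_of_carry_lt h1 h2).1

lemma swap_lt_gt (h : l ≠ c) (h' : l ≠ d) : Equiv.swap c d l = l :=
  Equiv.swap_apply_of_ne_of_ne h h'

lemma src_of_true (h : X k = true) : src X k = k := by simp [src, h]

lemma src_of_false (h : X k = false) : src X k = carry X (k - 1) := by simp [src, h]

/-- The southern row of a chute rectangle. -/
lemma src_south (hc1 : 1 ≤ c) (hcd : c < d) (hc : X c = false) (hd : X d = false)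
    (hX : ∀ l, c < l → l < d → X l = true) (hXc : X' c = true) (hX' : ∀ l, l ≠ c → X' l = X l)
    (hk : 1 ≤ k) : src X' k = src X (Equiv.swap c d k) := by
  have h1 : ∀ m < c, carry X' m = carry X m := fun m hm =>
    carry_congr fun l _ hl => hX' l (by omega)
  by_cases ec : k = c
  · subst ec
    rw [Equiv.swap_apply_left, src_of_true hXc, src_of_false hd]
    exact (carry_eq (by omega) (Or.inr hc) fun l h2 h3 => hX l h2 (by omega)).symm
  by_cases ed : k = d
  · subst ed
    rw [Equiv.swap_apply_right, src_of_false hc, src_of_false ((hX' k ec).trans hd),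
      ← h1 _ (by omega)]
    refine carry_eq (by have := @carry_le X' (c - 1); omega) ?_ fun l h2 h3 => ?_
    · by_cases h0 : carry X' (c - 1) = 0
      · exact Or.inl h0
      · exact Or.inr (not_cross_carry h0)
    · rcases lt_trichotomy l c with h4 | rfl | h4
      · exact (cross_of_carry_lt h2 (by omega)).1
      · exact hXc
      · rw [hX' l (by omega)]; exact hX l h4 (by omega)
  rw [swap_lt_gt ec ed]
  by_cases hXk : X k = true
  · rw [src_of_true hXk, src_of_true ((hX' k ec).trans hXk)]
  have hXk : X k = false := by simpa using hXk
  rw [src_of_false hXk, src_of_false ((hX' k ec).trans hXk)]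
  by_cases hkc : k < c
  · exact h1 _ (by omega)
  have hkd : d < k := by
    by_contra h
    have := hX k (by omega) (by omega)
    simp [hXk] at this
  refine carry_congr fun l h2 h3 => hX' l ?_
  have := @le_carry X (k - 1) d hd (by omega)
  omega

/-- A middle row of a chute rectangle. -/
lemma src_middle (hcd : c < d) (hc : 1 ≤ c) (hX : ∀ l, c ≤ l → l ≤ d → X l = true) :
    src X (Equiv.swap c d k) = Equiv.swap c d (src X k) := by
  have tc := hX c le_rfl hcd.le
  have td := hX d hcd.le le_rfl
  by_cases ec : k = c
  · subst ec
    rw [Equiv.swap_apply_left, src_of_true tc, src_of_true td, Equiv.swap_apply_left]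
  by_cases ed : k = d
  · subst ed
    rw [Equiv.swap_apply_right, src_of_true tc, src_of_true td, Equiv.swap_apply_right]
  rw [swap_lt_gt ec ed]
  by_cases hXk : X k = true
  · rw [src_of_true hXk, swap_lt_gt ec ed]
  rw [src_of_false (by simpa using hXk)]
  refine (swap_lt_gt ?_ ?_).symm <;> intro h <;>
    have := @not_cross_carry X (k - 1) (by omega) <;> rw [h] at this <;> simp_all

/-- The northern row of a chute rectangle. -/
lemma src_north (hcd : c < d) (hc : X c = false) (hX : ∀ l, c < l → l ≤ d → X l = true)
    (hXd : X' d = false) (hX' : ∀ l, l ≠ d → X' l = X l)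
    (hk : 1 ≤ k) : src X' k = Equiv.swap c d (src X k) := by
  have h1 : ∀ m < d, carry X' m = carry X m := fun m hm =>
    carry_congr fun l _ hl => hX' l (by omega)
  have td := hX d hcd le_rfl
  by_cases ed : k = d
  · subst ed
    rw [src_of_true td, src_of_false hXd, Equiv.swap_apply_right, h1 _ (by omega)]
    exact carry_eq (by omega) (Or.inr hc) fun l h2 h3 => hX l h2 (by omega)
  by_cases hXk : X k = true
  · rw [src_of_true hXk, src_of_true ((hX' k ed).trans hXk), swap_lt_gt ?_ ed]
    rintro rfl; simp [hc] at hXk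
  have hXk : X k = false := by simpa using hXk
  rw [src_of_false hXk, src_of_false ((hX' k ed).trans hXk)]
  have hne : carry X (k - 1) ≠ d := fun h => by
    have := @not_cross_carry X (k - 1) (by omega)
    rw [h, td] at this
    simp at this
  by_cases hkd : k < d
  · have hkc : k ≤ c := by
      by_contra h
      have := hX k (by omega) (by omega)
      simp [hXk] at this
    have := @carry_le X (k - 1)
    rw [h1 _ (by omega), swap_lt_gt (by omega) hne]
  have hge := @le_carry X (k - 1) c hc (by omega)
  by_cases ec : carry X (k - 1) = c
  · rw [ec, Equiv.swap_apply_left]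
    refine carry_eq (by omega) (Or.inr hXd) fun l h2 h3 => ?_
    rw [hX' l (by omega)]
    exact (cross_of_carry_lt (show carry X (k - 1) < l by omega) h3).1
  rw [swap_lt_gt ec hne]
  have hgd : d < carry X (k - 1) := by
    by_contra h
    have := hX _ (show c < carry X (k - 1) by omega) (by omega)
    rw [@not_cross_carry X (k - 1) (by omega)] at this
    simp at this
  exact carry_congr fun l h2 h3 => hX' l (by omega)

end

section
variable {I : ℕ → ℕ → Prop} {n a b c d r k l p q i j x A B : ℕ} {P Q : ℕ → ℕ → Bool}
  {T T' : ℕ → ℕ → ℕ}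

lemma Stair.chuteResult (hP : Stair n P) (h : IsChuteRect n P a b c d) :
    Stair n (chuteResult P a b c d) := by
  obtain ⟨h1, h2, h3, h4, h5, -⟩ := h
  intro i j hij
  simp only [_root_.chuteResult] at hij
  split_ifs at hij with e1 e2
  · omega
  · exact hP i j hij

lemma northLabel_congr_above (hP : Stair n P) (hQ : Stair n Q) (h : ∀ s, r ≤ s → P s = Q s)
    (hk : 1 ≤ k) (hn : r + k ≤ n + 1) : northLabel n P r k = northLabel n Q r k := by
  obtain ⟨t, ht⟩ : ∃ t, r + t = n := ⟨n - r, by omega⟩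
  induction t generalizing r k with
  | zero =>
    have := hQ.src_le hk hn
    rw [northLabel_eq hP hk hn, northLabel_eq hQ hk hn, h r le_rfl, base, base, if_pos (by omega),
      if_pos (by omega)]
  | succ t ih =>
    have := hQ.src_le hk hn
    rw [northLabel_eq hP hk hn, northLabel_eq hQ hk hn, h r le_rfl, base, base]
    split_ifs with h0
    · rfl
    · exact ih (fun s hs => h s (by omega)) (by omega) (by omega) (by omega)

/-- A chute move exchanges the labels of the columns `c` and `d` inside its rectangle. -/
lemma northLabel_chuteResult_of_mem (hP : Stair n P) (h : IsChuteRect n P a b c d)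
    (har : a < r) (hrb : r ≤ b) (hk : 1 ≤ k) (hn : r + k ≤ n + 1) :
    northLabel n (chuteResult P a b c d) r k = northLabel n P r (Equiv.swap c d k) := by
  have hQ := hP.chuteResult h
  obtain ⟨h1, h2, h3, h4, h5, h6, h7, h8, h9⟩ := h
  have hτ : ∀ k, 1 ≤ k → r + k ≤ n + 1 →
      1 ≤ Equiv.swap c d k ∧ r + Equiv.swap c d k ≤ n + 1 := by
    intro k hk hn
    rw [Equiv.swap_apply_def]
    split_ifs <;> omega
  induction hrb using Nat.decreasingInduction generalizing k with
  | self =>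
    have hs := src_south (X := P b) (X' := chuteResult P a b c d b) (k := k) h3 h4 h7 h8
      (fun l h h' => h9 b l h2.le le_rfl h.le h'.le (by omega) (by omega) (by omega))
      (by simp [chuteResult]) (fun l hl => by simp [chuteResult, hl, h2.ne']) hk
    have h10 := hτ k hk hn
    rw [northLabel_eq hQ hk hn, northLabel_eq hP h10.1 h10.2, hs, base, base]
    have := hP.src_le h10.1 h10.2
    split_ifs with h0
    · rfl
    refine northLabel_congr_above hQ hP (fun s hs => ?_) (by omega) (by omega)
    funext k
    simp [chuteResult, show s ≠ b by omega, show s ≠ a by omega]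
  | of_succ r hrb ih =>
    have hrow : chuteResult P a b c d r = P r := by
      funext k
      simp [chuteResult, show r ≠ b by omega, show r ≠ a by omega]
    have hs := src_middle (X := P r) (k := k) h4 h3
      (fun l h h' => h9 r l har.le hrb.le h h' (by omega) (by omega) (by omega))
    have h10 := hτ k hk hn
    have h11 := hP.src_le hk hn
    rw [northLabel_eq hQ hk hn, northLabel_eq hP h10.1 h10.2, hs, base, base, hrow]
    have h0 : src (P r) k = 0 ↔ Equiv.swap c d (src (P r) k) = 0 := by
      rw [Equiv.swap_apply_def]; split_ifs <;> omega
    simp only [← h0]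
    split_ifs with h0
    · rfl
    exact ih (by omega) (by omega) (by omega) fun k hk hn => by
      rw [Equiv.swap_apply_def]
      split_ifs <;> omega

lemma northLabel_chuteResult_of_not_mem (hP : Stair n P) (h : IsChuteRect n P a b c d)
    (hr : ¬ (a < r ∧ r ≤ b)) (hk : 1 ≤ k) (hn : r + k ≤ n + 1) :
    northLabel n (chuteResult P a b c d) r k = northLabel n P r k := by
  have hQ := hP.chuteResult h
  have h' := h
  obtain ⟨h1, h2, h3, h4, h5, h6, h7, h8, h9⟩ := h'
  by_cases hra : a < r
  · refine northLabel_congr_above hQ hP (fun s hs => ?_) hk hn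
    funext k
    simp [chuteResult, show s ≠ b by omega, show s ≠ a by omega]
  replace hra : r ≤ a := by omega
  clear hr
  induction hra using Nat.decreasingInduction generalizing k with
  | self =>
    have hs := src_north (X := P a) (X' := chuteResult P a b c d a) (k := k) h4 h6
      (fun l h h' => h9 a l le_rfl h2.le h.le h' (by omega) (by omega) (by omega))
      (by simp [chuteResult, h2.ne]) (fun l hl => by simp [chuteResult, hl, h2.ne]) hk
    have h11 := hP.src_le hk hn
    rw [northLabel_eq hQ hk hn, northLabel_eq hP hk hn, hs, base, base]
    have h0 : src (P a) k = 0 ↔ Equiv.swap c d (src (P a) k) = 0 := by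
      rw [Equiv.swap_apply_def]; split_ifs <;> omega
    simp only [← h0]
    split_ifs with h00
    · rfl
    rw [northLabel_chuteResult_of_mem hP h (by omega) (by omega) (by omega)
      (by rw [Equiv.swap_apply_def]; split_ifs <;> omega), Equiv.swap_apply_self]
  | of_succ r hra ih =>
    have hrow : chuteResult P a b c d r = P r := by
      funext k
      simp [chuteResult, show r ≠ b by omega, show r ≠ a by omega]
    have h11 := hP.src_le hk hn
    rw [northLabel_eq hQ hk hn, northLabel_eq hP hk hn, base, base, hrow]
    split_ifs with h0
    · rfl
    exact ih (by omega) (by omega)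

/-- The two pipes of a chute rectangle run vertically inside it. -/
lemma northLabel_chuteRect (hP : Stair n P) (h : IsChuteRect n P a b c d)
    (har : a < r) (hrb : r ≤ b) :
    northLabel n P r c = northLabel n P b c ∧ northLabel n P r d = northLabel n P b d := by
  obtain ⟨h1, h2, h3, h4, h5, h6, h7, h8, h9⟩ := h
  induction hrb using Nat.decreasingInduction with
  | self => exact ⟨rfl, rfl⟩
  | of_succ r hrb ih =>
    have ih := ih (by omega)
    rw [← ih.1, ← ih.2, northLabel_eq hP (r := r) (k := c) (by omega) (by omega),
      northLabel_eq hP (r := r) (k := d) (by omega) (by omega),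
      src_of_true (h9 r c (by omega) (by omega) (by omega) (by omega) (by omega) (by omega)
        (by omega)),
      src_of_true (h9 r d (by omega) (by omega) (by omega) (by omega) (by omega) (by omega)
        (by omega)), base, base, if_neg (by omega), if_neg (by omega)]
    exact ⟨rfl, rfl⟩

/-- The labels of a chute move, as labels: inside the rectangle the pipes `B` and `A` are
exchanged. -/
lemma northLabel_chuteResult_eq_swap (hP : Stair n P) (h : IsChuteRect n P a b c d)
    (har : a < r) (hrb : r ≤ b) (hk : 1 ≤ k) (hn : r + k ≤ n + 1) :
    northLabel n (chuteResult P a b c d) r k =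
      Equiv.swap (northLabel n P b c) (northLabel n P b d) (northLabel n P r k) := by
  have h' := h
  obtain ⟨h1, h2, h3, h4, h5, -⟩ := h'
  have hv := northLabel_chuteRect hP h har hrb
  have hE := hP.isEnum r
  have hinj : ∀ k l, 1 ≤ k → r + k ≤ n + 1 → 1 ≤ l → r + l ≤ n + 1 →
      northLabel n P r k = northLabel n P r l → k = l := by
    intro k l k1 k2 l1 l2 e
    rcases lt_trichotomy k l with h | h | h
    · exact absurd e (hE.inj k l k1 h l2)
    · exact h
    · exact absurd e.symm (hE.inj l k l1 h k2)
  rw [northLabel_chuteResult_of_mem hP h har hrb hk hn, ← hv.1, ← hv.2]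
  by_cases ec : k = c
  · subst ec; simp
  by_cases ed : k = d
  · subst ed; simp
  rw [swap_lt_gt ec ed, swap_lt_gt]
  · exact fun e => ec (hinj _ _ hk hn h3 (by omega) e)
  · exact fun e => ed (hinj _ _ hk hn (by omega) (by omega) e)

end

section
variable {I : ℕ → ℕ → Prop} {n a b c d r k l p q i j x y A B : ℕ} {P Q : ℕ → ℕ → Bool}
  {T T' : ℕ → ℕ → ℕ}

lemma move_val : move T B A a b B A = b := by simp [move]

lemma move_of_lt (h : j < A) : move T B A a b i j = T i j := by
  simp [move, h.ne, h.not_gt]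

lemma move_of_ne (h : i ≠ B) (h' : i ≠ A) : move T B A a b i j = T i j := by
  simp [move, h, h']

lemma move_col (h : i ≠ B) : move T B A a b i A = T i A := by simp [move, h]

lemma move_row_left (h : A < j) :
    T A j = b ∧ T B j = a ∧ move T B A a b B j = b ∨
      ¬ (T A j = b ∧ T B j = a) ∧ move T B A a b B j = T B j := by
  by_cases h' : T A j = b ∧ T B j = a
  · simp [move, h, h'.1, h'.2, h.ne']
  · simp [move, h, h', h.ne']

lemma move_row_right (hBA : B < A) (h : A < j) :
    T A j = b ∧ T B j = a ∧ move T B A a b A j = a ∨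
      ¬ (T A j = b ∧ T B j = a) ∧ move T B A a b A j = T A j := by
  by_cases h' : T A j = b ∧ T B j = a
  · simp [move, h, h'.1, h'.2, h.ne', hBA.ne']
  · simp [move, h, h', h.ne']

lemma bef_move_of_mem (hF : Fits n P T) (h : Tab I n T) (hBA : B < A) (hv : T B A = a)
    (ha : 1 ≤ a) (har : a < r) (hrb : r ≤ b) (hrB : r ≤ B) (hA : A ≤ n)
    (hbet : ∀ x, r ≤ x → x ≤ n → Bef T r B x → Bef T r x A → T A x = b ∧ T B x = a)
    (hx : r ≤ x) (hx' : x ≤ n) (hy : r ≤ y) (hy' : y ≤ n) (hxy : x ≠ y)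
    (hb : Bef T r (Equiv.swap B A x) (Equiv.swap B A y)) : Bef (move T B A a b) r x y := by
  have hBA' : Bef T r B A := (bef_iff hBA).2 (by omega)
  have tr : ∀ z, r ≤ z → z ≤ n → Bef T r A z → Bef T r B z := fun z h1 h2 h3 =>
    Bef.trans_crossRow hF (by omega) hrB (by omega)
      (by omega) hA h1 h2 hBA' h3
  have tr' : ∀ z, r ≤ z → z ≤ n → Bef T r z B → Bef T r z A := fun z h1 h2 h3 =>
    Bef.trans_crossRow hF (by omega) h1 h2 hrB (by omega) (by omega) hA h3 hBA'
  have v := @move_val a b A B T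
  have right : ∀ z, r ≤ z → z ≤ n → z ≠ A → z ≠ B → Bef T r A z →
      Bef (move T B A a b) r B z := by
    intro z h1 h2 h3 h4 h5
    rcases lt_or_gt_of_ne h4 with h6 | h6
    · have := tr z h1 h2 h5
      rw [bef_iff' h6] at this ⊢
      rwa [move_of_lt hBA]
    · have := tr z h1 h2 h5
      rw [bef_iff h6] at this ⊢
      rcases lt_or_gt_of_ne h3 with h7 | h7
      · rwa [move_of_lt h7]
      · have := @move_row_left a b z A B T h7
        rw [bef_iff h7] at h5
        omega
  have left : ∀ z, r ≤ z → z ≤ n → z ≠ A → z ≠ B → Bef T r z A →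
      Bef (move T B A a b) r z B := by
    intro z h1 h2 h3 h4 h5
    rcases bef_or T r h4 with h8 | h8
    · rcases lt_or_gt_of_ne h4 with h6 | h6
      · rw [bef_iff h6] at h8 ⊢
        rwa [move_of_lt hBA]
      · rw [bef_iff' h6] at h8 ⊢
        rcases lt_or_gt_of_ne h3 with h7 | h7
        · rwa [move_of_lt h7]
        · have := @move_row_left a b z A B T h7
          omega
    · have e := hbet z h1 h2 h8 h5
      have hz := h.lt A z (by omega)
      have := @move_row_left a b z A B T hz
      rw [bef_iff' (by omega)]
      omega
  have right' : ∀ z, r ≤ z → z ≤ n → z ≠ A → z ≠ B → Bef T r B z →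
      Bef (move T B A a b) r A z := by
    intro z h1 h2 h3 h4 h5
    rcases bef_or T r h3 with h8 | h8
    · have e := hbet z h1 h2 h5 h8
      have hz := h.lt A z (by omega)
      have := @move_row_right a b z A B T hBA hz
      rw [bef_iff hz]
      omega
    · rcases lt_or_gt_of_ne h3 with h6 | h6
      · rw [bef_iff' h6] at h8 ⊢
        rwa [move_col h4]
      · rw [bef_iff h6] at h8 ⊢
        have := @move_row_right a b z A B T hBA h6
        omega
  have left' : ∀ z, r ≤ z → z ≤ n → z ≠ A → z ≠ B → Bef T r z B →
      Bef (move T B A a b) r z A := by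
    intro z h1 h2 h3 h4 h5
    have h8 := tr' z h1 h2 h5
    rcases lt_or_gt_of_ne h3 with h6 | h6
    · rw [bef_iff h6] at h8 ⊢
      rwa [move_col h4]
    · rw [bef_iff' h6] at h8 ⊢
      rw [bef_iff' (by omega)] at h5
      have := @move_row_right a b z A B T hBA h6
      omega
  by_cases xB : x = B
  · subst xB
    rw [Equiv.swap_apply_left] at hb
    by_cases yA : y = A
    · subst yA
      rw [Equiv.swap_apply_right] at hb
      exact (hb.asymm hBA').elim
    · rw [swap_lt_gt hxy.symm yA] at hb
      exact right y hy hy' yA hxy.symm hb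
  by_cases xA : x = A
  · subst xA
    rw [Equiv.swap_apply_right] at hb
    by_cases yB : y = B
    · subst yB
      rw [bef_iff' hBA]
      omega
    · rw [swap_lt_gt yB hxy.symm] at hb
      exact right' y hy hy' hxy.symm yB hb
  rw [swap_lt_gt xB xA] at hb
  by_cases yB : y = B
  · subst yB
    rw [Equiv.swap_apply_left] at hb
    exact left x hx hx' xA xB hb
  by_cases yA : y = A
  · subst yA
    rw [Equiv.swap_apply_right] at hb
    exact left' x hx hx' xA xB hb
  rw [swap_lt_gt yB yA] at hb
  unfold Bef at *
  rwa [move_of_ne xB xA, move_of_ne yB yA]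

lemma bef_move_of_not_mem (hBA : B < A) (hv : T B A = a) (hr : ¬ (a < r ∧ r ≤ b)) (hab : a < b) :
    Bef (move T B A a b) r x y ↔ Bef T r x y := by
  have key : ∀ i j, (move T B A a b i j < r ↔ T i j < r) := by
    intro i j
    unfold move
    by_cases iB : i = B
    · subst iB
      by_cases jA : j = A
      · subst jA; simp only [if_true]; omega
      · simp only [jA, if_true, if_false]; split_ifs <;> omega
    · by_cases iA : i = A
      · subst iA
        simp only [iB, if_true, if_false]; split_ifs <;> omega
      · simp [iB, iA]
  have h1 := key x y
  have h2 := key y x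
  unfold Bef
  omega

/-- The pipes entering a chute rectangle from the south between its corners. -/
lemma IsChuteRect.between (h : IsChuteRect n P a b c d) (hF : Fits n P T) (hT : Tab I n T)
    (har : a < r) (hrb : r ≤ b) (hcl : c < l) (hld : l < d) :
    T (northLabel n P b d) (northLabel n P r l) = b ∧
      T (northLabel n P b c) (northLabel n P r l) = a := by
  have hP := hF.stair
  have hr := northLabel_chuteRect hP h (r := a + 1) (by omega) (by have := h.2.1; omega)
  obtain ⟨h1, h2, h3, h4, h5, h6, h7, h8, h9⟩ := h
  have hX : ∀ s, a ≤ s → s ≤ b → P s l = true := fun s hs hs' =>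
    h9 s l hs hs' hcl.le hld.le (by omega) (by omega) (by omega)
  have const : ∀ r, a < r → r ≤ b → northLabel n P r l = northLabel n P b l := by
    intro r har hrb
    induction hrb using Nat.decreasingInduction with
    | self => rfl
    | of_succ r hrb ih =>
      rw [← ih (by omega), northLabel_eq hP (by omega) (by omega),
        src_of_true (hX r (by omega) (by omega)), base, if_neg (by omega)]
  constructor
  · have hc := (hF.cross_iff hT (r := b) (k := l) (by omega) (by omega) (by omega)).1
      (hX b (by omega) le_rfl)
    have e1 : carry (P b) (l - 1) = c := carry_eq (by omega) (Or.inr h7) fun m h10 h11 =>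
      h9 b m (by omega) le_rfl (by omega) (by omega) (by omega) (by omega) (by omega)
    have e2 : carry (P b) (d - 1) = c := carry_eq (by omega) (Or.inr h7) fun m h10 h11 =>
      h9 b m (by omega) le_rfl (by omega) (by omega) (by omega) (by omega) (by omega)
    rw [westLabel_eq (by omega) (by omega), southLabel_eq (by omega), e1] at hc
    rw [const r har hrb, northLabel_eq hP (k := d) (by omega) (by omega), src_of_false h8, e2,
      northLabel_eq hP (k := l) (by omega) (by omega), src_of_true (hX b (by omega) le_rfl), hc]
  · have hc := (hF.cross_iff hT (r := a) (k := l) (by omega) (by omega) (by omega)).1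
      (hX a le_rfl (by omega))
    have e1 : carry (P a) (l - 1) = c := carry_eq (by omega) (Or.inr h6) fun m h10 h11 =>
      h9 a m le_rfl (by omega) (by omega) (by omega) (by omega) (by omega) (by omega)
    rw [westLabel_eq (by omega) (by omega), southLabel_eq (by omega), e1, base, base,
      if_neg (by omega), if_neg (by omega), hr.1, const _ (by omega) (by omega)] at hc
    rw [const r har hrb, hc]

/-- The pipes of a chute rectangle cross at its corner. -/
lemma IsChuteRect.cross (h : IsChuteRect n P a b c d) (hF : Fits n P T) (hT : Tab I n T) :
    T (northLabel n P b c) (northLabel n P b d) = a := by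
  have hP := hF.stair
  have hr := northLabel_chuteRect hP h (r := a + 1) (by omega) (by have := h.2.1; omega)
  obtain ⟨h1, h2, h3, h4, h5, h6, h7, h8, h9⟩ := h
  have hc := (hF.cross_iff hT (r := a) (k := d) (by omega) (by omega) (by omega)).1
    (h9 a d le_rfl h2.le h4.le le_rfl (by omega) (by omega) (by omega))
  have e1 : carry (P a) (d - 1) = c := carry_eq (by omega) (Or.inr h6) fun m h10 h11 =>
    h9 a m le_rfl (by omega) (by omega) (by omega) (by omega) (by omega) (by omega)
  rwa [westLabel_eq (by omega) (by omega), southLabel_eq (by omega), e1, base, base,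
    if_neg (by omega), if_neg (by omega), hr.1, hr.2] at hc

/-- A chute move acts on tableaux by `move`. -/
lemma IsChuteRect.fits (h : IsChuteRect n P a b c d) (hF : Fits n P T) (hT : Tab I n T) :
    Fits n (chuteResult P a b c d)
      (move T (northLabel n P b c) (northLabel n P b d) a b) where
  stair := hF.stair.chuteResult h
  sorted r k l hr hk hkl hl := by
    have hP := hF.stair
    have hv := h.cross hF hT
    have h' := h
    obtain ⟨h1, h2, h3, h4, h5, -⟩ := h'
    have hBA := hT.lt _ _ (show T (northLabel n P b c) (northLabel n P b d) ≠ 0 by omega)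
    by_cases hm : a < r ∧ r ≤ b
    · have m1 := (hP.isEnum b).mem c h3 (by omega)
      have m2 := (hP.isEnum b).mem d (by omega) (by omega)
      have hE := (hP.chuteResult h).isEnum r
      have n1 := hE.mem k hk (by omega)
      have n2 := hE.mem l (by omega) hl
      refine bef_move_of_mem hF hT hBA hv h1 hm.1 hm.2 (by omega) m2.2 (fun x hx hx' b1 b2 => ?_)
        n1.1 n1.2 n2.1 n2.2 (hE.inj k l hk hkl hl) ?_
      · obtain ⟨m, l1, l2, rfl⟩ := (hP.isEnum r).surj x hx hx'
        have hr' := northLabel_chuteRect hP h hm.1 hm.2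
        rw [← hr'.1, hF.bef_iff hr h3 (by omega) l1 l2] at b1
        rw [← hr'.2, hF.bef_iff hr l1 l2 (by omega) (by omega)] at b2
        exact h.between hF hT hm.1 hm.2 b1 b2
      · rw [northLabel_chuteResult_eq_swap hP h hm.1 hm.2 hk (by omega),
          northLabel_chuteResult_eq_swap hP h hm.1 hm.2 (by omega) hl, Equiv.swap_apply_self,
          Equiv.swap_apply_self]
        exact hF.sorted r k l hr hk hkl hl
    · rw [bef_move_of_not_mem hBA hv hm h2,
        northLabel_chuteResult_of_not_mem hP h hm hk (by omega),
        northLabel_chuteResult_of_not_mem hP h hm (by omega) hl]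
      exact hF.sorted r k l hr hk hkl hl

lemma move_le (hB : b ≤ B) (hA : a ≤ A) (h : T i j ≤ i) : move T B A a b i j ≤ i := by
  unfold move
  split_ifs <;> omega

lemma move_mem (h : Tab I n T) (hBA : B < A) (hA : A ≤ n) (hb : b ≠ 0)
    (h0 : move T B A a b i j ≠ 0) : i < j ∧ j ≤ n := by
  have h1 : T i j ≠ 0 → i < j ∧ j ≤ n := fun h' => ⟨h.lt i j h', ((h.supp i j).1 h').2⟩
  unfold move at h0
  split_ifs at h0 with e1 e2 e3 e4 e5
  · omega
  · exact h1 h0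
  · have := ((h.supp A j).1 (by omega)).2
    omega
  · have := ((h.supp A j).1 (by omega)).2
    omega
  · exact h1 h0
  · exact h1 h0

lemma IsChuteRect.tabStep (h : IsChuteRect n P a b c d) (hF : Fits n P T) (hT : Tab I n T)
    (hF' : Fits n (chuteResult P a b c d) T') (hT' : Tab I n T') :
    TabStep I n T T' (northLabel n P b c) (northLabel n P b d) a b := by
  have hP := hF.stair
  have hM := h.fits hF hT
  have hv := h.cross hF hT
  have h' := h
  obtain ⟨h1, h2, h3, h4, h5, h6, h7, h8, h9⟩ := h'
  have hBA := hT.lt _ _ (show T (northLabel n P b c) (northLabel n P b d) ≠ 0 by omega)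
  have m1 := (hP.isEnum b).mem c h3 (by omega)
  have m2 := (hP.isEnum b).mem d (by omega) (by omega)
  refine ⟨hT, hT', hBA, hv, by omega, h2, fun r har hrb => ?_, ?_⟩
  · have hX : ∀ l, c ≤ l → l ≤ d → P r l = true := fun l hl hl' =>
      h9 r l (by omega) (by omega) hl hl' (by omega) (by omega) (by omega)
    have e1 := (hF.cross_iff hT (r := r) (k := c) (by omega) (by omega) (by omega)).1
      (hX c le_rfl h4.le)
    have e2 := (hF.cross_iff hT (r := r) (k := d) (by omega) (by omega) (by omega)).1
      (hX d h4.le le_rfl)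
    have e3 : carry (P r) (d - 1) = carry (P r) (c - 1) := by
      refine carry_eq (by have := @carry_le (P r) (c - 1); omega) ?_ fun m h10 h11 => ?_
      · by_cases h0 : carry (P r) (c - 1) = 0
        · exact Or.inl h0
        · exact Or.inr (not_cross_carry h0)
      · by_cases hm : m < c
        · exact (cross_of_carry_lt h10 (by omega)).1
        · exact hX m (by omega) (by omega)
    have hr := northLabel_chuteRect hP h (r := r + 1) (by omega) (by omega)
    have b1 : base n P r c = northLabel n P b c := by rw [base, if_neg (by omega), hr.1]
    have b2 : base n P r d = northLabel n P b d := by rw [base, if_neg (by omega), hr.2]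
    rw [westLabel_eq (by omega) (by omega), southLabel_eq (by omega), b1] at e1
    rw [westLabel_eq (by omega) (by omega), southLabel_eq (by omega), e3, b2] at e2
    exact ⟨_, hT.lt _ _ (show _ ≠ 0 by rw [e1]; omega), e2⟩
  · funext i j
    have hle : move T (northLabel n P b c) (northLabel n P b d) a b i j ≤ i :=
      move_le m1.1 (by omega) (hT.le i j)
    have hle' := hT'.le i j
    have hmem : T' i j ≠ 0 → i < j ∧ j ≤ n := fun h0 =>
      ⟨hT'.lt i j h0, ((hT'.supp i j).1 h0).2⟩
    have hmem' := @move_mem I n a b i j _ _ T hT hBA m2.2 (by omega)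
    have key : i < j → j ≤ n → ∀ r, 1 ≤ r → r ≤ i →
        (r ≤ T' i j ↔ r ≤ move T (northLabel n P b c) (northLabel n P b d) a b i j) := by
      intro hij hj r hr hri
      rw [← bef_iff' hij, ← bef_iff' hij]
      obtain ⟨k, k1, k2, rfl⟩ := (hF'.stair.isEnum r).surj i hri (by omega)
      obtain ⟨l, l1, l2, rfl⟩ := (hF'.stair.isEnum r).surj j (by omega) hj
      rw [hF'.bef_iff hr l1 l2 k1 k2, hM.bef_iff hr l1 l2 k1 k2]
    by_cases h0 : i < j ∧ j ≤ n
    · have k1 := key h0.1 h0.2 (T' i j)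
      have k2 := key h0.1 h0.2 (move T (northLabel n P b c) (northLabel n P b d) a b i j)
      omega
    · rw [not_ne_iff.1 (mt hmem h0), not_ne_iff.1 (mt hmem' h0)]

lemma TabStep.between (s : TabStep I n T T' B A a b) (hxB : x ≠ B) (hxA : x ≠ A)
    (h1 : Bef T b B x) (h2 : Bef T b x A) : A < x ∧ T A x = b ∧ T B x = a := by
  have hlt := s.lt
  have hab := s.ab
  have v := s.val'
  have hv := s.val
  rcases lt_or_gt_of_ne hxB with h3 | h3
  · rw [bef_iff' h3] at h1
    rw [bef_iff (by omega)] at h2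
    have b1 := s.tab'.bal x B A h3 hlt
    have e1 := s.of_ne (j := A) hxB hxA
    have e2 := s.of_ne (j := B) hxB hxA
    omega
  rw [bef_iff h3] at h1
  rcases lt_or_gt_of_ne hxA with h4 | h4
  · rw [bef_iff h4] at h2
    have b1 := s.tab'.bal B x A h3 h4
    have e1 := s.of_ne (j := A) hxB hxA
    have e2 := s.of_lt (i := B) h4
    omega
  · rw [bef_iff' h4] at h2
    have b1 := s.tab'.bal B A x hlt h4
    have e1 := @move_row_left a b x A B T h4
    have e2 := @move_row_right a b x A B T hlt h4
    rw [← s.eq] at e1 e2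
    omega

/-- Every elementary increase of the tableau of `P` comes from a chute rectangle. -/
lemma TabStep.exists_isChuteRect (s : TabStep I n T T' B A a b) (hF : Fits n P T) :
    ∃ c d, IsChuteRect n P a b c d ∧ northLabel n P b c = B ∧ northLabel n P b d = A := by
  have hP := hF.stair
  have hT := s.tab
  have hlt := s.lt
  have hab := s.ab
  have v := s.val'
  have hv := s.val
  have hA := s.le_N
  have ha := s.pos
  have hbB := s.tab'.le B A
  obtain ⟨c, c1, c2, hB⟩ := (hP.isEnum b).surj B (by omega) (by omega)
  obtain ⟨d, d1, d2, hA'⟩ := (hP.isEnum b).surj A (by omega) hA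
  have hcd : c < d := by
    rw [← hF.bef_iff (by omega) c1 c2 d1 d2, hB, hA', bef_iff hlt]
    omega
  have south : ∀ r k, 1 ≤ k → southLabel n P r k = northLabel n P (r + 1) k := fun r k hk => by
    rw [southLabel_eq hk, base, if_neg (by omega)]
  have vertical : ∀ r, a < r → r ≤ b → northLabel n P r c = B ∧ northLabel n P r d = A ∧
      (r < b → P r c = true ∧ P r d = true ∧
        carry (P r) (d - 1) = carry (P r) (c - 1)) := by
    intro r har hrb
    induction hrb using Nat.decreasingInduction with
    | self => exact ⟨hB, hA', by omega⟩
    | of_succ r hrb ih =>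
      obtain ⟨ih1, ih2, -⟩ := ih (by omega)
      obtain ⟨h, hhB, hh⟩ := s.fill r har hrb
      have hh' := s.fill_col hhB (by omega) (by omega)
      have s1 := south r c c1
      have s2 := south r d d1
      have v1 := hF.vert hT (r := r) (k := c) (i := h) (by omega) c1 (by omega)
        (by rw [s1, ih1]; omega)
      have v2 := hF.vert hT (r := r) (k := d) (i := h) (by omega) d1 (by omega)
        (by rw [s2, ih2]; omega)
      refine ⟨?_, ?_, fun _ => ⟨v1.1, v2.1, ?_⟩⟩
      · rw [northLabel_eq hP c1 (by omega), src_of_true v1.1, base, if_neg (by omega), ih1]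
      · rw [northLabel_eq hP d1 (by omega), src_of_true v2.1, base, if_neg (by omega), ih2]
      · have e := v2.2.symm.trans v1.2
        rw [westLabel_eq d1 (by omega), westLabel_eq c1 (by omega)] at e
        have l1 := @carry_le (P r) (d - 1)
        have l2 := @carry_le (P r) (c - 1)
        exact hP.base_inj (by omega) (by omega) e
  have top := vertical (a + 1) (by omega) (by omega)
  have hda : P a d = true ∧ carry (P a) (d - 1) = c := by
    have s2 := south a d d1
    have v2 := hF.vert hT (r := a) (k := d) (i := B) (by omega) d1 (by omega)
      (by rw [s2, top.2.1]; omega)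
    refine ⟨v2.1, ?_⟩
    have l1 := @carry_le (P a) (d - 1)
    have e := v2.2
    rw [westLabel_eq d1 (by omega)] at e
    refine hP.base_inj (r := a) (by omega) (by omega) ?_
    rw [← e, base, if_neg (by omega), top.1]
  have hbd : P b d = false := by
    by_contra h
    have h : P b d = true := by simpa using h
    have hle := hP _ _ h
    have e := (hF.cross_iff hT (by omega) d1 hle.2.2).1 h
    rw [northLabel_eq hP d1 d2, src_of_true h] at hA'
    rw [southLabel_eq d1, hA'] at e
    exact s.ne_b _ e
  have hbc : P b c = false := by
    by_contra h
    have h : P b c = true := by simpa using h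
    have e := (hF.cross_iff hT (by omega) c1 (by omega)).1 h
    rw [northLabel_eq hP c1 c2, src_of_true h] at hB
    rw [southLabel_eq c1, hB] at e
    set x := westLabel n P b c
    have hx := hT.lt x B (by omega)
    have hne := s.ne_b x
    have e1 := s.of_lt (i := x) hlt
    have e2 := s.col_ne (i := x) (by omega)
    have b1 := s.tab'.bal x B A hx hlt
    omega
  refine ⟨c, d, ⟨by omega, hab, c1, hcd, d2, ?_, hbc, hbd, fun i j i1 i2 j1 j2 n1 n2 n3 => ?_⟩,
    hB, hA'⟩
  · rw [← hda.2]
    exact not_cross_carry (by omega)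
  rcases i1.eq_or_lt with rfl | i1
  · by_cases hj : j = d
    · rw [hj]; exact hda.1
    · exact (cross_of_carry_lt (k := d - 1) (by omega) (by omega)).1
  rcases i2.lt_or_eq with i2 | rfl
  · have hv := (vertical i i1 i2.le).2.2 i2
    by_cases hj : j = d
    · rw [hj]; exact hv.2.1
    · have := @carry_le (P i) (c - 1)
      exact (cross_of_carry_lt (k := d - 1) (by omega) (by omega)).1
  · by_contra hX
    have hX : P i j = false := by simpa using hX
    have m := (hP.isEnum i).mem j (by omega) (by omega)
    have hbet := s.between (x := northLabel n P i j)
      (by rw [← hB]; exact ((hP.isEnum i).inj c j c1 (by omega) (by omega)).symm)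
      (by rw [← hA']; exact (hP.isEnum i).inj j d (by omega) (by omega) (by omega))
      (by rw [← hB, hF.bef_iff (by omega) c1 c2 (by omega) (by omega)]; omega)
      (by rw [← hA', hF.bef_iff (by omega) (by omega) (by omega) d1 d2]; omega)
    rw [northLabel_eq hP (by omega) (by omega), src_of_false hX] at hbet
    have hle := @carry_le (P i) (j - 1)
    by_cases h0 : carry (P i) (j - 1) = 0
    · rw [h0, base, if_pos rfl] at hbet
      omega
    · rw [← southLabel_eq (by omega)] at hbet
      have := hF.vert hT (r := i) (k := carry (P i) (j - 1)) (i := A) (by omega) (by omega)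
        (by omega) hbet.2.1
      rw [not_cross_carry h0] at this
      simp at this

end

section
variable {n : ℕ} {w : Equiv.Perm (Fin n)} {P Q : RPD w} {T : ℕ → ℕ → ℕ}

lemma fits_rpd (P : RPD w) : Fits n P.1 (crossRow n P.1) := fits_crossRow P.2.1.1 P.2.2

lemma tab_rpd (P : RPD w) : Tab (IsInv w) n (crossRow n P.1) := tab_crossRow P.2.1 P.2.2

lemma exists_rpd (h : Tab (IsInv w) n T) : ∃ P : RPD w, crossRow n P.1 = T := by
  let P : RPD w := ⟨pdOf n T, h.fits_pdOf.rpd h⟩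
  exact ⟨P, (fits_rpd P).tab_unique h.fits_pdOf (tab_rpd P) h⟩

lemma rankLE_of_chuteLE (h : chuteLE w P Q) : RankLE (crossRow n P.1) (crossRow n Q.1) := by
  induction h with
  | refl => exact RankLE.refl _
  | @tail Q R _ hs ih =>
    obtain ⟨a, b, c, d, hr, e⟩ := hs
    exact ih.trans (hr.tabStep (fits_rpd Q) (tab_rpd Q) (e ▸ fits_rpd R) (tab_rpd R)).rankLE

lemma chuteLE_of_reach {T' : ℕ → ℕ → ℕ} (h : Reach (IsInv w) n T T')
    (hP : crossRow n P.1 = T) (hQ : crossRow n Q.1 = T') : chuteLE w P Q := by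
  induction h generalizing Q with
  | refl =>
    have : P = Q := Subtype.ext
      ((fits_rpd P).pd_unique (hP.trans hQ.symm ▸ fits_rpd Q) (tab_rpd P))
    subst this
    exact Relation.ReflTransGen.refl
  | @tail R R' _ hs ih =>
    obtain ⟨B, A, a, b, s⟩ := hs
    obtain ⟨X, rfl⟩ := exists_rpd s.tab
    refine (ih rfl).tail ?_
    obtain ⟨c, d, hr, rfl, rfl⟩ := s.exists_isChuteRect (fits_rpd X)
    refine ⟨a, b, c, d, hr, ?_⟩
    have hF := hr.fits (fits_rpd X) s.tab
    rw [← s.eq, ← hQ] at hF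
    exact (fits_rpd Q).pd_unique hF (tab_rpd Q)

/-- The chute move order is the comparison of tableaux by rank. -/
lemma chuteLE_iff : chuteLE w P Q ↔ RankLE (crossRow n P.1) (crossRow n Q.1) :=
  ⟨rankLE_of_chuteLE, fun h => chuteLE_of_reach
    ((Tab.reach_and_join_and_meet n).1 _ _ (tab_rpd P) (tab_rpd Q) h) rfl rfl⟩

lemma isMeetOf_iff {M : RPD w} : IsMeetOf w M P Q ↔
    TabMeet (IsInv w) n (crossRow n M.1) (crossRow n P.1) (crossRow n Q.1) := by
  unfold IsMeetOf
  simp only [chuteLE_iff]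
  refine ⟨fun h => ⟨h.1, h.2.1, fun U hU h1 h2 => ?_⟩,
    fun h => ⟨h.left, h.right, fun R h1 h2 => h.univ _ (tab_rpd R) h1 h2⟩⟩
  obtain ⟨R, rfl⟩ := exists_rpd hU
  exact h.2.2 R h1 h2

lemma isJoinOf_iff {J : RPD w} : IsJoinOf w J P Q ↔
    TabJoin (IsInv w) n (crossRow n J.1) (crossRow n P.1) (crossRow n Q.1) := by
  unfold IsJoinOf
  simp only [chuteLE_iff]
  refine ⟨fun h => ⟨h.1, h.2.1, fun U hU h1 h2 => ?_⟩,
    fun h => ⟨h.left, h.right, fun R h1 h2 => h.univ _ (tab_rpd R) h1 h2⟩⟩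
  obtain ⟨R, rfl⟩ := exists_rpd hU
  exact h.2.2 R h1 h2

end

/-- the lattice `PD(w)` is semidistributive: for all `α ≤ β`, the set
`{γ : γ ⊓ β = α}` has a maximum element, and the set `{γ : γ ⊔ α = β}` has a
minimum element. -/
theorem chute_poset_semidistributive {n : ℕ} (w : Equiv.Perm (Fin n)) :
    (∀ α β : RPD w, chuteLE w α β →
      ∃ μ, IsMeetOf w α μ β ∧ ∀ γ, IsMeetOf w α γ β → chuteLE w γ μ) ∧
      ∀ α β : RPD w, chuteLE w α β →
        ∃ ν, IsJoinOf w β ν α ∧ ∀ γ, IsJoinOf w β γ α → chuteLE w ν γ := by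
  simp only [chuteLE_iff, isMeetOf_iff, isJoinOf_iff]
  constructor
  · intro α β h
    obtain ⟨μ, hμ, h1, h2⟩ := Tab.exists_max_tabMeet (tab_rpd α) (tab_rpd β) h
    obtain ⟨M, rfl⟩ := exists_rpd hμ
    exact ⟨M, h1, fun γ => h2 _ (tab_rpd γ)⟩
  · intro α β h
    obtain ⟨ν, hν, h1, h2⟩ := Tab.exists_min_tabJoin (tab_rpd α) (tab_rpd β) h
    obtain ⟨M, rfl⟩ := exists_rpd hν
    exact ⟨M, h1, fun γ => h2 _ (tab_rpd γ)⟩
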